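/- Upper bound via the Aizenman–Sims–Starr scheme: In the perturbed bipartite model with q_u = q_v = 0, s_n = n^{−1/4} and (a_u,a_v) uniform on [1,2]², limsup_{n→∞} F_n(λ) ≤ limsup_{n→∞} E_a[𝓕(λ, E⟨v⁽¹⁾·v⁽²⁾⟩_n, E⟨u⁽¹⁾·u⁽²⁾⟩_n)], where E_a denotes expectation over (a_u,a_v). -/

import Mathlib

open MeasureTheory ProbabilityTheory Filter Real
open scoped Topology

noncomputable section

/-- Standard Gaussian measure on `ℝ`. -/
def stdG : Measure ℝ := gaussianReal 0 1

/-- The weight `exp(√γ·x·z + γ·x·x₀ − γ·x²/2)` appearing in the scalar Gaussian channel. -/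
def scalarWeight (γ x₀ z x : ℝ) : ℝ :=
  Real.exp (Real.sqrt γ * x * z + γ * x * x₀ - γ * x ^ 2 / 2)

/-- Free energy `ψ_P(γ)` of the scalar Gaussian channel with prior `P`. -/
def psiF (P : Measure ℝ) [IsProbabilityMeasure P] (γ : ℝ) : ℝ :=
  ∫ p : ℝ × ℝ, Real.log (∫ x, scalarWeight γ p.1 p.2 x ∂P) ∂(P.prod stdG)

/-- Posterior mean `⟨x⟩_γ` in the scalar Gaussian channel (`x₀` is the signal, `z` the noise). -/
def postMean (P : Measure ℝ) (γ x₀ z : ℝ) : ℝ :=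
  (∫ x, x * scalarWeight γ x₀ z x ∂P) / (∫ x, scalarWeight γ x₀ z x ∂P)

/-- Overlap `F_P(γ) = E[X₀·⟨x⟩_γ]` of the scalar Gaussian channel. -/
def Fov (P : Measure ℝ) [IsProbabilityMeasure P] (γ : ℝ) : ℝ :=
  ∫ p : ℝ × ℝ, p.1 * postMean P γ p.1 p.2 ∂(P.prod stdG)

/-- The set `Γ(λ)` of fixed points of the state evolution equations. -/
def Gam (PU PV : Measure ℝ) [IsProbabilityMeasure PU] [IsProbabilityMeasure PV]
    (lam : ℝ) : Set (ℝ × ℝ) :=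
  {q | 0 ≤ q.1 ∧ 0 ≤ q.2 ∧ q.2 = Fov PU (lam * q.1) ∧ q.1 = Fov PV (lam * q.2)}

/-- The replica-symmetric potential `𝓕(λ,q₁,q₂)`. -/
def rsF (PU PV : Measure ℝ) [IsProbabilityMeasure PU] [IsProbabilityMeasure PV]
    (lam q₁ q₂ : ℝ) : ℝ :=
  psiF PU (lam * q₁) + psiF PV (lam * q₂) - lam / 2 * q₁ * q₂

/-- Prior distribution of the pair of vectors `(u,v)`. -/
def prior (PU PV : Measure ℝ) [IsProbabilityMeasure PU] [IsProbabilityMeasure PV]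
    (n : ℕ) : Measure ((Fin n → ℝ) × (Fin n → ℝ)) :=
  (Measure.pi fun _ => PU).prod (Measure.pi fun _ => PV)

/-- Law of the Gaussian noise matrix `Z`. -/
def noiseM (n : ℕ) : Measure (Fin n → Fin n → ℝ) :=
  Measure.pi fun _ => Measure.pi fun _ => stdG

/-- Joint law of `((U,V),Z)`. -/
def sampleM (PU PV : Measure ℝ) [IsProbabilityMeasure PU] [IsProbabilityMeasure PV]
    (n : ℕ) : Measure (((Fin n → ℝ) × (Fin n → ℝ)) × (Fin n → Fin n → ℝ)) :=
  (prior PU PV n).prod (noiseM n)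

/-- Hamiltonian `H_n(u,v)` of the planted bipartite model. -/
def Ham (lam : ℝ) (n : ℕ) (U V : Fin n → ℝ) (Z : Fin n → Fin n → ℝ)
    (u v : Fin n → ℝ) : ℝ :=
  ∑ i : Fin n, ∑ j : Fin n,
    (Real.sqrt (lam / n) * u i * v j * Z i j
      + lam / n * (u i * U i * v j * V j)
      - lam / (2 * n) * (u i ^ 2 * v j ^ 2))

/-- Partition function `Z_n = ∫ e^{H_n(u,v)} dP₀ⁿ(u,v)`. -/
def partFun (PU PV : Measure ℝ) [IsProbabilityMeasure PU] [IsProbabilityMeasure PV]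
    (lam : ℝ) (n : ℕ)
    (ω : ((Fin n → ℝ) × (Fin n → ℝ)) × (Fin n → Fin n → ℝ)) : ℝ :=
  ∫ uv, Real.exp (Ham lam n ω.1.1 ω.1.2 ω.2 uv.1 uv.2) ∂(prior PU PV n)

/-- Free energy `F_n(λ) = (1/n)·E[log Z_n]`. -/
def freeEnergy (PU PV : Measure ℝ) [IsProbabilityMeasure PU] [IsProbabilityMeasure PV]
    (n : ℕ) (lam : ℝ) : ℝ :=
  (1 / (n : ℝ)) * ∫ ω, Real.log (partFun PU PV lam n ω) ∂(sampleM PU PV n)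

/-- Gibbs (posterior) expectation `⟨f(u,v)⟩` given the realization `ω = ((U,V),Z)`. -/
def gibbs (PU PV : Measure ℝ) [IsProbabilityMeasure PU] [IsProbabilityMeasure PV]
    (lam : ℝ) (n : ℕ)
    (ω : ((Fin n → ℝ) × (Fin n → ℝ)) × (Fin n → Fin n → ℝ))
    (f : (Fin n → ℝ) × (Fin n → ℝ) → ℝ) : ℝ :=
  (∫ uv, f uv * Real.exp (Ham lam n ω.1.1 ω.1.2 ω.2 uv.1 uv.2) ∂(prior PU PV n))
    / partFun PU PV lam n ω

/-- Rescaled scalar product `x·y = (1/n)·Σᵢ xᵢyᵢ`. -/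
def ovDot (n : ℕ) (x y : Fin n → ℝ) : ℝ := (1 / (n : ℝ)) * ∑ i, x i * y i

/-- Law of a vector of `n` i.i.d. standard Gaussians. -/
def gvec (n : ℕ) : Measure (Fin n → ℝ) := Measure.pi fun _ => stdG

/-- Joint law of `((U,V), Z, ((Z^u,Z^v),(z^u,z^v)))`: signal, noise matrix and the four
extra Gaussian vectors of the side channels and of the perturbation. -/
def sampleP (PU PV : Measure ℝ) [IsProbabilityMeasure PU] [IsProbabilityMeasure PV]
    (n : ℕ) :
    Measure ((((Fin n → ℝ) × (Fin n → ℝ)) × (Fin n → Fin n → ℝ)) ×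
      (((Fin n → ℝ) × (Fin n → ℝ)) × ((Fin n → ℝ) × (Fin n → ℝ)))) :=
  (sampleM PU PV n).prod (((gvec n).prod (gvec n)).prod ((gvec n).prod (gvec n)))

/-- The perturbation strength `s_n = n^{-1/4}`. -/
def sSeq (n : ℕ) : ℝ := (n : ℝ) ^ (-(1 / 4 : ℝ))

/-- Total Hamiltonian `H_n^{(tot)} = H_n + H_n^{(s)} + H_n^{(pert)}`, where
`ω = (((U,V),Z), ((Z^u,Z^v),(z^u,z^v)))`. -/
def HamTot (lam qu qv : ℝ) (n : ℕ) (au av : ℝ)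
    (ω : (((Fin n → ℝ) × (Fin n → ℝ)) × (Fin n → Fin n → ℝ)) ×
      (((Fin n → ℝ) × (Fin n → ℝ)) × ((Fin n → ℝ) × (Fin n → ℝ))))
    (u v : Fin n → ℝ) : ℝ :=
  Ham lam n ω.1.1.1 ω.1.1.2 ω.1.2 u v
  + (∑ i : Fin n,
      (Real.sqrt (lam * qu) * u i * ω.2.1.1 i + lam * qu * u i * ω.1.1.1 i
          - lam * qu / 2 * u i ^ 2
        + Real.sqrt (lam * qv) * v i * ω.2.1.2 i + lam * qv * v i * ω.1.1.2 i
          - lam * qv / 2 * v i ^ 2))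
  + (∑ i : Fin n,
      (Real.sqrt (sSeq n) * au * ω.2.2.1 i * u i + sSeq n * au ^ 2 * u i * ω.1.1.1 i
        - sSeq n * au ^ 2 / 2 * u i ^ 2))
  + (∑ i : Fin n,
      (Real.sqrt (sSeq n) * av * ω.2.2.2 i * v i + sSeq n * av ^ 2 * v i * ω.1.1.2 i
        - sSeq n * av ^ 2 / 2 * v i ^ 2))

/-- Gibbs expectation `⟨f(u,v)⟩_n` for the total Hamiltonian. -/
def gibbsTot (PU PV : Measure ℝ) [IsProbabilityMeasure PU] [IsProbabilityMeasure PV]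
    (lam qu qv : ℝ) (n : ℕ) (au av : ℝ)
    (ω : (((Fin n → ℝ) × (Fin n → ℝ)) × (Fin n → Fin n → ℝ)) ×
      (((Fin n → ℝ) × (Fin n → ℝ)) × ((Fin n → ℝ) × (Fin n → ℝ))))
    (f : (Fin n → ℝ) × (Fin n → ℝ) → ℝ) : ℝ :=
  (∫ uv, f uv * Real.exp (HamTot lam qu qv n au av ω uv.1 uv.2) ∂(prior PU PV n))
    / ∫ uv, Real.exp (HamTot lam qu qv n au av ω uv.1 uv.2) ∂(prior PU PV n)

/-- `E⟨u⁽¹⁾·u⁽²⁾⟩_n`. -/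
def EovU (PU PV : Measure ℝ) [IsProbabilityMeasure PU] [IsProbabilityMeasure PV]
    (lam qu qv : ℝ) (n : ℕ) (au av : ℝ) : ℝ :=
  ∫ ω, gibbsTot PU PV lam qu qv n au av ω
      (fun uv1 => gibbsTot PU PV lam qu qv n au av ω
        (fun uv2 => ovDot n uv1.1 uv2.1)) ∂(sampleP PU PV n)

/-- `E⟨v⁽¹⁾·v⁽²⁾⟩_n`. -/
def EovV (PU PV : Measure ℝ) [IsProbabilityMeasure PU] [IsProbabilityMeasure PV]
    (lam qu qv : ℝ) (n : ℕ) (au av : ℝ) : ℝ :=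
  ∫ ω, gibbsTot PU PV lam qu qv n au av ω
      (fun uv1 => gibbsTot PU PV lam qu qv n au av ω
        (fun uv2 => ovDot n uv1.2 uv2.2)) ∂(sampleP PU PV n)

namespace ASS

set_option linter.unusedSectionVars false
set_option autoImplicit false

instance : IsProbabilityMeasure stdG := by unfold stdG; infer_instance

/-- Product standard Gaussian measure. -/
def gp (ι : Type*) [Fintype ι] : Measure (ι → ℝ) := Measure.pi fun _ => stdG

instance (ι : Type*) [Fintype ι] : IsProbabilityMeasure (gp ι) := by unfold gp; infer_instance

lemma integrable_id_stdG : Integrable (fun z : ℝ => z) stdG :=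
  (memLp_id_gaussianReal (μ := 0) (v := 1) 1).integrable (by norm_num)

lemma integrable_abs_stdG : Integrable (fun z : ℝ => |z|) stdG := integrable_id_stdG.abs

lemma integrable_sq_stdG : Integrable (fun z : ℝ => z ^ 2) stdG :=
  (memLp_id_gaussianReal (μ := 0) (v := 1) 2).integrable_sq

lemma integral_id_stdG : ∫ z, z ∂stdG = 0 := integral_id_gaussianReal

lemma integral_sq_stdG : ∫ z, z ^ 2 ∂stdG = 1 := by
  have h := variance_fun_id_gaussianReal (μ := 0) (v := 1)
  rw [variance_eq_integral (by fun_prop)] at h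
  simpa [stdG] using h

/-- Stein's lemma in one dimension. -/
lemma stein1 {g g' : ℝ → ℝ} {C : ℝ} (hg : ∀ y, HasDerivAt g (g' y) y)
    (hgm : Measurable g') (hb : ∀ y, |g y| ≤ C) (hb' : ∀ y, |g' y| ≤ C) :
    ∫ z, z * g z ∂stdG = ∫ z, g' z ∂stdG := by
  have hgc : Continuous g := continuous_iff_continuousAt.2 fun y => (hg y).continuousAt
  unfold stdG
  rw [integral_gaussianReal_eq_integral_smul (by norm_num),
    integral_gaussianReal_eq_integral_smul (by norm_num)]
  have hφ : ∀ y, HasDerivAt (gaussianPDFReal 0 1) (-(y * gaussianPDFReal 0 1 y)) y := by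
    intro y
    have h1 : HasDerivAt (fun x : ℝ => (√(2 * π * (1 : NNReal)))⁻¹ * rexp (-(x - 0) ^ 2 / (2 * (1 : NNReal))))
        ((√(2 * π * (1 : NNReal)))⁻¹ * (rexp (-(y - 0) ^ 2 / (2 * (1 : NNReal))) * (-(2 * (y - 0)) / (2 * (1 : NNReal))))) y := by
      have h2 : HasDerivAt (fun x : ℝ => -(x - 0) ^ 2 / (2 * ((1 : NNReal) : ℝ)))
          (-(2 * (y - 0)) / (2 * (1 : NNReal))) y := by
        have := ((((hasDerivAt_id y).sub_const 0).pow 2).neg).div_const (2 * ((1 : NNReal) : ℝ))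
        refine this.congr_deriv ?_
        simp
      exact (h2.exp).const_mul _
    rw [gaussianPDFReal_def]
    refine h1.congr_deriv ?_
    simp
    ring
  have hφi : Integrable (gaussianPDFReal 0 1) := integrable_gaussianPDFReal 0 1
  have hzφ : Integrable (fun z => z * gaussianPDFReal 0 1 z) := by
    have := integrable_id_stdG
    unfold stdG at this
    rw [gaussianReal_of_var_ne_zero _ (by norm_num)] at this
    unfold gaussianPDF at this
    rw [integrable_withDensity_iff_integrable_smul₀'] at this
    · refine this.congr (ae_of_all _ fun z => ?_)
      simp [ENNReal.toReal_ofReal (gaussianPDFReal_nonneg 0 1 z), mul_comm]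
    · exact (measurable_gaussianPDFReal 0 1).ennreal_ofReal.aemeasurable
    · simp
  have key := integral_mul_deriv_eq_deriv_mul_of_integrable (u := g) (v := gaussianPDFReal 0 1)
    (u' := g') (v' := fun y => -(y * gaussianPDFReal 0 1 y)) (fun y _ => hg y) (fun y _ => hφ y) ?_ ?_ ?_
  · calc _ = - ∫ x, g x * -(x * gaussianPDFReal 0 1 x) := by
          rw [← integral_neg]; congr 1; ext x; simp; ring
      _ = ∫ x, g' x * gaussianPDFReal 0 1 x := by rw [key]; simp
      _ = _ := by congr 1; ext x; simp [mul_comm]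
  · exact hzφ.neg.bdd_mul hgc.aestronglyMeasurable (c := C) (ae_of_all _ (by simpa using hb))
  · exact hφi.bdd_mul hgm.aestronglyMeasurable (c := C) (ae_of_all _ (by simpa using hb'))
  · exact hφi.bdd_mul hgc.aestronglyMeasurable (c := C) (ae_of_all _ (by simpa using hb))

section upd
variable {ι : Type*} [Fintype ι] [DecidableEq ι] {α : ι → Type*} [∀ i, MeasurableSpace (α i)]
  (μ : ∀ i, Measure (α i)) [∀ i, IsProbabilityMeasure (μ i)]

lemma mp_update (k : ι) : MeasurePreserving
    (fun q : (∀ i, α i) × α k => Function.update q.1 k q.2)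
    ((Measure.pi μ).prod (μ k)) (Measure.pi μ) := by
  have hm : Measurable (fun q : (∀ i, α i) × α k => Function.update q.1 k q.2) := by
    rw [measurable_pi_iff]
    intro j
    by_cases h : j = k
    · subst h; simpa using measurable_snd
    · simp only [Function.update_of_ne h]; fun_prop
  refine ⟨hm, ?_⟩
  refine (Measure.pi_eq fun s hs => ?_).symm
  rw [Measure.map_apply hm (MeasurableSet.univ_pi hs)]
  have : (fun q : (∀ i, α i) × α k => Function.update q.1 k q.2) ⁻¹' (Set.univ.pi s)
      = (Set.univ.pi (Function.update s k Set.univ)) ×ˢ (s k) := by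
    ext ⟨z, y⟩
    simp only [Set.mem_preimage, Set.mem_pi, Set.mem_univ, true_implies, Set.mem_prod]
    constructor
    · intro h
      refine ⟨fun i => ?_, by simpa using h k⟩
      by_cases hi : i = k
      · subst hi; simp
      · simpa [Function.update_of_ne hi] using h i
    · rintro ⟨h1, h2⟩ i
      by_cases hi : i = k
      · subst hi; simpa using h2
      · simpa [Function.update_of_ne hi] using h1 i
  rw [this, Measure.prod_prod, Measure.pi_pi]
  rw [← Finset.mul_prod_erase Finset.univ _ (Finset.mem_univ k),
    ← Finset.mul_prod_erase Finset.univ (fun i => μ i (s i)) (Finset.mem_univ k)]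
  simp only [Function.update_self, measure_univ, one_mul]
  rw [mul_comm]
  congr 1
  refine Finset.prod_congr rfl fun i hi => ?_
  rw [Function.update_of_ne (Finset.ne_of_mem_erase hi)]

lemma integral_update (k : ι) {f : (∀ i, α i) → ℝ} (hf : Integrable f (Measure.pi μ)) :
    ∫ z, f z ∂(Measure.pi μ) = ∫ z, ∫ y, f (Function.update z k y) ∂(μ k) ∂(Measure.pi μ) := by
  have mp := mp_update μ k
  have h := integral_map (f := f) mp.measurable.aemeasurable
      (by rw [mp.map_eq]; exact hf.aestronglyMeasurable)
  rw [mp.map_eq] at h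
  rw [h, integral_prod]
  exact mp.integrable_comp_of_integrable hf

end upd

variable {ι : Type*} [Fintype ι] [DecidableEq ι]

lemma integrable_coord (k : ι) : Integrable (fun z : ι → ℝ => z k) (gp ι) :=
  (measurePreserving_eval (fun _ : ι => stdG) k).integrable_comp_of_integrable integrable_id_stdG

/-- Stein's lemma for a product Gaussian measure. -/
lemma stein (k : ι) {h h' : (ι → ℝ) → ℝ} {C : ℝ}
    (hd : ∀ z, HasDerivAt (fun y => h (Function.update z k y)) (h' z) (z k))
    (hm : Measurable h) (hm' : Measurable h') (hb : ∀ z, |h z| ≤ C) (hb' : ∀ z, |h' z| ≤ C) :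
    ∫ z, z k * h z ∂gp ι = ∫ z, h' z ∂gp ι := by
  have mp := mp_update (fun _ : ι => stdG) k
  have i1 : Integrable (fun z : ι → ℝ => z k * h z) (gp ι) :=
    (integrable_coord k).mul_bdd (c := C) hm.aestronglyMeasurable (ae_of_all _ (by simpa using hb))
  have i2 : Integrable h' (gp ι) :=
    Integrable.of_bound hm'.aestronglyMeasurable C (ae_of_all _ (by simpa using hb'))
  have e1 : ∫ z, z k * h z ∂gp ι = ∫ z, ∫ y, y * h (Function.update z k y) ∂stdG ∂gp ι := by
    have := integral_update (fun _ : ι => stdG) k i1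
    simpa [gp] using this
  have e2 : ∫ z, h' z ∂gp ι = ∫ z, ∫ y, h' (Function.update z k y) ∂stdG ∂gp ι :=
    integral_update (fun _ : ι => stdG) k i2
  rw [e1, e2]
  congr 1
  ext z
  refine stein1 (C := C) (fun y => ?_) ?_ (fun y => hb _) (fun y => hb' _)
  · have := hd (Function.update z k y)
    simpa using this
  · exact hm'.comp (measurable_update z)

/-- One-dimensional Cameron-Martin. -/
lemma cm1 (c : ℝ) : gaussianReal c 1 = stdG.withDensity
    (fun z => ENNReal.ofReal (rexp (c * z - c ^ 2 / 2))) := by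
  unfold stdG
  rw [gaussianReal_of_var_ne_zero _ (by norm_num), gaussianReal_of_var_ne_zero _ (by norm_num),
    ← withDensity_mul _ (by fun_prop) (by fun_prop)]
  congr 1
  ext z
  simp only [gaussianPDF, Pi.mul_apply]
  rw [← ENNReal.ofReal_mul (gaussianPDFReal_nonneg _ _ _)]
  congr 1
  simp only [gaussianPDFReal]
  rw [mul_assoc _ (rexp _) (rexp _), ← Real.exp_add]
  congr 2
  simp
  ring

lemma cm_measure (c : ι → ℝ) : (gp ι).map (fun z k => c k + z k) = (gp ι).withDensity
    (fun z => ENNReal.ofReal (rexp (∑ k, (c k * z k - c k ^ 2 / 2)))) := by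
  have h1 : (gp ι).map (fun z k => c k + z k) = Measure.pi (fun k => gaussianReal (c k) 1) := by
    have := Measure.pi_map_pi (μ := fun _ : ι => stdG) (f := fun k z => c k + z)
      (fun k => by fun_prop)
    unfold gp
    rw [this]
    congr 1
    ext1 k
    unfold stdG
    rw [gaussianReal_map_const_add, zero_add]
  rw [h1]
  refine Measure.pi_eq fun s hs => ?_
  rw [withDensity_apply _ (MeasurableSet.univ_pi hs)]
  have hi : ∀ k, Integrable (fun z => rexp (c k * z - c k ^ 2 / 2)) stdG := by
    intro k
    have := (integrable_exp_mul_gaussianReal (μ := 0) (v := 1) (c k)).mul_const (rexp (- (c k ^ 2 / 2)))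
    refine this.congr (ae_of_all _ fun z => ?_)
    simp only
    rw [← Real.exp_add]; ring_nf
  have e1 : ∀ k, (gaussianReal (c k) 1) (s k) = ENNReal.ofReal
      (∫ z, (s k).indicator (fun z => rexp (c k * z - c k ^ 2 / 2)) z ∂stdG) := by
    intro k
    rw [cm1, withDensity_apply _ (hs k), integral_indicator (hs k),
      ofReal_integral_eq_lintegral_ofReal (hi k).integrableOn (ae_of_all _ fun z => (Real.exp_pos _).le)]
  simp_rw [e1]
  rw [← ENNReal.ofReal_prod_of_nonneg (fun k _ => integral_nonneg fun z =>
    Set.indicator_nonneg (fun _ _ => (Real.exp_pos _).le) _)]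
  have := integral_fintype_prod_eq_prod (𝕜 := ℝ) (μ := fun _ : ι => stdG)
    (fun k z => (s k).indicator (fun z => rexp (c k * z - c k ^ 2 / 2)) z)
  rw [← this]
  have e2 : ∀ z : ι → ℝ, ∏ k, (s k).indicator (fun z => rexp (c k * z - c k ^ 2 / 2)) (z k)
      = (Set.univ.pi s).indicator (fun z => rexp (∑ k, (c k * z k - c k ^ 2 / 2))) z := by
    intro z
    by_cases hz : z ∈ Set.univ.pi s
    · rw [Set.indicator_of_mem hz, Real.exp_sum]
      refine Finset.prod_congr rfl fun k _ => ?_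
      rw [Set.indicator_of_mem (hz k trivial)]
    · rw [Set.indicator_of_notMem hz]
      simp only [Set.mem_pi, Set.mem_univ, true_implies, not_forall] at hz
      obtain ⟨k, hk⟩ := hz
      exact Finset.prod_eq_zero (Finset.mem_univ k) (Set.indicator_of_notMem hk _)
  simp_rw [e2]
  rw [integral_indicator (MeasurableSet.univ_pi hs),
    ofReal_integral_eq_lintegral_ofReal _ (ae_of_all _ fun z => (Real.exp_pos _).le)]
  · rfl
  · have : Integrable (fun z : ι → ℝ => ∏ k, rexp (c k * z k - c k ^ 2 / 2)) (gp ι) :=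
      Integrable.fintype_prod (f := fun k z => rexp (c k * z - c k ^ 2 / 2)) hi
    refine Integrable.integrableOn (this.congr (ae_of_all _ fun z => ?_))
    simp only
    rw [Real.exp_sum]

lemma cm_integral (c : ι → ℝ) {φ : (ι → ℝ) → ℝ} (hφ : Measurable φ) :
    ∫ z, φ (fun k => c k + z k) ∂gp ι
      = ∫ z, φ z * rexp (∑ k, (c k * z k - c k ^ 2 / 2)) ∂gp ι := by
  have hm : Measurable (fun (z : ι → ℝ) k => c k + z k) := by fun_prop
  rw [← integral_map (φ := fun (z : ι → ℝ) k => c k + z k) (f := φ) hm.aemeasurable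
    hφ.aestronglyMeasurable, cm_measure,
    integral_withDensity_eq_integral_toReal_smul (by fun_prop) (by simp)]
  congr 1
  ext z
  simp [ENNReal.toReal_ofReal (Real.exp_pos _).le, mul_comm]

lemma cm_integrable (c : ι → ℝ) {φ : (ι → ℝ) → ℝ} (hφ : Measurable φ) {C : ℝ}
    (hC : ∀ z, |φ z| ≤ C) :
    Integrable (fun z => φ z * rexp (∑ k, (c k * z k - c k ^ 2 / 2))) (gp ι) := by
  have hm : Measurable (fun (z : ι → ℝ) k => c k + z k) := by fun_prop
  have hm2 : Measurable (fun z : ι → ℝ => ENNReal.ofReal (rexp (∑ k, (c k * z k - c k ^ 2 / 2)))) := by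
    fun_prop
  have h : Integrable φ ((gp ι).map (fun z k => c k + z k)) := by
    have : IsProbabilityMeasure ((gp ι).map (fun z k => c k + z k)) :=
      Measure.isProbabilityMeasure_map (hm.aemeasurable)
    exact Integrable.of_bound hφ.aestronglyMeasurable C (ae_of_all _ (by simpa using hC))
  rw [cm_measure, integrable_withDensity_iff_integrable_smul₀' hm2.aemeasurable (by simp)] at h
  refine h.congr (ae_of_all _ fun z => ?_)
  simp [ENNReal.toReal_ofReal (Real.exp_pos _).le, mul_comm]

end ASS

namespace ASS

set_option linter.unusedSectionVars false
set_option autoImplicit false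

section model
variable {σ ι : Type*} [Fintype σ] [Fintype ι] [DecidableEq ι]

/-- Unnormalized Gibbs weight. -/
def wt (p : σ → ℝ) (x : σ → ι → ℝ) (γ b : ι → ℝ) (s : σ) : ℝ :=
  p s * rexp (∑ k, (x s k * b k - γ k * x s k ^ 2 / 2))

/-- Partition function (likelihood ratio). -/
def Lf (p : σ → ℝ) (x : σ → ι → ℝ) (γ b : ι → ℝ) : ℝ := ∑ s, wt p x γ b s

/-- Gibbs average of an observable. -/
def av (p : σ → ℝ) (x : σ → ι → ℝ) (a : σ → ℝ) (γ b : ι → ℝ) : ℝ :=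
  (∑ s, a s * wt p x γ b s) / Lf p x γ b

/-- Observation. -/
def pl (x : σ → ι → ℝ) (γ : ι → ℝ) (s : σ) (z : ι → ℝ) : ι → ℝ :=
  fun k => γ k * x s k + √(γ k) * z k

/-- Planted expectation. -/
def EP (p : σ → ℝ) (x : σ → ι → ℝ) (γ : ι → ℝ) (φ : σ → (ι → ℝ) → ℝ) : ℝ :=
  ∑ s, p s * ∫ z, φ s (pl x γ s z) ∂gp ι

/-- Linear path of signal to noise ratios. -/
def lp (γ d : ι → ℝ) (t : ℝ) : ι → ℝ := fun k => γ k + t * d k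

/-- `p` is a probability vector. -/
structure Prob (p : σ → ℝ) : Prop where
  nn : ∀ s, 0 ≤ p s
  sum : ∑ s, p s = 1

variable {p : σ → ℝ} {x : σ → ι → ℝ}

lemma wt_nonneg (hp : Prob p) (γ b : ι → ℝ) (s : σ) : 0 ≤ wt p x γ b s :=
  mul_nonneg (hp.nn s) (Real.exp_pos _).le

lemma Lf_pos (hp : Prob p) (γ b : ι → ℝ) : 0 < Lf p x γ b := by
  have : ∃ s, 0 < p s := by
    by_contra h
    push Not at h
    have h2 : ∑ s, p s ≤ 0 := Finset.sum_nonpos fun s _ => h s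
    rw [hp.sum] at h2; linarith
  obtain ⟨s, hs⟩ := this
  exact Finset.sum_pos' (fun s _ => wt_nonneg hp γ b s) ⟨s, Finset.mem_univ s, mul_pos hs (Real.exp_pos _)⟩

lemma av_mono (hp : Prob p) {a a' : σ → ℝ} (h : ∀ s, a s ≤ a' s) (γ b : ι → ℝ) :
    av p x a γ b ≤ av p x a' γ b := by
  unfold av
  refine div_le_div_of_nonneg_right ?_ (Lf_pos hp γ b).le
  exact Finset.sum_le_sum fun s _ => mul_le_mul_of_nonneg_right (h s) (wt_nonneg hp γ b s)

lemma av_const (hp : Prob p) (c : ℝ) (γ b : ι → ℝ) : av p x (fun _ => c) γ b = c := by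
  unfold av
  rw [← Finset.mul_sum]
  exact mul_div_cancel_right₀ _ (Lf_pos hp γ b).ne'

lemma av_add (a a' : σ → ℝ) (γ b : ι → ℝ) :
    av p x (fun s => a s + a' s) γ b = av p x a γ b + av p x a' γ b := by
  unfold av; rw [← add_div, ← Finset.sum_add_distrib]; simp_rw [add_mul]

lemma av_smul (c : ℝ) (a : σ → ℝ) (γ b : ι → ℝ) :
    av p x (fun s => c * a s) γ b = c * av p x a γ b := by
  unfold av; rw [← mul_div_assoc, Finset.mul_sum]; simp_rw [mul_assoc]

lemma av_sum {κ : Type*} (u : Finset κ) (a : κ → σ → ℝ) (γ b : ι → ℝ) :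
    av p x (fun s => ∑ i ∈ u, a i s) γ b = ∑ i ∈ u, av p x (a i) γ b := by
  unfold av
  rw [← Finset.sum_div]
  congr 1
  rw [Finset.sum_comm]
  simp_rw [Finset.sum_mul]

lemma av_abs_le (hp : Prob p) {a : σ → ℝ} {C : ℝ} (h : ∀ s, |a s| ≤ C) (γ b : ι → ℝ) :
    |av p x a γ b| ≤ C := by
  rw [abs_le]
  constructor
  · have := av_mono (x := x) hp (a := fun _ => -C) (a' := a) (fun s => (abs_le.1 (h s)).1) γ b
    rwa [av_const hp] at this
  · have := av_mono (x := x) hp (a := a) (a' := fun _ => C) (fun s => (abs_le.1 (h s)).2) γ b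
    rwa [av_const hp] at this

lemma continuous_wt (s : σ) : Continuous (fun q : (ι → ℝ) × (ι → ℝ) => wt p x q.1 q.2 s) := by
  unfold wt; fun_prop

lemma continuous_Lf : Continuous (fun q : (ι → ℝ) × (ι → ℝ) => Lf p x q.1 q.2) := by
  unfold Lf; exact continuous_finsetSum _ fun s _ => continuous_wt s

lemma continuous_av (hp : Prob p) (a : σ → ℝ) :
    Continuous (fun q : (ι → ℝ) × (ι → ℝ) => av p x a q.1 q.2) := by
  unfold av
  refine Continuous.div ?_ continuous_Lf fun q => (Lf_pos hp _ _).ne'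
  exact continuous_finsetSum _ fun s _ => continuous_const.mul (continuous_wt s)

lemma measurable_av (hp : Prob p) (a : σ → ℝ) (γ : ι → ℝ) : Measurable (av p x a γ) :=
  ((continuous_av hp a).comp (Continuous.prodMk_right γ)).measurable

lemma continuous_logL (hp : Prob p) :
    Continuous (fun q : (ι → ℝ) × (ι → ℝ) => Real.log (Lf p x q.1 q.2)) :=
  continuous_Lf.log fun q => (Lf_pos hp _ _).ne'

lemma measurable_logL (hp : Prob p) (γ : ι → ℝ) : Measurable (fun b => Real.log (Lf p x γ b)) :=
  ((continuous_logL hp).comp (Continuous.prodMk_right γ)).measurable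

/-- Linear growth of the log-likelihood. -/
lemma logL_bound (hp : Prob p) {B : ℝ} (hB : ∀ s k, |x s k| ≤ B) (γ b : ι → ℝ) :
    |Real.log (Lf p x γ b)| ≤ ∑ k, (B * |b k| + |γ k| * B ^ 2) := by
  set R := ∑ k, (B * |b k| + |γ k| * B ^ 2) with hR
  have h : ∀ s, |∑ k, (x s k * b k - γ k * x s k ^ 2 / 2)| ≤ R := by
    intro s
    refine (Finset.abs_sum_le_sum_abs _ _).trans (Finset.sum_le_sum fun k _ => ?_)
    have h1 : |x s k * b k| ≤ B * |b k| := by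
      rw [abs_mul]; exact mul_le_mul_of_nonneg_right (hB s k) (abs_nonneg _)
    have h2 : |γ k * x s k ^ 2 / 2| ≤ |γ k| * B ^ 2 := by
      rw [abs_div, abs_mul, abs_of_nonneg (sq_nonneg (x s k)), abs_two]
      have : x s k ^ 2 ≤ B ^ 2 := by
        rw [← sq_abs]; exact pow_le_pow_left₀ (abs_nonneg _) (hB s k) 2
      have := mul_le_mul_of_nonneg_left this (abs_nonneg (γ k))
      have h0 : 0 ≤ |γ k| * x s k ^ 2 := by positivity
      linarith
    exact (abs_sub _ _).trans (add_le_add h1 h2)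
  have hu : Lf p x γ b ≤ rexp R := by
    calc Lf p x γ b ≤ ∑ s, p s * rexp R := Finset.sum_le_sum fun s _ =>
          mul_le_mul_of_nonneg_left (Real.exp_le_exp.2 (abs_le.1 (h s)).2) (hp.nn s)
      _ = rexp R := by rw [← Finset.sum_mul, hp.sum, one_mul]
  have hl : rexp (-R) ≤ Lf p x γ b := by
    calc rexp (-R) = ∑ s, p s * rexp (-R) := by rw [← Finset.sum_mul, hp.sum, one_mul]
      _ ≤ _ := Finset.sum_le_sum fun s _ =>
          mul_le_mul_of_nonneg_left (Real.exp_le_exp.2 (abs_le.1 (h s)).1) (hp.nn s)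
  rw [abs_le]
  exact ⟨(Real.le_log_iff_exp_le (Lf_pos hp γ b)).2 hl, (Real.log_le_iff_le_exp (Lf_pos hp γ b)).2 hu⟩

lemma continuous_pl (γ : ι → ℝ) (s : σ) : Continuous (pl x γ s) := by unfold pl; fun_prop

lemma EP_congr {γ : ι → ℝ} {φ φ' : σ → (ι → ℝ) → ℝ} (h : ∀ s b, φ s b = φ' s b) :
    EP p x γ φ = EP p x γ φ' := by
  have : φ = φ' := by ext s b; exact h s b
  rw [this]

/-- Integrability of all planted components. -/
def EI (x : σ → ι → ℝ) (γ : ι → ℝ) (φ : σ → (ι → ℝ) → ℝ) : Prop :=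
  ∀ s, Integrable (fun z => φ s (pl x γ s z)) (gp ι)

lemma EI_of_bdd {γ : ι → ℝ} {φ : σ → (ι → ℝ) → ℝ} {C : ℝ} (hm : ∀ s, Measurable (φ s))
    (hC : ∀ s b, |φ s b| ≤ C) : EI x γ φ := fun s =>
  Integrable.of_bound ((hm s).comp (continuous_pl γ s).measurable).aestronglyMeasurable C
    (ae_of_all _ fun z => by simpa using hC s _)

lemma integrable_lin (c : ι → ℝ) (c0 : ℝ) :
    Integrable (fun z : ι → ℝ => c0 + ∑ k, c k * |z k|) (gp ι) :=
  (integrable_const c0).add (integrable_finsetSum _ fun k _ => ((integrable_coord k).abs).const_mul _)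

lemma EI_logL (hp : Prob p) {B : ℝ} (hB : ∀ s k, |x s k| ≤ B) (γ γ' : ι → ℝ) :
    EI x γ (fun _ b => Real.log (Lf p x γ' b)) := by
  intro s
  have hB0 : 0 ≤ B ∨ IsEmpty ι := by
    rcases isEmpty_or_nonempty ι with h | ⟨⟨k⟩⟩
    · exact Or.inr h
    · exact Or.inl ((abs_nonneg _).trans (hB s k))
  refine (integrable_lin (fun k => B * |√(γ k)|) (∑ k, (B * |γ k * x s k| + |γ' k| * B ^ 2))).mono'
    ((measurable_logL hp γ').comp (continuous_pl γ s).measurable).aestronglyMeasurable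
    (ae_of_all _ fun z => ?_)
  rw [Real.norm_eq_abs]
  refine (logL_bound hp hB γ' _).trans ?_
  rw [← Finset.sum_add_distrib]
  refine Finset.sum_le_sum fun k _ => ?_
  have hB0 : 0 ≤ B := (abs_nonneg _).trans (hB s k)
  have : |pl x γ s z k| ≤ |γ k * x s k| + |√(γ k)| * |z k| := by
    unfold pl; rw [← abs_mul]; exact abs_add_le _ _
  nlinarith [mul_le_mul_of_nonneg_left this hB0]

lemma EP_add {γ : ι → ℝ} {φ ψ : σ → (ι → ℝ) → ℝ} (h1 : EI x γ φ) (h2 : EI x γ ψ) :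
    EP p x γ (fun s b => φ s b + ψ s b) = EP p x γ φ + EP p x γ ψ := by
  unfold EP
  rw [← Finset.sum_add_distrib]
  refine Finset.sum_congr rfl fun s _ => ?_
  rw [integral_add (h1 s) (h2 s), mul_add]

lemma EP_sub {γ : ι → ℝ} {φ ψ : σ → (ι → ℝ) → ℝ} (h1 : EI x γ φ) (h2 : EI x γ ψ) :
    EP p x γ (fun s b => φ s b - ψ s b) = EP p x γ φ - EP p x γ ψ := by
  unfold EP
  rw [← Finset.sum_sub_distrib]
  refine Finset.sum_congr rfl fun s _ => ?_
  rw [integral_sub (h1 s) (h2 s), mul_sub]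

lemma EP_smul {γ : ι → ℝ} (c : ℝ) (φ : σ → (ι → ℝ) → ℝ) :
    EP p x γ (fun s b => c * φ s b) = c * EP p x γ φ := by
  unfold EP
  rw [Finset.mul_sum]
  refine Finset.sum_congr rfl fun s _ => ?_
  rw [integral_const_mul]; ring

lemma EP_sum {κ : Type*} (u : Finset κ) {γ : ι → ℝ} {φ : κ → σ → (ι → ℝ) → ℝ}
    (h : ∀ i ∈ u, EI x γ (φ i)) :
    EP p x γ (fun s b => ∑ i ∈ u, φ i s b) = ∑ i ∈ u, EP p x γ (φ i) := by
  unfold EP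
  rw [Finset.sum_comm]
  refine Finset.sum_congr rfl fun s _ => ?_
  rw [integral_finsetSum _ (fun i hi => h i hi s), Finset.mul_sum]

lemma EP_const (hp : Prob p) {γ : ι → ℝ} (c : ℝ) : EP p x γ (fun _ _ => c) = c := by
  unfold EP
  simp [← Finset.sum_mul, hp.sum]

lemma EP_mono (hp : Prob p) {γ : ι → ℝ} {φ ψ : σ → (ι → ℝ) → ℝ} (h1 : EI x γ φ) (h2 : EI x γ ψ)
    (h : ∀ s b, φ s b ≤ ψ s b) : EP p x γ φ ≤ EP p x γ ψ :=
  Finset.sum_le_sum fun s _ => mul_le_mul_of_nonneg_left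
    (integral_mono (h1 s) (h2 s) fun z => h s _) (hp.nn s)

lemma EP_nonneg (hp : Prob p) {γ : ι → ℝ} {φ : σ → (ι → ℝ) → ℝ}
    (h : ∀ s b, 0 ≤ φ s b) : 0 ≤ EP p x γ φ :=
  Finset.sum_nonneg fun s _ => mul_nonneg (hp.nn s) (integral_nonneg fun z => h s _)

lemma EP_abs_le (hp : Prob p) {γ : ι → ℝ} {φ : σ → (ι → ℝ) → ℝ} {C : ℝ}
    (h : ∀ s b, |φ s b| ≤ C) : |EP p x γ φ| ≤ C := by
  unfold EP
  calc _ ≤ ∑ s, |p s * ∫ z, φ s (pl x γ s z) ∂gp ι| := Finset.abs_sum_le_sum_abs _ _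
    _ ≤ ∑ s, p s * C := by
        refine Finset.sum_le_sum fun s _ => ?_
        rw [abs_mul, abs_of_nonneg (hp.nn s)]
        refine mul_le_mul_of_nonneg_left ?_ (hp.nn s)
        have := norm_integral_le_of_norm_le_const (μ := gp ι) (f := fun z => φ s (pl x γ s z)) (C := C)
          (ae_of_all _ fun z => by simpa using h s _)
        simpa using this
    _ = C := by rw [← Finset.sum_mul, hp.sum, one_mul]

/-- Nishimori identity. -/
lemma nishimori (hp : Prob p) {γ : ι → ℝ} (hγ : ∀ k, 0 ≤ γ k) (a : σ → ℝ) {φ : (ι → ℝ) → ℝ}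
    (hm : Measurable φ) {C : ℝ} (hC : ∀ b, |φ b| ≤ C) :
    EP p x γ (fun s b => a s * φ b) = EP p x γ (fun _ b => av p x a γ b * φ b) := by
  have key : ∀ (a : σ → ℝ) (ψ : (ι → ℝ) → ℝ), Measurable ψ → (∃ C, ∀ b, |ψ b| ≤ C) →
      EP p x γ (fun s b => a s * ψ b) = ∫ z, ψ (fun k => √(γ k) * z k) *
        ∑ s, a s * wt p x γ (fun k => √(γ k) * z k) s ∂gp ι := by
    intro a ψ hψ ⟨C, hC⟩
    have hψ' : Measurable (fun z : ι → ℝ => ψ (fun k => √(γ k) * z k)) :=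
      hψ.comp (by fun_prop)
    have e : ∀ s, p s * ∫ z, a s * ψ (pl x γ s z) ∂gp ι
        = ∫ z, ψ (fun k => √(γ k) * z k) * (a s * wt p x γ (fun k => √(γ k) * z k) s) ∂gp ι := by
      intro s
      have h := cm_integral (fun k => √(γ k) * x s k) hψ'
      have h2 : ∀ z : ι → ℝ, pl x γ s z = fun k => √(γ k) * (√(γ k) * x s k + z k) := by
        intro z; ext k; unfold pl
        rw [mul_add, ← mul_assoc, Real.mul_self_sqrt (hγ k)]
      simp_rw [h2]
      rw [integral_const_mul, h, ← integral_const_mul, ← integral_const_mul]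
      congr 1; ext z
      unfold wt
      have h3 : ∀ k, √(γ k) * x s k * z k - (√(γ k) * x s k) ^ 2 / 2
          = x s k * (√(γ k) * z k) - γ k * x s k ^ 2 / 2 := by
        intro k; rw [mul_pow, Real.sq_sqrt (hγ k)]; ring
      simp_rw [h3]; ring
    unfold EP
    simp_rw [e]
    rw [← integral_finsetSum]
    · simp_rw [Finset.mul_sum]
    · intro s _
      have := (cm_integrable (fun k => √(γ k) * x s k) hψ' (C := C) (fun z => hC _)).const_mul (a s * p s)
      refine this.congr (ae_of_all _ fun z => ?_)
      unfold wt
      have h3 : ∀ k, √(γ k) * x s k * z k - (√(γ k) * x s k) ^ 2 / 2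
          = x s k * (√(γ k) * z k) - γ k * x s k ^ 2 / 2 := by
        intro k; rw [mul_pow, Real.sq_sqrt (hγ k)]; ring
      simp_rw [h3]; ring
  rw [key a φ hm ⟨C, hC⟩]
  have h2 := key (fun _ => 1) (fun b => av p x a γ b * φ b) ((measurable_av hp a γ).mul hm)
    ⟨(∑ s, |a s|) * C, fun b => ?_⟩
  · simp only [one_mul] at h2
    rw [h2]
    congr 1; ext z
    have hL := (Lf_pos (x := x) hp γ (fun k => √(γ k) * z k)).ne'
    change _ = _ * Lf p x γ (fun k => √(γ k) * z k)
    unfold av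
    field_simp
  · rw [abs_mul]
    refine mul_le_mul (av_abs_le hp (fun s => ?_) γ b) (hC b) (abs_nonneg _)
      (Finset.sum_nonneg fun _ _ => abs_nonneg _)
    exact Finset.single_le_sum (f := fun s => |a s|) (fun _ _ => abs_nonneg _) (Finset.mem_univ s)

end model
end ASS

namespace ASS

set_option linter.unusedSectionVars false
set_option linter.unusedVariables false
set_option autoImplicit false

section good
variable {σ ι : Type*} [Fintype σ] [Fintype ι] [DecidableEq ι]

/-- Chain rule along arbitrary paths, i.e. (a weak form of) joint differentiability. -/
def HasPath (T : Set ℝ) (g gt : ℝ → (ι → ℝ) → ℝ) (g1 : ι → ℝ → (ι → ℝ) → ℝ) : Prop :=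
  ∀ (τ : ℝ → ℝ) (b : ℝ → ι → ℝ) (τ' r : ℝ) (b' : ι → ℝ), τ r ∈ T → HasDerivAt τ τ' r →
    (∀ k, HasDerivAt (fun q => b q k) (b' k) r) →
    HasDerivAt (fun q => g (τ q) (b q)) (gt (τ r) (b r) * τ' + ∑ k, g1 k (τ r) (b r) * b' k) r

lemma HasPath.coord {T : Set ℝ} {g gt : ℝ → (ι → ℝ) → ℝ} {g1 : ι → ℝ → (ι → ℝ) → ℝ}
    (h : HasPath T g gt g1) {t : ℝ} (ht : t ∈ T) (b : ι → ℝ) (k : ι) :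
    HasDerivAt (fun y => g t (Function.update b k y)) (g1 k t b) (b k) := by
  have := h (fun _ => t) (fun y => Function.update b k y) 0 (b k) (Pi.single k 1) ht
    (hasDerivAt_const _ _) (fun j => ?_)
  · refine this.congr_deriv ?_
    simp [Pi.single_apply]
  · by_cases hj : j = k
    · subst hj; simp only [Function.update_self, Pi.single_eq_same]; exact hasDerivAt_id' (b j)
    · simp only [Function.update_of_ne hj, Pi.single_eq_of_ne hj]
      exact hasDerivAt_const _ _

lemma HasPath.mul {T : Set ℝ} {g gt h ht : ℝ → (ι → ℝ) → ℝ} {g1 h1 : ι → ℝ → (ι → ℝ) → ℝ}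
    (hg : HasPath T g gt g1) (hh : HasPath T h ht h1) :
    HasPath T (fun t b => g t b * h t b) (fun t b => gt t b * h t b + g t b * ht t b)
      (fun k t b => g1 k t b * h t b + g t b * h1 k t b) := by
  intro τ b τ' r b' hr hτ hb
  refine ((hg τ b τ' r b' hr hτ hb).mul (hh τ b τ' r b' hr hτ hb)).congr_deriv ?_
  rw [add_mul, mul_add, Finset.sum_mul, Finset.mul_sum]
  have : ∀ k, (g1 k (τ r) (b r) * h (τ r) (b r) + g (τ r) (b r) * h1 k (τ r) (b r)) * b' k
      = g1 k (τ r) (b r) * b' k * h (τ r) (b r) + g (τ r) (b r) * (h1 k (τ r) (b r) * b' k) := by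
    intro k; ring
  simp_rw [this]
  rw [Finset.sum_add_distrib]
  ring

lemma HasPath.sub {T : Set ℝ} {g gt h ht : ℝ → (ι → ℝ) → ℝ} {g1 h1 : ι → ℝ → (ι → ℝ) → ℝ}
    (hg : HasPath T g gt g1) (hh : HasPath T h ht h1) :
    HasPath T (fun t b => g t b - h t b) (fun t b => gt t b - ht t b)
      (fun k t b => g1 k t b - h1 k t b) := by
  intro τ b τ' r b' hr hτ hb
  refine ((hg τ b τ' r b' hr hτ hb).sub (hh τ b τ' r b' hr hτ hb)).congr_deriv ?_
  simp_rw [sub_mul]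
  rw [Finset.sum_sub_distrib]
  ring

lemma HasPath.sum {κ : Type*} (u : Finset κ) {T : Set ℝ} {g gt : κ → ℝ → (ι → ℝ) → ℝ}
    {g1 : κ → ι → ℝ → (ι → ℝ) → ℝ} (hg : ∀ i ∈ u, HasPath T (g i) (gt i) (g1 i)) :
    HasPath T (fun t b => ∑ i ∈ u, g i t b) (fun t b => ∑ i ∈ u, gt i t b)
      (fun k t b => ∑ i ∈ u, g1 i k t b) := by
  intro τ b τ' r b' hr hτ hb
  refine (HasDerivAt.fun_sum fun i hi => hg i hi τ b τ' r b' hr hτ hb).congr_deriv ?_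
  rw [Finset.sum_add_distrib, Finset.sum_mul]
  congr 1
  rw [Finset.sum_comm]
  simp_rw [Finset.sum_mul]

lemma HasPath.comp {T : Set ℝ} {g gt : ℝ → (ι → ℝ) → ℝ} {g1 : ι → ℝ → (ι → ℝ) → ℝ}
    (hg : HasPath T g gt g1) {f f' : ℝ → ℝ} (hf : ∀ y, HasDerivAt f (f' y) y) :
    HasPath T (fun t b => f (g t b)) (fun t b => f' (g t b) * gt t b)
      (fun k t b => f' (g t b) * g1 k t b) := by
  intro τ b τ' r b' hr hτ hb
  refine ((hf _).comp r (hg τ b τ' r b' hr hτ hb)).congr_deriv ?_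
  simp_rw [mul_add, Finset.mul_sum, mul_assoc]

lemma HasPath.time {T : Set ℝ} {c c' : ℝ → ℝ} (hc : ∀ t ∈ T, HasDerivAt c (c' t) t) :
    HasPath (ι := ι) T (fun t _ => c t) (fun t _ => c' t) (fun _ _ _ => 0) := by
  intro τ b τ' r b' hr hτ hb
  refine ((hc _ hr).comp r hτ).congr_deriv ?_
  simp

variable {p : σ → ℝ} {x : σ → ι → ℝ}

lemma hasDeriv_wt (γ d : ι → ℝ) {τ : ℝ → ℝ} {b : ℝ → ι → ℝ} {τ' r : ℝ} {b' : ι → ℝ}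
    (hτ : HasDerivAt τ τ' r) (hb : ∀ k, HasDerivAt (fun q => b q k) (b' k) r) (s : σ) :
    HasDerivAt (fun q => wt p x (lp γ d (τ q)) (b q) s)
      ((∑ k, (x s k * b' k - d k * τ' * x s k ^ 2 / 2)) * wt p x (lp γ d (τ r)) (b r) s) r := by
  unfold wt lp
  have h : HasDerivAt (fun q => ∑ k, (x s k * b q k - (γ k + τ q * d k) * x s k ^ 2 / 2))
      (∑ k, (x s k * b' k - d k * τ' * x s k ^ 2 / 2)) r := by
    refine HasDerivAt.fun_sum fun k _ => ?_
    have h1 := (hb k).const_mul (x s k)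
    have h2 := ((((hτ.mul_const (d k)).const_add (γ k)).mul_const (x s k ^ 2)).div_const 2)
    refine (h1.sub h2).congr_deriv ?_
    ring
  refine ((h.exp).const_mul (p s)).congr_deriv ?_
  ring

lemma hasPath_av (hp : Prob p) (T : Set ℝ) (γ d : ι → ℝ) (a : σ → ℝ) :
    HasPath T (fun t => av p x a (lp γ d t))
      (fun t b => ∑ k, d k * (-(1 / 2) * (av p x (fun s => a s * x s k ^ 2) (lp γ d t) b
        - av p x a (lp γ d t) b * av p x (fun s => x s k ^ 2) (lp γ d t) b)))
      (fun k t b => av p x (fun s => a s * x s k) (lp γ d t) b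
        - av p x a (lp γ d t) b * av p x (fun s => x s k) (lp γ d t) b) := by
  intro τ b τ' r b' hr hτ hb
  have hw := hasDeriv_wt (p := p) (x := x) γ d hτ hb
  have hL : HasDerivAt (fun q => Lf p x (lp γ d (τ q)) (b q))
      (∑ s, (∑ k, (x s k * b' k - d k * τ' * x s k ^ 2 / 2)) * wt p x (lp γ d (τ r)) (b r) s) r :=
    HasDerivAt.fun_sum fun s _ => hw s
  have hN : HasDerivAt (fun q => ∑ s, a s * wt p x (lp γ d (τ q)) (b q) s)
      (∑ s, a s * ((∑ k, (x s k * b' k - d k * τ' * x s k ^ 2 / 2)) * wt p x (lp γ d (τ r)) (b r) s)) r :=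
    HasDerivAt.fun_sum fun s _ => (hw s).const_mul (a s)
  have hLp := (Lf_pos (x := x) hp (lp γ d (τ r)) (b r)).ne'
  refine (hN.div hL hLp).congr_deriv ?_
  set G := lp γ d (τ r)
  set bb := b r
  set L := Lf p x G bb with hLdef
  have e1 : ∀ c : σ → ℝ, (∑ s, c s * ((∑ k, (x s k * b' k - d k * τ' * x s k ^ 2 / 2)) * wt p x G bb s)) / L
      = ∑ k, (b' k * av p x (fun s => c s * x s k) G bb
          - d k * τ' / 2 * av p x (fun s => c s * x s k ^ 2) G bb) := by
    intro c
    have : ∀ s, c s * ((∑ k, (x s k * b' k - d k * τ' * x s k ^ 2 / 2)) * wt p x G bb s)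
        = (∑ k, (b' k * (c s * x s k) + (- (d k * τ' / 2)) * (c s * x s k ^ 2))) * wt p x G bb s := by
      intro s
      rw [← mul_assoc, Finset.mul_sum]
      congr 1
      refine Finset.sum_congr rfl fun k _ => by ring
    simp_rw [this]
    change av p x (fun s => ∑ k, (b' k * (c s * x s k) + (- (d k * τ' / 2)) * (c s * x s k ^ 2))) G bb = _
    rw [av_sum]
    refine Finset.sum_congr rfl fun k _ => ?_
    rw [av_add, av_smul, av_smul]
    ring
  have e2 := e1 a
  have e3 := e1 (fun _ => 1)
  simp only [one_mul] at e3
  have e4 : ∀ N N' L' : ℝ, (N' * L - N * L') / L ^ 2 = N' / L - (N / L) * (L' / L) := by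
    intro N N' L'
    field_simp
  rw [e4, e2, e3]
  change _ - av p x a G bb * _ = _
  rw [Finset.mul_sum, ← Finset.sum_sub_distrib, Finset.sum_mul, ← Finset.sum_add_distrib]
  refine Finset.sum_congr rfl fun k _ => ?_
  ring

lemma hasPath_logL (hp : Prob p) (T : Set ℝ) (γ d : ι → ℝ) :
    HasPath T (fun t b => Real.log (Lf p x (lp γ d t) b))
      (fun t b => ∑ k, d k * (-(1 / 2) * av p x (fun s => x s k ^ 2) (lp γ d t) b))
      (fun k t b => av p x (fun s => x s k) (lp γ d t) b) := by
  intro τ b τ' r b' hr hτ hb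
  have hw := hasDeriv_wt (p := p) (x := x) γ d hτ hb
  have hL : HasDerivAt (fun q => Lf p x (lp γ d (τ q)) (b q))
      (∑ s, (∑ k, (x s k * b' k - d k * τ' * x s k ^ 2 / 2)) * wt p x (lp γ d (τ r)) (b r) s) r :=
    HasDerivAt.fun_sum fun s _ => hw s
  have hLp := (Lf_pos (x := x) hp (lp γ d (τ r)) (b r)).ne'
  refine (hL.log hLp).congr_deriv ?_
  change av p x (fun s => ∑ k, (x s k * b' k - d k * τ' * x s k ^ 2 / 2)) (lp γ d (τ r)) (b r) = _
  have : ∀ s, ∑ k, (x s k * b' k - d k * τ' * x s k ^ 2 / 2)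
      = ∑ k, (b' k * x s k + (- (d k * τ' / 2)) * x s k ^ 2) := fun s =>
    Finset.sum_congr rfl fun k _ => by ring
  simp_rw [this]
  rw [av_sum, Finset.sum_mul, ← Finset.sum_add_distrib]
  refine Finset.sum_congr rfl fun k _ => ?_
  rw [av_add, av_smul, av_smul]
  ring

/-- Twice differentiable functions with bounded derivatives. -/
structure Good (T : Set ℝ) (g gt : ℝ → (ι → ℝ) → ℝ) (g1 g2 : ι → ℝ → (ι → ℝ) → ℝ) : Prop where
  path : HasPath T g gt g1
  second : ∀ t ∈ T, ∀ b k, HasDerivAt (fun y => g1 k t (Function.update b k y)) (g2 k t b) (b k)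
  m0 : ∀ t ∈ T, Measurable (g t)
  mt : ∀ t ∈ T, Measurable (gt t)
  m1 : ∀ t ∈ T, ∀ k, Measurable (g1 k t)
  m2 : ∀ t ∈ T, ∀ k, Measurable (g2 k t)
  bt : ∃ C, ∀ t ∈ T, ∀ b, |gt t b| ≤ C
  b1 : ∃ C, ∀ t ∈ T, ∀ k b, |g1 k t b| ≤ C
  b2 : ∃ C, ∀ t ∈ T, ∀ k b, |g2 k t b| ≤ C

/-- The fundamental differentiation formula. -/
theorem deriv_EP (hp : Prob p) {γ d : ι → ℝ} {T : Set ℝ} (hT : IsOpen T)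
    (hpos : ∀ t ∈ T, ∀ k, 0 < lp γ d t k) {g gt : ℝ → (ι → ℝ) → ℝ} {g1 g2 : ι → ℝ → (ι → ℝ) → ℝ}
    (hg : Good T g gt g1 g2) {t₀ : ℝ} (ht₀ : t₀ ∈ T)
    (hEIt : EI x (lp γ d t₀) (fun _ b => g t₀ b)) :
    HasDerivAt (fun t => EP p x (lp γ d t) (fun _ b => g t b))
      (EP p x (lp γ d t₀) (fun _ b => gt t₀ b + ∑ k, d k *
        (av p x (fun s => x s k) (lp γ d t₀) b * g1 k t₀ b + g2 k t₀ b / 2))) t₀ := by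
  obtain ⟨Ct, hCt⟩ := hg.bt
  obtain ⟨C1, hC1⟩ := hg.b1
  obtain ⟨C2, hC2⟩ := hg.b2
  have hpl : ∀ t s, Measurable (pl x (lp γ d t) s) := fun t s => (continuous_pl _ s).measurable
  -- derivative of each component
  have comp : ∀ s, HasDerivAt (fun t => ∫ z, g t (pl x (lp γ d t) s z) ∂gp ι)
      (∫ z, (gt t₀ (pl x (lp γ d t₀) s z) + ∑ k, g1 k t₀ (pl x (lp γ d t₀) s z) *
        (d k * x s k + d k / (2 * √(lp γ d t₀ k)) * z k)) ∂gp ι) t₀ := by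
    intro s
    set W : Set ℝ := T ∩ ⋂ k, {t | lp γ d t₀ k / 2 < lp γ d t k} with hW
    have hWn : W ∈ 𝓝 t₀ := by
      refine inter_mem (hT.mem_nhds ht₀) ?_
      rw [Filter.iInter_mem]
      intro k
      refine IsOpen.mem_nhds ?_ ?_
      · exact isOpen_lt continuous_const (by unfold lp; fun_prop)
      · have := hpos t₀ ht₀ k
        simp only [Set.mem_ofPred_eq]; linarith
    have := hasDerivAt_integral_of_dominated_loc_of_deriv_le (μ := gp ι)
      (F := fun t z => g t (pl x (lp γ d t) s z))
      (F' := fun t z => gt t (pl x (lp γ d t) s z) + ∑ k, g1 k t (pl x (lp γ d t) s z) *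
        (d k * x s k + d k / (2 * √(lp γ d t k)) * z k)) (x₀ := t₀) (s := W)
      (bound := fun z => Ct + ∑ k, C1 * (|d k * x s k| + |d k| / (2 * √(lp γ d t₀ k / 2)) * |z k|))
      hWn ?_ (hEIt s) ?_ ?_ ?_ ?_
    · exact this.2
    · filter_upwards [hT.mem_nhds ht₀] with t ht
      exact ((hg.m0 t ht).comp (hpl t s)).aestronglyMeasurable
    · refine Measurable.aestronglyMeasurable ?_
      refine ((hg.mt t₀ ht₀).comp (hpl t₀ s)).add (Finset.measurable_sum _ fun k _ => ?_)
      exact ((hg.m1 t₀ ht₀ k).comp (hpl t₀ s)).mul (by fun_prop)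
    · refine ae_of_all _ fun z t ht => ?_
      rw [Real.norm_eq_abs]
      refine (abs_add_le _ _).trans (add_le_add (hCt t ht.1 _) ?_)
      refine (Finset.abs_sum_le_sum_abs _ _).trans (Finset.sum_le_sum fun k _ => ?_)
      rw [abs_mul]
      refine mul_le_mul (hC1 t ht.1 k _) ?_ (abs_nonneg _) ((abs_nonneg _).trans (hC1 t ht.1 k 0))
      refine (abs_add_le _ _).trans (add_le_add le_rfl ?_)
      rw [abs_mul]
      refine mul_le_mul_of_nonneg_right ?_ (abs_nonneg _)
      have h1 : lp γ d t₀ k / 2 < lp γ d t k := by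
        have := Set.mem_iInter.1 ht.2 k; exact this
      have h0 := hpos t₀ ht₀ k
      rw [abs_div, abs_of_nonneg (by positivity : (0:ℝ) ≤ 2 * √(lp γ d t k))]
      have h2 : 0 < √(lp γ d t₀ k / 2) := Real.sqrt_pos.2 (by linarith)
      have h3 := Real.sqrt_le_sqrt h1.le
      exact div_le_div_of_nonneg_left (abs_nonneg _) (by positivity) (by linarith)
    · have := integrable_lin (ι := ι) (fun k => C1 * (|d k| / (2 * √(lp γ d t₀ k / 2))))
        (Ct + ∑ k, C1 * |d k * x s k|)
      refine this.congr (ae_of_all _ fun z => ?_)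
      simp only
      rw [add_assoc, ← Finset.sum_add_distrib]
      congr 1
      exact Finset.sum_congr rfl fun k _ => by ring
    · refine ae_of_all _ fun z t ht => ?_
      have := hg.path (fun q => q) (fun q => pl x (lp γ d q) s z) 1 t
        (fun k => d k * x s k + d k / (2 * √(lp γ d t k)) * z k) ht.1 (hasDerivAt_id t) (fun k => ?_)
      · refine this.congr_deriv ?_
        simp
      · have hl : HasDerivAt (fun q => lp γ d q k) (d k) t := by
          unfold lp
          simpa using ((hasDerivAt_id t).mul_const (d k)).const_add (γ k)
        have := (hl.mul_const (x s k)).add ((hl.sqrt (hpos t ht.1 k).ne').mul_const (z k))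
        exact this
  -- Stein
  have st : ∀ s, (∫ z, (gt t₀ (pl x (lp γ d t₀) s z) + ∑ k, g1 k t₀ (pl x (lp γ d t₀) s z) *
        (d k * x s k + d k / (2 * √(lp γ d t₀ k)) * z k)) ∂gp ι)
      = ∫ z, (gt t₀ (pl x (lp γ d t₀) s z) + ∑ k, d k * (x s k * g1 k t₀ (pl x (lp γ d t₀) s z)
          + g2 k t₀ (pl x (lp γ d t₀) s z) / 2)) ∂gp ι := by
    intro s
    have it : Integrable (fun z => gt t₀ (pl x (lp γ d t₀) s z)) (gp ι) :=
      EI_of_bdd (x := x) (φ := fun _ b => gt t₀ b) (fun _ => hg.mt t₀ ht₀) (fun _ b => hCt t₀ ht₀ b) s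
    have i1 : ∀ k, Integrable (fun z => g1 k t₀ (pl x (lp γ d t₀) s z)) (gp ι) := fun k =>
      EI_of_bdd (x := x) (φ := fun _ b => g1 k t₀ b) (fun _ => hg.m1 t₀ ht₀ k) (fun _ b => hC1 t₀ ht₀ k b) s
    have i2 : ∀ k, Integrable (fun z => g2 k t₀ (pl x (lp γ d t₀) s z)) (gp ι) := fun k =>
      EI_of_bdd (x := x) (φ := fun _ b => g2 k t₀ b) (fun _ => hg.m2 t₀ ht₀ k) (fun _ b => hC2 t₀ ht₀ k b) s
    have iz : ∀ k, Integrable (fun z : ι → ℝ => z k * g1 k t₀ (pl x (lp γ d t₀) s z)) (gp ι) := fun k =>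
      (integrable_coord k).mul_bdd (c := C1)
        ((hg.m1 t₀ ht₀ k).comp (hpl t₀ s)).aestronglyMeasurable
        (ae_of_all _ fun z => by simpa using hC1 t₀ ht₀ k _)
    have hst : ∀ k, ∫ z, z k * g1 k t₀ (pl x (lp γ d t₀) s z) ∂gp ι
        = ∫ z, √(lp γ d t₀ k) * g2 k t₀ (pl x (lp γ d t₀) s z) ∂gp ι := by
      intro k
      refine stein (C := max C1 (√(lp γ d t₀ k) * C2)) k (fun z => ?_) ((hg.m1 t₀ ht₀ k).comp (hpl t₀ s))
        (((hg.m2 t₀ ht₀ k).comp (hpl t₀ s)).const_mul _) (fun z => (hC1 t₀ ht₀ k _).trans (le_max_left _ _))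
        (fun z => ?_)
      · have e : ∀ y, pl x (lp γ d t₀) s (Function.update z k y)
            = Function.update (pl x (lp γ d t₀) s z) k (lp γ d t₀ k * x s k + √(lp γ d t₀ k) * y) := by
          intro y
          ext j
          by_cases hj : j = k
          · subst hj; simp [pl]
          · simp [pl, Function.update_of_ne hj]
        simp_rw [e]
        have h1 := hg.second t₀ ht₀ (pl x (lp γ d t₀) s z) k
        have h2 : HasDerivAt (fun y => lp γ d t₀ k * x s k + √(lp γ d t₀ k) * y) (√(lp γ d t₀ k)) (z k) := by
          simpa using ((hasDerivAt_id (z k)).const_mul (√(lp γ d t₀ k))).const_add (lp γ d t₀ k * x s k)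
        have := HasDerivAt.comp (z k) (h₂ := fun y => g1 k t₀ (Function.update (pl x (lp γ d t₀) s z) k y)) h1 h2
        refine this.congr_deriv ?_
        ring
      · rw [abs_mul, abs_of_nonneg (Real.sqrt_nonneg _)]
        exact (mul_le_mul_of_nonneg_left (hC2 t₀ ht₀ k _) (Real.sqrt_nonneg _)).trans (le_max_right _ _)
    have l1 : ∀ z, (∑ k, g1 k t₀ (pl x (lp γ d t₀) s z) *
        (d k * x s k + d k / (2 * √(lp γ d t₀ k)) * z k)) = ∑ k, ((d k * x s k) * g1 k t₀ (pl x (lp γ d t₀) s z)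
          + (d k / (2 * √(lp γ d t₀ k))) * (z k * g1 k t₀ (pl x (lp γ d t₀) s z))) := fun z =>
      Finset.sum_congr rfl fun k _ => by ring
    have l2 : ∀ z, (∑ k, d k * (x s k * g1 k t₀ (pl x (lp γ d t₀) s z)
          + g2 k t₀ (pl x (lp γ d t₀) s z) / 2)) = ∑ k, ((d k * x s k) * g1 k t₀ (pl x (lp γ d t₀) s z)
          + (d k / 2) * g2 k t₀ (pl x (lp γ d t₀) s z)) := fun z =>
      Finset.sum_congr rfl fun k _ => by ring
    simp_rw [l1, l2]
    have j1 : ∀ k, Integrable (fun z : ι → ℝ => (d k * x s k) * g1 k t₀ (pl x (lp γ d t₀) s z)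
          + (d k / (2 * √(lp γ d t₀ k))) * (z k * g1 k t₀ (pl x (lp γ d t₀) s z))) (gp ι) :=
      fun k => ((i1 k).const_mul _).add ((iz k).const_mul _)
    have j2 : ∀ k, Integrable (fun z : ι → ℝ => (d k * x s k) * g1 k t₀ (pl x (lp γ d t₀) s z)
          + (d k / 2) * g2 k t₀ (pl x (lp γ d t₀) s z)) (gp ι) :=
      fun k => ((i1 k).const_mul _).add ((i2 k).const_mul _)
    rw [integral_add it (integrable_finsetSum _ fun k _ => j1 k),
      integral_add it (integrable_finsetSum _ fun k _ => j2 k),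
      integral_finsetSum _ (fun k _ => j1 k),
      integral_finsetSum _ (fun k _ => j2 k)]
    congr 1
    refine Finset.sum_congr rfl fun k _ => ?_
    rw [integral_add ((i1 k).const_mul _) ((iz k).const_mul _),
      integral_add ((i1 k).const_mul _) ((i2 k).const_mul _), integral_const_mul (d k / (2 * √(lp γ d t₀ k))),
      hst, integral_const_mul (√(lp γ d t₀ k)), integral_const_mul (d k / 2)]
    have h0 : √(lp γ d t₀ k) ≠ 0 := (Real.sqrt_pos.2 (hpos t₀ ht₀ k)).ne'
    congr 1
    field_simp
  have hsum : HasDerivAt (fun t => EP p x (lp γ d t) (fun _ b => g t b))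
      (EP p x (lp γ d t₀) (fun s b => gt t₀ b + ∑ k, d k * (x s k * g1 k t₀ b + g2 k t₀ b / 2))) t₀ := by
    unfold EP
    refine HasDerivAt.fun_sum fun s _ => ?_
    refine ((comp s).const_mul (p s)).congr_deriv ?_
    rw [st s]
  refine hsum.congr_deriv ?_
  -- Nishimori
  have it : EI x (lp γ d t₀) (fun _ b => gt t₀ b) :=
    EI_of_bdd (fun _ => hg.mt t₀ ht₀) (fun _ b => hCt t₀ ht₀ b)
  have i2 : ∀ k, EI x (lp γ d t₀) (fun _ b => g2 k t₀ b / 2 ) := fun k =>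
    EI_of_bdd (C := C2 / 2) (fun _ => (hg.m2 t₀ ht₀ k).div_const 2) (fun _ b => by
      rw [abs_div, abs_two]; exact div_le_div_of_nonneg_right (hC2 t₀ ht₀ k b) (by norm_num))
  have bx : ∀ k, ∃ B, 0 ≤ B ∧ ∀ s, |x s k| ≤ B := fun k => ⟨∑ s, |x s k|, Finset.sum_nonneg fun _ _ => abs_nonneg _,
    fun s => Finset.single_le_sum (f := fun s => |x s k|) (fun _ _ => abs_nonneg _) (Finset.mem_univ s)⟩
  have i1 : ∀ k, EI x (lp γ d t₀) (fun s b => x s k * g1 k t₀ b) := fun k => by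
    obtain ⟨B, hB0, hB⟩ := bx k
    refine EI_of_bdd (C := B * C1) (fun s => (hg.m1 t₀ ht₀ k).const_mul _) (fun s b => ?_)
    rw [abs_mul]; exact mul_le_mul (hB s) (hC1 t₀ ht₀ k b) (abs_nonneg _) hB0
  have i1' : ∀ k, EI x (lp γ d t₀) (fun s b => av p x (fun s => x s k) (lp γ d t₀) b * g1 k t₀ b) := fun k => by
    obtain ⟨B, hB0, hB⟩ := bx k
    refine EI_of_bdd (C := B * C1) (fun s => (measurable_av hp _ _).mul (hg.m1 t₀ ht₀ k)) (fun s b => ?_)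
    rw [abs_mul]; exact mul_le_mul (av_abs_le hp hB _ b) (hC1 t₀ ht₀ k b) (abs_nonneg _) hB0
  have gen : ∀ (f : ι → σ → (ι → ℝ) → ℝ), (∀ k, EI x (lp γ d t₀) (f k)) →
      EP p x (lp γ d t₀) (fun s b => gt t₀ b + ∑ k, d k * (f k s b + g2 k t₀ b / 2))
      = EP p x (lp γ d t₀) (fun _ b => gt t₀ b) + ∑ k, d k * (EP p x (lp γ d t₀) (f k)
        + EP p x (lp γ d t₀) (fun _ b => g2 k t₀ b / 2)) := by
    intro f hf
    have hk : ∀ k, EI x (lp γ d t₀) (fun s b => d k * (f k s b + g2 k t₀ b / 2)) := fun k s =>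
      (((hf k s).add (i2 k s)).const_mul (d k))
    have hs : EI x (lp γ d t₀) (fun s b => ∑ k, d k * (f k s b + g2 k t₀ b / 2)) :=
      fun s => integrable_finsetSum _ fun k _ => hk k s
    rw [EP_add it hs, EP_sum (φ := fun k s b => d k * (f k s b + g2 k t₀ b / 2)) _ (fun k _ => hk k)]
    congr 1
    refine Finset.sum_congr rfl fun k _ => ?_
    rw [EP_smul, EP_add (hf k) (i2 k)]
  rw [gen _ i1, gen _ i1']
  congr 1
  refine Finset.sum_congr rfl fun k _ => ?_
  rw [nishimori hp (fun k => (hpos t₀ ht₀ k).le) (fun s => x s k) (hg.m1 t₀ ht₀ k) (hC1 t₀ ht₀ k)]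

end good
end ASS

namespace ASS

set_option linter.unusedSectionVars false
set_option linter.unusedVariables false
set_option autoImplicit false

section calculus
variable {σ ι : Type*} [Fintype σ] [Fintype ι] [DecidableEq ι]

/-- Bounded measurable time dependent observables. -/
def BM (T : Set ℝ) (g : ℝ → (ι → ℝ) → ℝ) : Prop :=
  (∀ t ∈ T, Measurable (g t)) ∧ ∃ C, ∀ t ∈ T, ∀ b, |g t b| ≤ C

lemma BM.add {T : Set ℝ} {g h : ℝ → (ι → ℝ) → ℝ} (hg : BM T g) (hh : BM T h) :
    BM T (fun t b => g t b + h t b) := by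
  obtain ⟨m1, C1, h1⟩ := hg
  obtain ⟨m2, C2, h2⟩ := hh
  exact ⟨fun t ht => (m1 t ht).add (m2 t ht), C1 + C2, fun t ht b =>
    (abs_add_le _ _).trans (add_le_add (h1 t ht b) (h2 t ht b))⟩

lemma BM.sub {T : Set ℝ} {g h : ℝ → (ι → ℝ) → ℝ} (hg : BM T g) (hh : BM T h) :
    BM T (fun t b => g t b - h t b) := by
  obtain ⟨m1, C1, h1⟩ := hg
  obtain ⟨m2, C2, h2⟩ := hh
  exact ⟨fun t ht => (m1 t ht).sub (m2 t ht), C1 + C2, fun t ht b =>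
    (abs_sub _ _).trans (add_le_add (h1 t ht b) (h2 t ht b))⟩

lemma BM.mul {T : Set ℝ} {g h : ℝ → (ι → ℝ) → ℝ} (hg : BM T g) (hh : BM T h) :
    BM T (fun t b => g t b * h t b) := by
  obtain ⟨m1, C1, h1⟩ := hg
  obtain ⟨m2, C2, h2⟩ := hh
  refine ⟨fun t ht => (m1 t ht).mul (m2 t ht), C1 * C2, fun t ht b => ?_⟩
  rw [abs_mul]
  exact mul_le_mul (h1 t ht b) (h2 t ht b) (abs_nonneg _) ((abs_nonneg _).trans (h1 t ht b))

lemma BM.const (T : Set ℝ) (c : ℝ) : BM (ι := ι) T (fun _ _ => c) :=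
  ⟨fun _ _ => measurable_const, |c|, fun _ _ _ => le_rfl⟩

lemma BM.smul {T : Set ℝ} {g : ℝ → (ι → ℝ) → ℝ} (c : ℝ) (hg : BM T g) :
    BM T (fun t b => c * g t b) := (BM.const T c).mul hg

lemma BM.sum {κ : Type*} (u : Finset κ) {T : Set ℝ} {g : κ → ℝ → (ι → ℝ) → ℝ}
    (hg : ∀ i ∈ u, BM T (g i)) : BM T (fun t b => ∑ i ∈ u, g i t b) := by
  classical
  induction u using Finset.induction_on with
  | empty => simpa using BM.const T 0
  | insert i u hi ih =>
    simp only [Finset.sum_insert hi]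
    exact (hg i (Finset.mem_insert_self _ _)).add (ih fun j hj => hg j (Finset.mem_insert_of_mem hj))

lemma BM.time {T : Set ℝ} {c : ℝ → ℝ} {C : ℝ} (hc : ∀ t ∈ T, |c t| ≤ C) :
    BM (ι := ι) T (fun t _ => c t) :=
  ⟨fun _ _ => measurable_const, C, fun t ht _ => hc t ht⟩

variable {p : σ → ℝ} {x : σ → ι → ℝ}

lemma BM.av (hp : Prob p) (T : Set ℝ) (γ d : ι → ℝ) (a : σ → ℝ) :
    BM T (fun t b => av p x a (lp γ d t) b) :=
  ⟨fun t _ => measurable_av hp a _, ∑ s, |a s|, fun t _ b => av_abs_le hp (fun s =>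
    Finset.single_le_sum (f := fun s => |a s|) (fun _ _ => abs_nonneg _) (Finset.mem_univ s)) _ b⟩

lemma BM.EI {T : Set ℝ} {g : ℝ → (ι → ℝ) → ℝ} (hg : BM T g) {t : ℝ} (ht : t ∈ T) (γ : ι → ℝ) :
    EI x γ (fun _ b => g t b) := by
  obtain ⟨m, C, h⟩ := hg
  exact EI_of_bdd (fun _ => m t ht) (fun _ => h t ht)

lemma Good.mk' {T : Set ℝ} {g gt : ℝ → (ι → ℝ) → ℝ} {g1 g2 : ι → ℝ → (ι → ℝ) → ℝ}
    (path : HasPath T g gt g1)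
    (second : ∀ t ∈ T, ∀ b k, HasDerivAt (fun y => g1 k t (Function.update b k y)) (g2 k t b) (b k))
    (m0 : ∀ t ∈ T, Measurable (g t)) (bt : BM T gt) (b1 : ∀ k, BM T (g1 k)) (b2 : ∀ k, BM T (g2 k)) :
    Good T g gt g1 g2 := by
  have un : ∀ {f : ι → ℝ → (ι → ℝ) → ℝ}, (∀ k, BM T (f k)) →
      ∃ C, ∀ t ∈ T, ∀ k b, |f k t b| ≤ C := by
    intro f hf
    choose m C hC using hf
    refine ⟨∑ k, |C k|, fun t ht k b => (hC k t ht b).trans ((le_abs_self _).trans ?_)⟩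
    exact Finset.single_le_sum (f := fun k => |C k|) (fun _ _ => abs_nonneg _) (Finset.mem_univ k)
  exact ⟨path, second, m0, bt.1, fun t ht k => (b1 k).1 t ht, fun t ht k => (b2 k).1 t ht, bt.2, un b1, un b2⟩

lemma Good.BMt {T : Set ℝ} {g gt : ℝ → (ι → ℝ) → ℝ} {g1 g2 : ι → ℝ → (ι → ℝ) → ℝ}
    (h : Good T g gt g1 g2) : BM T gt := ⟨h.mt, h.bt⟩
lemma Good.BM1 {T : Set ℝ} {g gt : ℝ → (ι → ℝ) → ℝ} {g1 g2 : ι → ℝ → (ι → ℝ) → ℝ}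
    (h : Good T g gt g1 g2) (k : ι) : BM T (g1 k) := by
  obtain ⟨C, hC⟩ := h.b1
  exact ⟨fun t ht => h.m1 t ht k, C, fun t ht b => hC t ht k b⟩
lemma Good.BM2 {T : Set ℝ} {g gt : ℝ → (ι → ℝ) → ℝ} {g1 g2 : ι → ℝ → (ι → ℝ) → ℝ}
    (h : Good T g gt g1 g2) (k : ι) : BM T (g2 k) := by
  obtain ⟨C, hC⟩ := h.b2
  exact ⟨fun t ht => h.m2 t ht k, C, fun t ht b => hC t ht k b⟩

/-- `g` has gradient `g1` and generator value `D` along the linear path. -/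
def Gen (p : σ → ℝ) (x : σ → ι → ℝ) (γ d : ι → ℝ) (T : Set ℝ) (g : ℝ → (ι → ℝ) → ℝ)
    (g1 : ι → ℝ → (ι → ℝ) → ℝ) (D : ℝ → (ι → ℝ) → ℝ) : Prop :=
  ∃ gt g2, Good T g gt g1 g2 ∧ ∀ t ∈ T, ∀ b, gt t b + ∑ k, d k *
    (av p x (fun s => x s k) (lp γ d t) b * g1 k t b + g2 k t b / 2) = D t b

variable {γ d : ι → ℝ} {T : Set ℝ}

theorem Gen.deriv (hp : Prob p) (hT : IsOpen T) (hpos : ∀ t ∈ T, ∀ k, 0 < lp γ d t k)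
    {g D : ℝ → (ι → ℝ) → ℝ} {g1 : ι → ℝ → (ι → ℝ) → ℝ} (hg : Gen p x γ d T g g1 D)
    {t₀ : ℝ} (ht₀ : t₀ ∈ T) (hEIt : EI x (lp γ d t₀) (fun _ b => g t₀ b)) :
    HasDerivAt (fun t => EP p x (lp γ d t) (fun _ b => g t b))
      (EP p x (lp γ d t₀) (fun _ b => D t₀ b)) t₀ := by
  obtain ⟨gt, g2, h, hD⟩ := hg
  have := deriv_EP hp hT hpos h ht₀ hEIt
  simpa only [hD t₀ ht₀] using this

/-- Gibbs covariance. -/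
def cv (p : σ → ℝ) (x : σ → ι → ℝ) (a c : σ → ℝ) (γ b : ι → ℝ) : ℝ :=
  av p x (fun s => a s * c s) γ b - av p x a γ b * av p x c γ b

/-- Gibbs mean of coordinate `k`. -/
def mn (p : σ → ℝ) (x : σ → ι → ℝ) (k : ι) (γ b : ι → ℝ) : ℝ := av p x (fun s => x s k) γ b

/-- Gibbs covariance of coordinates. -/
def cc (p : σ → ℝ) (x : σ → ι → ℝ) (i k : ι) (γ b : ι → ℝ) : ℝ :=
  cv p x (fun s => x s i) (fun s => x s k) γ b

lemma BM.cv (hp : Prob p) (T : Set ℝ) (γ d : ι → ℝ) (a c : σ → ℝ) :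
    BM T (fun t b => cv p x a c (lp γ d t) b) := by
  unfold ASS.cv
  exact (BM.av hp T γ d _).sub ((BM.av hp T γ d _).mul (BM.av hp T γ d _))

lemma Gen.bm (hp : Prob p) {g D : ℝ → (ι → ℝ) → ℝ} {g1 : ι → ℝ → (ι → ℝ) → ℝ}
    (hg : Gen p x γ d T g g1 D) : BM T D := by
  obtain ⟨gt, g2, h, hD⟩ := hg
  have : BM T (fun t b => gt t b + ∑ k, d k *
    (av p x (fun s => x s k) (lp γ d t) b * g1 k t b + (1 / 2) * g2 k t b)) :=
    h.BMt.add (BM.sum _ fun k _ => BM.smul _ (((BM.av hp T γ d _).mul (h.BM1 k)).add ((h.BM2 k).smul _)))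
  obtain ⟨m, C, hC⟩ := this
  have e : ∀ t ∈ T, ∀ b, gt t b + ∑ k, d k *
    (av p x (fun s => x s k) (lp γ d t) b * g1 k t b + (1 / 2) * g2 k t b) = D t b := by
    intro t ht b
    rw [← hD t ht b]
    congr 1
    exact Finset.sum_congr rfl fun k _ => by ring
  refine ⟨fun t ht => ?_, C, fun t ht b => ?_⟩
  · have : D t = fun b => gt t b + ∑ k, d k *
      (av p x (fun s => x s k) (lp γ d t) b * g1 k t b + (1 / 2) * g2 k t b) := by
      ext b; exact (e t ht b).symm
    rw [this]; exact m t ht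
  · rw [← e t ht b]; exact hC t ht b

lemma gen_av (hp : Prob p) (a : σ → ℝ) :
    Gen p x γ d T (fun t => av p x a (lp γ d t)) (fun k t => cv p x a (fun s => x s k) (lp γ d t))
      (fun _ _ => 0) := by
  have hc : ∀ k : ι, HasPath T (fun t => cv p x a (fun s => x s k) (lp γ d t)) _ _ := fun k =>
    (hasPath_av (x := x) hp T γ d (fun s => a s * x s k)).sub
      ((hasPath_av (x := x) hp T γ d a).mul (hasPath_av (x := x) hp T γ d (fun s => x s k)))
  refine ⟨_, fun k t b => cv p x (fun s => a s * x s k) (fun s => x s k) (lp γ d t) b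
      - (cv p x a (fun s => x s k) (lp γ d t) b * mn p x k (lp γ d t) b
        + av p x a (lp γ d t) b * cc p x k k (lp γ d t) b), Good.mk' (hasPath_av (x := x) hp T γ d a)
      (fun t ht b k => (hc k).coord ht b k) (fun t _ => measurable_av hp _ _) ?_ ?_ ?_, ?_⟩
  · exact BM.sum _ fun k _ => BM.smul _ (BM.smul _ (BM.cv hp T γ d a (fun s => x s k ^ 2)))
  · exact fun k => BM.cv hp T γ d _ _
  · exact fun k => (BM.cv hp T γ d _ _).sub (((BM.cv hp T γ d _ _).mul (BM.av hp T γ d _)).add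
      ((BM.av hp T γ d _).mul (BM.cv hp T γ d _ _)))
  · intro t ht b
    rw [← Finset.sum_add_distrib]
    refine Finset.sum_eq_zero fun k _ => ?_
    unfold cv cc cv mn
    beta_reduce
    have e1 : (fun s => a s * x s k * x s k) = fun s => a s * x s k ^ 2 := by ext s; ring
    have e2 : (fun s => x s k * x s k) = fun s => x s k ^ 2 := by ext s; ring
    rw [e1, e2]
    ring

lemma gen_logL (hp : Prob p) :
    Gen p x γ d T (fun t b => Real.log (Lf p x (lp γ d t) b)) (fun k t => mn p x k (lp γ d t))
      (fun t b => ∑ k, d k * (1 / 2 * mn p x k (lp γ d t) b ^ 2)) := by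
  have hc : ∀ k : ι, HasPath T (fun t => mn p x k (lp γ d t)) _ _ := fun k =>
    (hasPath_av (x := x) hp T γ d (fun s => x s k))
  refine ⟨_, fun k t b => cc p x k k (lp γ d t) b, Good.mk' (hasPath_logL (x := x) hp T γ d)
      (fun t ht b k => (hc k).coord ht b k) (fun t _ => measurable_logL hp _) ?_ ?_ ?_, ?_⟩
  · exact BM.sum _ fun k _ => BM.smul _ (BM.smul _ (BM.av hp T γ d _))
  · exact fun k => BM.av hp T γ d _
  · exact fun k => BM.cv hp T γ d _ _
  · intro t ht b
    rw [← Finset.sum_add_distrib]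
    refine Finset.sum_congr rfl fun k _ => ?_
    unfold cc cv mn
    beta_reduce
    have e2 : (fun s => x s k * x s k) = fun s => x s k ^ 2 := by ext s; ring
    rw [e2]
    ring

lemma Gen.mul {g h Dg Dh : ℝ → (ι → ℝ) → ℝ} {g1 h1 : ι → ℝ → (ι → ℝ) → ℝ}
    (hg : Gen p x γ d T g g1 Dg) (hh : Gen p x γ d T h h1 Dh) (bg : BM T g) (bh : BM T h) :
    Gen p x γ d T (fun t b => g t b * h t b) (fun k t b => g1 k t b * h t b + g t b * h1 k t b)
      (fun t b => Dg t b * h t b + g t b * Dh t b + ∑ k, d k * (g1 k t b * h1 k t b)) := by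
  obtain ⟨gt, g2, Gg, eg⟩ := hg
  obtain ⟨ht, h2, Gh, eh⟩ := hh
  refine ⟨_, fun k t b => g2 k t b * h t b + g1 k t b * h1 k t b
      + (g1 k t b * h1 k t b + g t b * h2 k t b), Good.mk' (Gg.path.mul Gh.path)
      ?_ (fun t ht => (bg.1 t ht).mul (bh.1 t ht)) ((Gg.BMt.mul bh).add (bg.mul Gh.BMt))
      (fun k => ((Gg.BM1 k).mul bh).add (bg.mul (Gh.BM1 k)))
      (fun k => (((Gg.BM2 k).mul bh).add ((Gg.BM1 k).mul (Gh.BM1 k))).add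
        (((Gg.BM1 k).mul (Gh.BM1 k)).add (bg.mul (Gh.BM2 k)))), ?_⟩
  · intro t htT b k
    have a1 := Gg.path.coord htT b k
    have a2 := Gh.path.coord htT b k
    have a3 := Gg.second t htT b k
    have a4 := Gh.second t htT b k
    have := (a3.mul a2).add (a1.mul a4)
    simp only [Function.update_eq_self] at this
    exact this
  · intro t htT b
    beta_reduce
    rw [← eg t htT b, ← eh t htT b]
    rw [add_mul, mul_add, Finset.sum_mul, Finset.mul_sum]
    have : ∀ k, d k * (av p x (fun s => x s k) (lp γ d t) b * (g1 k t b * h t b + g t b * h1 k t b)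
      + (g2 k t b * h t b + g1 k t b * h1 k t b + (g1 k t b * h1 k t b + g t b * h2 k t b)) / 2)
      = d k * (av p x (fun s => x s k) (lp γ d t) b * g1 k t b + g2 k t b / 2) * h t b
        + g t b * (d k * (av p x (fun s => x s k) (lp γ d t) b * h1 k t b + h2 k t b / 2))
        + d k * (g1 k t b * h1 k t b) := by intro k; ring
    simp_rw [this]
    rw [Finset.sum_add_distrib, Finset.sum_add_distrib]
    ring

lemma Gen.sub {g h Dg Dh : ℝ → (ι → ℝ) → ℝ} {g1 h1 : ι → ℝ → (ι → ℝ) → ℝ}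
    (hg : Gen p x γ d T g g1 Dg) (hh : Gen p x γ d T h h1 Dh) :
    Gen p x γ d T (fun t b => g t b - h t b) (fun k t b => g1 k t b - h1 k t b)
      (fun t b => Dg t b - Dh t b) := by
  obtain ⟨gt, g2, Gg, eg⟩ := hg
  obtain ⟨ht, h2, Gh, eh⟩ := hh
  refine ⟨_, fun k t b => g2 k t b - h2 k t b, Good.mk' (Gg.path.sub Gh.path)
      (fun t htT b k => (Gg.second t htT b k).sub (Gh.second t htT b k))
      (fun t ht => (Gg.m0 t ht).sub (Gh.m0 t ht)) (Gg.BMt.sub Gh.BMt)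
      (fun k => (Gg.BM1 k).sub (Gh.BM1 k)) (fun k => (Gg.BM2 k).sub (Gh.BM2 k)), ?_⟩
  intro t htT b
  beta_reduce
  rw [← eg t htT b, ← eh t htT b]
  have : ∀ k, d k * (av p x (fun s => x s k) (lp γ d t) b * (g1 k t b - h1 k t b)
      + (g2 k t b - h2 k t b) / 2)
      = d k * (av p x (fun s => x s k) (lp γ d t) b * g1 k t b + g2 k t b / 2)
        - (d k * (av p x (fun s => x s k) (lp γ d t) b * h1 k t b + h2 k t b / 2)) := by intro k; ring
  simp_rw [this]
  rw [Finset.sum_sub_distrib]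
  ring

lemma Gen.sum {κ : Type*} (u : Finset κ) {g D : κ → ℝ → (ι → ℝ) → ℝ}
    {g1 : κ → ι → ℝ → (ι → ℝ) → ℝ} (hg : ∀ i, Gen p x γ d T (g i) (g1 i) (D i)) :
    Gen p x γ d T (fun t b => ∑ i ∈ u, g i t b) (fun k t b => ∑ i ∈ u, g1 i k t b)
      (fun t b => ∑ i ∈ u, D i t b) := by
  choose gt g2 Gg eg using hg
  refine ⟨_, fun k t b => ∑ i ∈ u, g2 i k t b, Good.mk' (HasPath.sum u fun i _ => (Gg i).path)
      (fun t htT b k => HasDerivAt.fun_sum fun i _ => (Gg i).second t htT b k)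
      (fun t ht => Finset.measurable_sum _ fun i _ => (Gg i).m0 t ht)
      (BM.sum u fun i _ => (Gg i).BMt)
      (fun k => BM.sum u fun i _ => (Gg i).BM1 k) (fun k => BM.sum u fun i _ => (Gg i).BM2 k), ?_⟩
  intro t htT b
  beta_reduce
  simp_rw [← fun i => eg i t htT b]
  rw [Finset.sum_add_distrib]
  congr 1
  rw [Finset.sum_comm]
  refine Finset.sum_congr rfl fun k _ => ?_
  rw [← Finset.mul_sum, Finset.sum_add_distrib, Finset.mul_sum, Finset.sum_div]

lemma Gen.time {c c' : ℝ → ℝ} {C : ℝ} (hc : ∀ t ∈ T, HasDerivAt c (c' t) t) (hC : ∀ t ∈ T, |c' t| ≤ C) :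
    Gen p x γ d T (fun t _ => c t) (fun _ _ _ => 0) (fun t _ => c' t) := by
  refine ⟨_, fun _ _ _ => 0, Good.mk' (HasPath.time hc) (fun t ht b k => hasDerivAt_const _ _)
    (fun _ _ => measurable_const) (BM.time hC) (fun k => BM.const T 0) (fun k => BM.const T 0), ?_⟩
  intro t ht b
  simp

lemma Gen.comp {g D : ℝ → (ι → ℝ) → ℝ} {g1 : ι → ℝ → (ι → ℝ) → ℝ}
    (hg : Gen p x γ d T g g1 D) {f f' f'' : ℝ → ℝ} (hf : ∀ y, HasDerivAt f (f' y) y)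
    (hf' : ∀ y, HasDerivAt f' (f'' y) y) (mf'' : Measurable f'') {C : ℝ} (b' : ∀ y, |f' y| ≤ C) (b'' : ∀ y, |f'' y| ≤ C) :
    Gen p x γ d T (fun t b => f (g t b)) (fun k t b => f' (g t b) * g1 k t b)
      (fun t b => f' (g t b) * D t b + 1 / 2 * (f'' (g t b) * ∑ k, d k * g1 k t b ^ 2)) := by
  obtain ⟨gt, g2, Gg, eg⟩ := hg
  have mf : Measurable f := (continuous_iff_continuousAt.2 fun y => (hf y).continuousAt).measurable
  have mf' : Measurable f' := (continuous_iff_continuousAt.2 fun y => (hf' y).continuousAt).measurable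
  have B1 : BM T (fun t b => f' (g t b)) := ⟨fun t ht => mf'.comp (Gg.m0 t ht), C, fun t ht b => b' _⟩
  have B2 : BM T (fun t b => f'' (g t b)) := ⟨fun t ht => mf''.comp (Gg.m0 t ht), C, fun t ht b => b'' _⟩
  refine ⟨_, fun k t b => (f'' (g t b) * g1 k t b) * g1 k t b + f' (g t b) * g2 k t b,
    Good.mk' (Gg.path.comp hf) ?_
    (fun t ht => mf.comp (Gg.m0 t ht)) (B1.mul Gg.BMt) (fun k => B1.mul (Gg.BM1 k))
    (fun k => ((B2.mul (Gg.BM1 k)).mul (Gg.BM1 k)).add (B1.mul (Gg.BM2 k))), ?_⟩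
  · intro t ht b k
    have a1 := Gg.path.coord ht b k
    have a3 := Gg.second t ht b k
    have a2 := (HasDerivAt.comp (b k) (hf' _) a1).mul a3
    simp only [Function.update_eq_self, Function.comp] at a2
    exact a2
  · intro t ht b
    beta_reduce
    rw [← eg t ht b, mul_add, Finset.mul_sum, Finset.mul_sum, Finset.mul_sum, add_assoc, ← Finset.sum_add_distrib]
    congr 1
    exact Finset.sum_congr rfl fun k _ => by ring

end calculus
end ASS

namespace ASS

set_option linter.unusedSectionVars false
set_option linter.unusedVariables false
set_option autoImplicit false

section consequences
variable {σ ι : Type*} [Fintype σ] [Fintype ι] [DecidableEq ι]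
variable {p : σ → ℝ} {x : σ → ι → ℝ}

lemma av_nonneg (hp : Prob p) {a : σ → ℝ} (h : ∀ s, 0 ≤ a s) (γ b : ι → ℝ) :
    0 ≤ av p x a γ b := by
  have := av_mono (x := x) hp (a := fun _ => 0) h γ b
  rwa [av_const hp] at this

lemma cv_eq (hp : Prob p) (a c : σ → ℝ) (γ b : ι → ℝ) :
    cv p x a c γ b = av p x (fun s => (a s - av p x a γ b) * (c s - av p x c γ b)) γ b := by
  set A := av p x a γ b with hA
  set C := av p x c γ b with hC
  have e : (fun s => (a s - A) * (c s - C)) = fun s => (a s * c s + (-C) * a s) + ((-A) * c s + A * C) := by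
    ext s; ring
  rw [e, av_add, av_add, av_add, av_smul, av_smul, av_const hp, ← hA, ← hC]
  unfold cv
  rw [← hA, ← hC]; ring

lemma cv_self_nonneg (hp : Prob p) (a : σ → ℝ) (γ b : ι → ℝ) : 0 ≤ cv p x a a γ b := by
  rw [cv_eq hp]
  exact av_nonneg hp (fun s => mul_self_nonneg _) γ b

lemma cv_sum_left (hp : Prob p) {κ : Type*} (u : Finset κ) (e : κ → ℝ) (a : κ → σ → ℝ) (c : σ → ℝ) (γ b : ι → ℝ) :
    cv p x (fun s => ∑ i ∈ u, e i * a i s) c γ b = ∑ i ∈ u, e i * cv p x (a i) c γ b := by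
  unfold cv
  have h : (fun s => (∑ i ∈ u, e i * a i s) * c s) = fun s => ∑ i ∈ u, e i * (a i s * c s) := by
    ext s; rw [Finset.sum_mul]; exact Finset.sum_congr rfl fun i _ => by ring
  rw [h, av_sum, av_sum]
  simp_rw [av_smul]
  rw [Finset.sum_mul, ← Finset.sum_sub_distrib]
  exact Finset.sum_congr rfl fun i _ => by ring

lemma cv_comm (a c : σ → ℝ) (γ b : ι → ℝ) : cv p x a c γ b = cv p x c a γ b := by
  unfold cv
  simp_rw [mul_comm (a _)]
  ring

/-- Positivity of the Hadamard square of a covariance matrix. -/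
lemma psd (hp : Prob p) (d : ι → ℝ) (γ b : ι → ℝ) :
    0 ≤ ∑ k, d k * ∑ l, d l * cc p x k l γ b ^ 2 := by
  set y : σ → ι → ℝ := fun s k => x s k - mn p x k γ b with hy
  have hcc : ∀ k l, cc p x k l γ b = av p x (fun s => y s k * y s l) γ b := fun k l => cv_eq hp _ _ γ b
  have h : ∑ k, d k * ∑ l, d l * cc p x k l γ b ^ 2
      = av p x (fun s => av p x (fun s' => (∑ k, d k * (y s k * y s' k)) ^ 2) γ b) γ b := by
    have e1 : ∀ s s', (∑ k, d k * (y s k * y s' k)) ^ 2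
        = ∑ k, ∑ l, (d k * d l * (y s k * y s l)) * (y s' k * y s' l) := by
      intro s s'
      rw [sq, Finset.sum_mul_sum]
      exact Finset.sum_congr rfl fun k _ => Finset.sum_congr rfl fun l _ => by ring
    simp_rw [e1, av_sum, av_smul, ← hcc]
    refine Finset.sum_congr rfl fun k _ => ?_
    rw [Finset.mul_sum]
    refine Finset.sum_congr rfl fun l _ => ?_
    have e2 : (fun s => d k * d l * (y s k * y s l) * cc p x k l γ b)
      = fun s => (d k * d l * cc p x k l γ b) * (y s k * y s l) := by ext s; ring
    rw [e2, av_smul, ← hcc]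
    ring
  rw [h]
  exact av_nonneg hp (fun s => av_nonneg hp (fun s' => sq_nonneg _) γ b) γ b

/-- Continuity in the signal to noise ratios. -/
lemma continuous_EP {φ : (ι → ℝ) → (ι → ℝ) → ℝ}
    (hφ : Continuous (fun q : (ι → ℝ) × (ι → ℝ) => φ q.1 q.2)) {A D C : ℝ} (hA : 0 ≤ A) (hD : 0 ≤ D)
    (hb : ∀ γ b, |φ γ b| ≤ C + ∑ k, (A * |b k| + D * |γ k|)) :
    Continuous (fun γ => EP p x γ (fun _ b => φ γ b)) := by
  unfold EP
  refine continuous_finsetSum _ fun s _ => continuous_const.mul ?_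
  have hpl : Continuous (fun q : (ι → ℝ) × (ι → ℝ) => (q.1, pl x q.1 s q.2)) := by
    refine continuous_fst.prodMk ?_
    unfold pl
    refine continuous_pi fun k => ?_
    have h1 : Continuous (fun q : (ι → ℝ) × (ι → ℝ) => q.1 k) := by fun_prop
    exact (h1.mul continuous_const).add (h1.sqrt.mul (by fun_prop))
  have hc := hφ.comp hpl
  rw [continuous_iff_continuousAt]
  intro γ0
  refine continuousAt_of_dominated (bound := fun z => C + ∑ k, (A * ((|γ0 k| + 1) * |x s k| + √(|γ0 k| + 1) * |z k|)
    + D * (|γ0 k| + 1))) ?_ ?_ ?_ ?_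
  · refine Eventually.of_forall fun γ => ?_
    exact (hc.comp (Continuous.prodMk_right γ)).aestronglyMeasurable
  · have hn : ∀ᶠ γ in 𝓝 γ0, ∀ k, |γ k| < |γ0 k| + 1 := by
      rw [eventually_all]
      intro k
      have : Continuous (fun γ : ι → ℝ => |γ k|) := by fun_prop
      exact this.continuousAt.eventually_lt continuousAt_const (by simp)
    filter_upwards [hn] with γ hγ
    refine ae_of_all _ fun z => ?_
    rw [Real.norm_eq_abs]
    refine (hb γ _).trans ?_
    gcongr with k _ k _
    · unfold pl
      refine (abs_add_le _ _).trans ?_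
      rw [abs_mul, abs_mul, abs_of_nonneg (Real.sqrt_nonneg _)]
      gcongr
      · exact (hγ k).le
      · exact (le_abs_self _).trans (hγ k).le
    · exact (hγ k).le
  · have := integrable_lin (ι := ι) (fun k => A * √(|γ0 k| + 1))
        (C + ∑ k, (A * ((|γ0 k| + 1) * |x s k|) + D * (|γ0 k| + 1)))
    refine this.congr (ae_of_all _ fun z => ?_)
    simp only
    rw [add_assoc, ← Finset.sum_add_distrib]
    congr 1
    exact Finset.sum_congr rfl fun k _ => by ring
  · refine ae_of_all _ fun z => ?_
    exact (hc.comp (Continuous.prodMk_left z)).continuousAt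

lemma continuous_EP_logL (hp : Prob p) {B : ℝ} (hB0 : 0 ≤ B) (hB : ∀ s k, |x s k| ≤ B) :
    Continuous (fun γ => EP p x γ (fun _ b => Real.log (Lf p x γ b))) := by
  refine continuous_EP (φ := fun γ b => Real.log (Lf p x γ b)) (continuous_logL hp) hB0 (sq_nonneg B) (C := 0) ?_
  intro γ b
  rw [zero_add]
  refine (logL_bound hp hB γ b).trans (le_of_eq (Finset.sum_congr rfl fun k _ => by ring))

lemma continuous_EP_bdd {φ : (ι → ℝ) → (ι → ℝ) → ℝ}
    (hφ : Continuous (fun q : (ι → ℝ) × (ι → ℝ) => φ q.1 q.2)) {C : ℝ}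
    (hb : ∀ γ b, |φ γ b| ≤ C) :
    Continuous (fun γ => EP p x γ (fun _ b => φ γ b)) := by
  refine continuous_EP hφ le_rfl le_rfl (C := C) ?_
  intro γ b
  simpa using hb γ b

variable {γ d : ι → ℝ} {T : Set ℝ}

lemma isOpen_pos (γ d : ι → ℝ) : IsOpen {t : ℝ | ∀ k, 0 < lp γ d t k} := by
  have : {t : ℝ | ∀ k, 0 < lp γ d t k} = ⋂ k, {t : ℝ | 0 < lp γ d t k} := by ext t; simp
  rw [this]
  refine isOpen_iInter_of_finite fun k => isOpen_lt continuous_const (by unfold lp; fun_prop)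

lemma continuous_lp (γ d : ι → ℝ) : Continuous (lp γ d) := by
  unfold lp; fun_prop

lemma gen_mn_sq (hp : Prob p) (i : ι) :
    Gen p x γ d T (fun t b => mn p x i (lp γ d t) b ^ 2)
      (fun k t b => 2 * (mn p x i (lp γ d t) b * cc p x i k (lp γ d t) b))
      (fun t b => ∑ k, d k * cc p x i k (lp γ d t) b ^ 2) := by
  have h := gen_av (x := x) (γ := γ) (d := d) (T := T) hp (fun s => x s i)
  have := h.mul h (BM.av hp T γ d _) (BM.av hp T γ d _)
  convert this using 1
  · ext t b; exact sq _
  · ext k t b; unfold cc mn; ring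
  · ext t b
    simp only [zero_mul, mul_zero, add_zero, zero_add]
    exact Finset.sum_congr rfl fun k _ => by unfold cc; ring

lemma BM.mn_sq (hp : Prob p) (i : ι) : BM T (fun t b => mn p x i (lp γ d t) b ^ 2) := by
  have := (BM.av (x := x) hp T γ d (fun s => x s i)).mul (BM.av (x := x) hp T γ d (fun s => x s i))
  simp only [← sq] at this
  exact this

lemma BM.mn (hp : Prob p) (i : ι) : BM T (fun t b => ASS.mn p x i (lp γ d t) b) := BM.av (x := x) hp T γ d (fun s => x s i)

/-- First derivative of the free energy. -/
lemma deriv_f (hp : Prob p) {B : ℝ} (hB : ∀ s k, |x s k| ≤ B) {t : ℝ} (ht : ∀ k, 0 < lp γ d t k) :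
    HasDerivAt (fun t => EP p x (lp γ d t) (fun _ b => Real.log (Lf p x (lp γ d t) b)))
      (EP p x (lp γ d t) (fun _ b => ∑ k, d k * (1 / 2 * mn p x k (lp γ d t) b ^ 2))) t :=
  (gen_logL (T := {t | ∀ k, 0 < lp γ d t k}) hp).deriv hp (isOpen_pos γ d) (fun t ht => ht) ht (EI_logL hp hB _ _)

/-- Second derivative of the free energy. -/
lemma deriv_f2 (hp : Prob p) {t : ℝ} (ht : ∀ k, 0 < lp γ d t k) :
    ∃ D, 0 ≤ D ∧ HasDerivAt (fun t => EP p x (lp γ d t) (fun _ b => ∑ k, d k * (1 / 2 * mn p x k (lp γ d t) b ^ 2))) D t := by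
  have h1 : ∀ k, Gen p x γ d {t | ∀ k, 0 < lp γ d t k} (fun t b => d k * (1 / 2 * mn p x k (lp γ d t) b ^ 2)) _ _ :=
    fun k => ((Gen.time (p := p) (x := x) (γ := γ) (d := d) (T := {t | ∀ k, 0 < lp γ d t k}) (c := fun _ => d k)
      (c' := fun _ => 0) (C := 0) (fun t _ => hasDerivAt_const t (d k)) (by simp))).mul
     ((Gen.time (p := p) (x := x) (γ := γ) (d := d) (T := {t | ∀ k, 0 < lp γ d t k}) (c := fun _ => 1 / 2)
      (c' := fun _ => 0) (C := 0) (fun t _ => hasDerivAt_const t (1 / 2)) (by simp)).mul (gen_mn_sq hp k)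
      (BM.const _ _) (BM.mn_sq hp k)) (BM.const _ _) ((BM.mn_sq hp k).smul _)
  have h2 := Gen.sum Finset.univ h1
  have b2 : BM {t | ∀ k, 0 < lp γ d t k} (fun t b => ∑ k, d k * (1 / 2 * mn p x k (lp γ d t) b ^ 2)) :=
    BM.sum _ fun k _ => ((BM.mn_sq hp k).smul _).smul _
  refine ⟨_, ?_, h2.deriv hp (isOpen_pos γ d) (fun t ht => ht) ht (b2.EI ht _)⟩
  refine EP_nonneg hp fun _ b => ?_
  have := psd (x := x) hp d (lp γ d t) b
  have e : ∑ k, d k * ∑ l, d l * cc p x k l (lp γ d t) b ^ 2 = 2 * ∑ k, d k * ((1 / 2) * ∑ l, d l * cc p x k l (lp γ d t) b ^ 2) := by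
    rw [Finset.mul_sum]; exact Finset.sum_congr rfl fun k _ => by ring
  rw [e] at this
  simp only [zero_mul, mul_zero, add_zero, zero_add, Finset.sum_const_zero]
  linarith

/-- Tangent inequality. -/
theorem tangent (hp : Prob p) {B : ℝ} (hB0 : 0 ≤ B) (hB : ∀ s k, |x s k| ≤ B) {γ γ' : ι → ℝ} (h0 : ∀ k, 0 < γ k)
    (h1 : ∀ k, 0 ≤ γ' k) :
    EP p x γ (fun _ b => Real.log (Lf p x γ b))
      + EP p x γ (fun _ b => ∑ k, (γ' k - γ k) * (1 / 2 * mn p x k γ b ^ 2))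
      ≤ EP p x γ' (fun _ b => Real.log (Lf p x γ' b)) := by
  set d : ι → ℝ := fun k => γ' k - γ k with hd
  have e0 : lp γ d 0 = γ := by ext k; simp [lp]
  have e1 : lp γ d 1 = γ' := by ext k; simp [lp, hd]
  have hpos : ∀ t, 0 ≤ t → t < 1 → ∀ k, 0 < lp γ d t k := by
    intro t ht0 ht1 k
    have : lp γ d t k = (1 - t) * γ k + t * γ' k := by simp only [lp, hd]; ring
    rw [this]
    have := mul_pos (sub_pos.2 ht1) (h0 k)
    have := mul_nonneg ht0 (h1 k)
    linarith
  set f := fun t => EP p x (lp γ d t) (fun _ b => Real.log (Lf p x (lp γ d t) b)) with hf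
  set φ := fun t => EP p x (lp γ d t) (fun _ b => ∑ k, d k * (1 / 2 * mn p x k (lp γ d t) b ^ 2)) with hφ
  have hfc : Continuous f := (continuous_EP_logL hp hB0 hB).comp (continuous_lp γ d)
  have hf' : ∀ t, 0 ≤ t → t < 1 → HasDerivAt f (φ t) t := fun t h0 h1 => deriv_f hp hB (hpos t h0 h1)
  have hφ' : ∀ t, 0 ≤ t → t < 1 → ∃ D, 0 ≤ D ∧ HasDerivAt φ D t := fun t h0 h1 => deriv_f2 hp (hpos t h0 h1)
  have mono : MonotoneOn φ (Set.Ico 0 1) := by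
    refine monotoneOn_of_deriv_nonneg (convex_Ico 0 1) ?_ ?_ ?_
    · intro t ht
      obtain ⟨D, _, h⟩ := hφ' t ht.1 ht.2
      exact h.continuousAt.continuousWithinAt
    · intro t ht
      rw [interior_Ico] at ht
      obtain ⟨D, _, h⟩ := hφ' t ht.1.le ht.2
      exact h.differentiableAt.differentiableWithinAt
    · intro t ht
      rw [interior_Ico] at ht
      obtain ⟨D, hD, h⟩ := hφ' t ht.1.le ht.2
      rw [h.deriv]; exact hD
  have hg : ∀ t, 0 ≤ t → t < 1 → HasDerivAt (fun t => f t - t * φ 0) (φ t - φ 0) t := by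
    intro t a b
    have := (hf' t a b).sub ((hasDerivAt_id' t).mul_const (φ 0))
    rw [one_mul] at this
    exact this
  have mono2 : MonotoneOn (fun t => f t - t * φ 0) (Set.Icc 0 1) := by
    refine monotoneOn_of_deriv_nonneg (convex_Icc 0 1) ?_ ?_ ?_
    · exact (hfc.sub (by fun_prop)).continuousOn
    · intro t ht
      rw [interior_Icc] at ht
      exact (hg t ht.1.le ht.2).differentiableAt.differentiableWithinAt
    · intro t ht
      rw [interior_Icc] at ht
      rw [(hg t ht.1.le ht.2).deriv]
      have := mono ⟨le_rfl, zero_lt_one⟩ ⟨ht.1.le, ht.2⟩ ht.1.le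
      linarith
  have := mono2 (Set.left_mem_Icc.2 zero_le_one) (Set.right_mem_Icc.2 zero_le_one) zero_le_one
  simp only [zero_mul, sub_zero, one_mul] at this
  have hfin : f 0 + φ 0 ≤ f 1 := by linarith
  simp only [hf, hφ, e0, e1] at hfin
  exact hfin

/-- Monotonicity in the signal to noise ratios. -/
theorem f_mono (hp : Prob p) {B : ℝ} (hB0 : 0 ≤ B) (hB : ∀ s k, |x s k| ≤ B) {γ γ' : ι → ℝ} (h0 : ∀ k, 0 ≤ γ k)
    (h1 : ∀ k, 0 < γ' k) (hle : ∀ k, γ k ≤ γ' k) :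
    EP p x γ (fun _ b => Real.log (Lf p x γ b)) ≤ EP p x γ' (fun _ b => Real.log (Lf p x γ' b)) := by
  set d : ι → ℝ := fun k => γ' k - γ k with hd
  have e0 : lp γ d 0 = γ := by ext k; simp [lp]
  have e1 : lp γ d 1 = γ' := by ext k; simp [lp, hd]
  have hpos : ∀ t, 0 < t → t < 1 → ∀ k, 0 < lp γ d t k := by
    intro t ht0 ht1 k
    have : lp γ d t k = (1 - t) * γ k + t * γ' k := by simp only [lp, hd]; ring
    rw [this]
    have := mul_nonneg (sub_pos.2 ht1).le (h0 k)
    have := mul_pos ht0 (h1 k)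
    linarith
  set f := fun t => EP p x (lp γ d t) (fun _ b => Real.log (Lf p x (lp γ d t) b)) with hf
  have hfc : Continuous f := (continuous_EP_logL hp hB0 hB).comp (continuous_lp γ d)
  have mono2 : MonotoneOn f (Set.Icc 0 1) := by
    refine monotoneOn_of_deriv_nonneg (convex_Icc 0 1) hfc.continuousOn ?_ ?_
    · intro t ht
      rw [interior_Icc] at ht
      exact (deriv_f hp hB (hpos t ht.1 ht.2)).differentiableAt.differentiableWithinAt
    · intro t ht
      rw [interior_Icc] at ht
      rw [(deriv_f hp hB (hpos t ht.1 ht.2)).deriv]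
      refine EP_nonneg hp fun _ b => Finset.sum_nonneg fun k _ => ?_
      have : 0 ≤ d k := sub_nonneg.2 (hle k)
      positivity
  have := mono2 (Set.left_mem_Icc.2 zero_le_one) (Set.right_mem_Icc.2 zero_le_one) zero_le_one
  simp only [hf, e0, e1] at this
  exact this

end consequences
end ASS

namespace ASS

set_option linter.unusedSectionVars false
set_option linter.unusedVariables false
set_option autoImplicit false

section quenched
variable {σ ι : Type*} [Fintype σ] [Fintype ι] [DecidableEq ι]
variable {p : σ → ℝ} {x : σ → ι → ℝ}

/-- Sum of squared means. -/
def Wf (p : σ → ℝ) (x : σ → ι → ℝ) (V : Finset ι) (γ b : ι → ℝ) : ℝ := ∑ k ∈ V, mn p x k γ b ^ 2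

/-- Indicator direction. -/
def ind (V : Finset ι) : ι → ℝ := fun k => if k ∈ V then 1 else 0

lemma sum_ind (V : Finset ι) (f : ι → ℝ) : ∑ k, ind V k * f k = ∑ k ∈ V, f k := by
  simp [ind, Finset.sum_ite_mem]

lemma memLp_coord (k : ι) : MemLp (fun z : ι → ℝ => z k) 2 (gp ι) := by
  rw [memLp_two_iff_integrable_sq (measurable_pi_apply k).aestronglyMeasurable]
  have := (measurePreserving_eval (fun _ : ι => stdG) k).integrable_comp_of_integrable integrable_sq_stdG
  exact this

lemma logL_pl_bound (hp : Prob p) {B : ℝ} (hB0 : 0 ≤ B) (hB : ∀ s k, |x s k| ≤ B) (γ γ' : ι → ℝ) (s : σ) (z : ι → ℝ) :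
    |Real.log (Lf p x γ' (pl x γ s z))| ≤ (∑ k, (B * (|γ k| * B) + |γ' k| * B ^ 2)) + ∑ k, (B * √(γ k)) * |z k| := by
  refine (logL_bound hp hB γ' _).trans ?_
  rw [← Finset.sum_add_distrib]
  refine Finset.sum_le_sum fun k _ => ?_
  have : |pl x γ s z k| ≤ |γ k| * B + √(γ k) * |z k| := by
    unfold pl
    refine (abs_add_le _ _).trans ?_
    rw [abs_mul, abs_mul, abs_of_nonneg (Real.sqrt_nonneg _)]
    gcongr
    exact hB s k
  have := mul_le_mul_of_nonneg_left this hB0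
  linarith

lemma memLp_logL (hp : Prob p) {B : ℝ} (hB0 : 0 ≤ B) (hB : ∀ s k, |x s k| ≤ B) (γ γ' : ι → ℝ) (s : σ) :
    MemLp (fun z => Real.log (Lf p x γ' (pl x γ s z))) 2 (gp ι) := by
  have h : MemLp (fun z : ι → ℝ => (∑ k, (B * (|γ k| * B) + |γ' k| * B ^ 2)) + ∑ k, (B * √(γ k)) * |z k|) 2 (gp ι) := by
    have h1 : ∀ k : ι, MemLp (fun z : ι → ℝ => (B * √(γ k)) * |z k|) 2 (gp ι) := fun k =>
      ((memLp_coord k).abs).const_mul _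
    have h2 : MemLp (fun z : ι → ℝ => ∑ k, (B * √(γ k)) * |z k|) 2 (gp ι) := memLp_finsetSum _ fun k _ => h1 k
    have h3 : MemLp (fun _ : ι → ℝ => ∑ k, (B * (|γ k| * B) + |γ' k| * B ^ 2)) 2 (gp ι) := memLp_const _
    exact h3.add h2
  refine h.mono ((measurable_logL hp γ').comp (continuous_pl γ s).measurable).aestronglyMeasurable
    (ae_of_all _ fun z => ?_)
  rw [Real.norm_eq_abs, Real.norm_eq_abs]
  exact (logL_pl_bound hp hB0 hB γ γ' s z).trans (le_abs_self _)

lemma EI_logL_sq (hp : Prob p) {B : ℝ} (hB0 : 0 ≤ B) (hB : ∀ s k, |x s k| ≤ B) (γ γ' : ι → ℝ) (c : ℝ) :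
    EI x γ (fun _ b => (Real.log (Lf p x γ' b) - c) ^ 2) := fun s =>
  ((memLp_logL hp hB0 hB γ γ' s).sub (memLp_const c)).integrable_sq

lemma Wf_nonneg (V : Finset ι) (γ b : ι → ℝ) : 0 ≤ Wf p x V γ b := Finset.sum_nonneg fun _ _ => sq_nonneg _

lemma mn_sq_le (hp : Prob p) {K : ℝ} (k : ι) (hK : ∀ s, |x s k| ≤ K) (γ b : ι → ℝ) : mn p x k γ b ^ 2 ≤ K ^ 2 := by
  rw [← sq_abs]
  exact pow_le_pow_left₀ (abs_nonneg _) (av_abs_le hp hK γ b) 2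

lemma Wf_le (hp : Prob p) {K : ℝ} (V : Finset ι) (hK : ∀ s, ∀ k ∈ V, |x s k| ≤ K) (γ b : ι → ℝ) :
    Wf p x V γ b ≤ V.card * K ^ 2 := by
  unfold Wf
  rw [← nsmul_eq_mul]
  exact Finset.sum_le_card_nsmul _ _ _ fun k hk => mn_sq_le hp k (fun s => hK s k hk) γ b

/-- The cross term is a variance. -/
lemma cross_eq (hp : Prob p) (V : Finset ι) (γ b : ι → ℝ) :
    ∑ k ∈ V, mn p x k γ b * ∑ i ∈ V, (mn p x i γ b * cc p x i k γ b)
      = cv p x (fun s => ∑ i ∈ V, mn p x i γ b * x s i) (fun s => ∑ i ∈ V, mn p x i γ b * x s i) γ b := by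
  rw [cv_sum_left hp]
  refine Finset.sum_congr rfl fun k _ => ?_
  rw [cv_comm, cv_sum_left hp]
  rfl

lemma cross_nonneg (hp : Prob p) (V : Finset ι) (γ b : ι → ℝ) :
    0 ≤ ∑ k ∈ V, mn p x k γ b * ∑ i ∈ V, (mn p x i γ b * cc p x i k γ b) := by
  rw [cross_eq hp]; exact cv_self_nonneg hp _ _ _

lemma cross_le (hp : Prob p) {K : ℝ} (hK0 : 0 ≤ K) (V : Finset ι) (hK : ∀ s, ∀ k ∈ V, |x s k| ≤ K) (γ b : ι → ℝ) :
    ∑ k ∈ V, mn p x k γ b * ∑ i ∈ V, (mn p x i γ b * cc p x i k γ b) ≤ (V.card * K ^ 2) ^ 2 := by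
  rw [cross_eq hp]
  unfold cv
  have h1 : av p x (fun s => (∑ i ∈ V, mn p x i γ b * x s i) * (∑ i ∈ V, mn p x i γ b * x s i)) γ b ≤ (V.card * K ^ 2) ^ 2 := by
    rw [← av_const (x := x) hp ((V.card * K ^ 2) ^ 2) γ b]
    refine av_mono hp (fun s => ?_) γ b
    rw [← sq, ← sq_abs]
    refine pow_le_pow_left₀ (abs_nonneg _) ?_ 2
    refine (Finset.abs_sum_le_sum_abs _ _).trans ?_
    rw [← nsmul_eq_mul]
    refine Finset.sum_le_card_nsmul _ _ _ fun k hk => ?_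
    rw [abs_mul, sq]
    exact mul_le_mul (av_abs_le hp (fun s => hK s k hk) γ b) (hK s k hk) (abs_nonneg _) hK0
  have h2 := mul_self_nonneg (av p x (fun s => ∑ i ∈ V, mn p x i γ b * x s i) γ b)
  linarith

variable {γ : ι → ℝ} {V : Finset ι}

lemma gen_W (hp : Prob p) (d : ι → ℝ) (T : Set ℝ) :
    Gen p x γ d T (fun t b => Wf p x V (lp γ d t) b)
      (fun k t b => ∑ i ∈ V, 2 * (mn p x i (lp γ d t) b * cc p x i k (lp γ d t) b))
      (fun t b => ∑ i ∈ V, ∑ k, d k * cc p x i k (lp γ d t) b ^ 2) :=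
  Gen.sum V fun i => gen_mn_sq hp i

lemma BM.W (hp : Prob p) (d : ι → ℝ) (T : Set ℝ) : BM T (fun t b => Wf p x V (lp γ d t) b) :=
  BM.sum V fun i _ => BM.mn_sq hp i

lemma deriv_W (hp : Prob p) (d : ι → ℝ) {t : ℝ} (ht : ∀ k, 0 < lp γ d t k) :
    HasDerivAt (fun t => EP p x (lp γ d t) (fun _ b => Wf p x V (lp γ d t) b))
      (EP p x (lp γ d t) (fun _ b => ∑ i ∈ V, ∑ k, d k * cc p x i k (lp γ d t) b ^ 2)) t :=
  (gen_W (T := {t | ∀ k, 0 < lp γ d t k}) hp d).deriv hp (isOpen_pos γ d) (fun t ht => ht) ht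
    ((BM.W (T := {t | ∀ k, 0 < lp γ d t k}) hp d).EI ht _)

lemma pointwise_bound {θ y W c' DW X M : ℝ} (hθ : 0 ≤ θ) (hW0 : 0 ≤ W) (hWM : W ≤ M) (hc0 : 0 ≤ c')
    (hcM : c' ≤ M / 2) (hDW : 0 ≤ DW) (hX0 : 0 ≤ X) (hXM : X ≤ M ^ 2) :
    θ * ((1 / 2 * W - c') * W) - 5 / 4 * θ ^ 3 * M ^ 2 * y ^ 2 - 1 / 2 * θ ^ 2 * M ^ 2
      ≤ ((θ * Real.cos (θ * y)) * (1 / 2 * W - c') + 1 / 2 * ((-θ ^ 2 * Real.sin (θ * y)) * W)) * W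
        + Real.sin (θ * y) * DW + θ * Real.cos (θ * y) * (2 * X) + DW := by
  have hc1 : 1 - Real.cos (θ * y) ≤ (θ * y) ^ 2 / 2 := by
    have := Real.one_sub_sq_div_two_le_cos (x := θ * y); linarith
  have hc2 : 0 ≤ 1 - Real.cos (θ * y) := by linarith [Real.cos_le_one (θ * y)]
  set q := 1 - Real.cos (θ * y) with hq
  have hcos : Real.cos (θ * y) = 1 - q := by rw [hq]; ring
  have hs1 := Real.sin_le_one (θ * y)
  have hs2 := Real.neg_one_le_sin (θ * y)
  set S := Real.sin (θ * y)
  rw [hcos]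
  have hM : 0 ≤ M := hW0.trans hWM
  have a1 : W ^ 2 ≤ M ^ 2 := pow_le_pow_left₀ hW0 hWM 2
  have a2 : (1 / 2 * W - c') * W ≤ M ^ 2 / 2 := by nlinarith
  have a3 : 0 ≤ (S + 1) * DW := mul_nonneg (by linarith) hDW
  have a4 : S * W ^ 2 ≤ M ^ 2 := by nlinarith [sq_nonneg W]
  have a5 : θ ^ 2 * (S * W ^ 2) ≤ θ ^ 2 * M ^ 2 := mul_le_mul_of_nonneg_left a4 (sq_nonneg θ)
  have a6 : θ * q * ((1 / 2 * W - c') * W) ≤ θ * q * (M ^ 2 / 2) := mul_le_mul_of_nonneg_left a2 (mul_nonneg hθ hc2)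
  have a7 : θ * q * (2 * X) ≤ θ * q * (2 * M ^ 2) := mul_le_mul_of_nonneg_left (by linarith) (mul_nonneg hθ hc2)
  have a8 : θ * q * (5 / 2 * M ^ 2) ≤ θ * ((θ * y) ^ 2 / 2) * (5 / 2 * M ^ 2) := by gcongr
  have a9 : 0 ≤ θ * X := mul_nonneg hθ hX0
  nlinarith

/-- Quenched fluctuation inequality. -/
theorem quenched (hp : Prob p) {B K : ℝ} (hB0 : 0 ≤ B) (hB : ∀ s k, |x s k| ≤ B) (hK0 : 0 ≤ K)
    (hK : ∀ s, ∀ k ∈ V, |x s k| ≤ K) {θ : ℝ} (hθ : 0 ≤ θ) :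
    ∃ Θ Θ' : ℝ → ℝ, (∀ t, |Θ t| ≤ 2 * (V.card * K ^ 2)) ∧
      ∀ t, (∀ k, 0 < lp γ (ind V) t k) → HasDerivAt Θ (Θ' t) t ∧
        θ / 2 * EP p x (lp γ (ind V) t) (fun _ b => (Wf p x V (lp γ (ind V) t) b
            - EP p x (lp γ (ind V) t) (fun _ b => Wf p x V (lp γ (ind V) t) b)) ^ 2)
          - 5 / 4 * θ ^ 3 * (V.card * K ^ 2) ^ 2 * EP p x (lp γ (ind V) t) (fun _ b =>
            (Real.log (Lf p x (lp γ (ind V) t) b) - EP p x (lp γ (ind V) t)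
              (fun _ b => Real.log (Lf p x (lp γ (ind V) t) b))) ^ 2)
          - 1 / 2 * θ ^ 2 * (V.card * K ^ 2) ^ 2 ≤ Θ' t := by
  set d := ind V with hd
  set M : ℝ := V.card * K ^ 2 with hM
  have hM0 : 0 ≤ M := by positivity
  set T : Set ℝ := {t | ∀ k, 0 < lp γ d t k} with hT
  have hTo : IsOpen T := isOpen_pos γ d
  set c : ℝ → ℝ := fun t => EP p x (lp γ d t) (fun _ b => Real.log (Lf p x (lp γ d t) b)) with hc
  set c' : ℝ → ℝ := fun t => EP p x (lp γ d t) (fun _ b => ∑ k, d k * (1 / 2 * mn p x k (lp γ d t) b ^ 2)) with hc'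
  have hsumW : ∀ t b, ∑ k, d k * (1 / 2 * mn p x k (lp γ d t) b ^ 2) = 1 / 2 * Wf p x V (lp γ d t) b := by
    intro t b
    rw [hd, sum_ind, ← Finset.mul_sum]; rfl
  have hc'W : ∀ t, c' t = 1 / 2 * EP p x (lp γ d t) (fun _ b => Wf p x V (lp γ d t) b) := by
    intro t
    simp only [hc', hsumW]
    rw [EP_smul]
  have hWM : ∀ t b, Wf p x V (lp γ d t) b ≤ M := fun t b => Wf_le hp V hK _ _
  have hEW : ∀ t, |EP p x (lp γ d t) (fun _ b => Wf p x V (lp γ d t) b)| ≤ M := fun t =>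
    EP_abs_le hp fun _ b => by rw [abs_of_nonneg (Wf_nonneg _ _ _)]; exact hWM t b
  have hEW0 : ∀ t, 0 ≤ EP p x (lp γ d t) (fun _ b => Wf p x V (lp γ d t) b) := fun t =>
    EP_nonneg hp fun _ b => Wf_nonneg _ _ _
  have hc0 : ∀ t, 0 ≤ c' t := fun t => by rw [hc'W]; linarith [hEW0 t]
  have hcM : ∀ t, c' t ≤ M / 2 := fun t => by rw [hc'W]; linarith [(abs_le.1 (hEW t)).2]
  have hcd : ∀ t ∈ T, HasDerivAt c (c' t) t := fun t ht => deriv_f hp hB ht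
  have hG1 : Gen p x γ d T (fun t _ => c t) (fun _ _ _ => 0) (fun t _ => c' t) :=
    Gen.time (C := M / 2) hcd (fun t _ => by rw [abs_of_nonneg (hc0 t)]; exact hcM t)
  have hY := (gen_logL (T := T) (γ := γ) (d := d) (x := x) hp).sub hG1
  have hSin := hY.comp (f := fun y => Real.sin (θ * y)) (f' := fun y => θ * Real.cos (θ * y))
    (f'' := fun y => -θ ^ 2 * Real.sin (θ * y)) (C := max θ (θ ^ 2))
    (fun y => by
      have := ((hasDerivAt_id' y).const_mul θ).sin
      refine this.congr_deriv ?_; ring)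
    (fun y => by
      have := (((hasDerivAt_id' y).const_mul θ).cos).const_mul θ
      refine this.congr_deriv ?_; ring)
    (by fun_prop)
    (fun y => by
      rw [abs_mul, abs_of_nonneg hθ]
      exact (mul_le_of_le_one_right hθ (Real.abs_cos_le_one _)).trans (le_max_left _ _))
    (fun y => by
      rw [abs_mul, abs_neg, abs_of_nonneg (sq_nonneg θ)]
      exact (mul_le_of_le_one_right (sq_nonneg θ) (Real.abs_sin_le_one _)).trans (le_max_right _ _))
  have bS : BM T (fun t b => Real.sin (θ * (Real.log (Lf p x (lp γ d t) b) - c t))) :=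
    ⟨fun t _ => Real.measurable_sin.comp (((measurable_logL hp _).sub measurable_const).const_mul θ), 1,
      fun t _ b => Real.abs_sin_le_one _⟩
  have bW : BM T (fun t b => Wf p x V (lp γ d t) b) := BM.W hp d T
  have hSW := hSin.mul (gen_W (V := V) hp d T) bS bW
  have bD := hSW.bm hp
  have bDW := (gen_W (x := x) (γ := γ) (V := V) hp d T).bm hp
  have hder1 : ∀ t ∈ T, HasDerivAt _ _ t := fun t ht => hSW.deriv hp hTo (fun t ht => ht) ht ((bS.mul bW).EI ht _)
  have hder2 : ∀ t ∈ T, HasDerivAt _ _ t := fun t ht => deriv_W (p := p) (x := x) (V := V) hp d ht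
  refine ⟨_, fun t => _, ?_, fun t ht => ⟨(hder1 t ht).add (hder2 t ht), ?_⟩⟩
  · intro t
    simp only [Pi.add_apply]
    refine (abs_add_le _ _).trans ?_
    rw [two_mul]
    refine add_le_add (EP_abs_le hp fun _ b => ?_) (hEW t)
    rw [abs_mul, abs_of_nonneg (Wf_nonneg _ _ _)]
    exact (mul_le_of_le_one_left (Wf_nonneg _ _ _) (Real.abs_sin_le_one _)).trans (hWM t b)
  · beta_reduce
    rw [← EP_add (bD.EI ht _) (bDW.EI ht _)]
    have bWsq : BM T (fun t b => (1 / 2 * Wf p x V (lp γ d t) b - c' t) * Wf p x V (lp γ d t) b) :=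
      ((bW.smul _).sub (BM.time (C := M / 2) fun t _ => by rw [abs_of_nonneg (hc0 t)]; exact hcM t)).mul bW
    set E : ((ι → ℝ) → ℝ) → ℝ := fun φ => EP p x (lp γ d t) (fun _ b => φ b) with hE
    have hvar : EP p x (lp γ d t) (fun _ b => (1 / 2 * Wf p x V (lp γ d t) b - c' t) * Wf p x V (lp γ d t) b)
        = 1 / 2 * EP p x (lp γ d t) (fun _ b => (Wf p x V (lp γ d t) b
            - EP p x (lp γ d t) (fun _ b => Wf p x V (lp γ d t) b)) ^ 2) := by
      set m := EP p x (lp γ d t) (fun _ b => Wf p x V (lp γ d t) b) with hm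
      have e1 : ∀ b, (Wf p x V (lp γ d t) b - m) ^ 2
          = 2 * ((1 / 2 * Wf p x V (lp γ d t) b - c' t) * Wf p x V (lp γ d t) b)
            + (-m * Wf p x V (lp γ d t) b + m ^ 2) := by
        intro b; rw [hc'W]; ring
      simp_rw [e1]
      rw [EP_add ((bWsq.smul 2).EI ht _) (((bW.smul (-m)).add (BM.const T (m ^ 2))).EI ht _),
        EP_add ((bW.smul (-m)).EI ht _) ((BM.const T (m ^ 2)).EI ht _), EP_smul, EP_smul, EP_const hp, ← hm]
      ring
    have hEI2 := EI_logL_sq (p := p) hp hB0 hB (lp γ d t) (lp γ d t) (c t)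
    have key : EP p x (lp γ d t) (fun _ b => θ * ((1 / 2 * Wf p x V (lp γ d t) b - c' t) * Wf p x V (lp γ d t) b)
        - 5 / 4 * θ ^ 3 * M ^ 2 * (Real.log (Lf p x (lp γ d t) b) - c t) ^ 2 - 1 / 2 * θ ^ 2 * M ^ 2)
        = θ / 2 * EP p x (lp γ d t) (fun _ b => (Wf p x V (lp γ d t) b
            - EP p x (lp γ d t) (fun _ b => Wf p x V (lp γ d t) b)) ^ 2)
          - 5 / 4 * θ ^ 3 * M ^ 2 * EP p x (lp γ d t) (fun _ b =>
            (Real.log (Lf p x (lp γ d t) b) - c t) ^ 2) - 1 / 2 * θ ^ 2 * M ^ 2 := by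
      have i1 : EI x (lp γ d t) (fun _ b => θ * ((1 / 2 * Wf p x V (lp γ d t) b - c' t) * Wf p x V (lp γ d t) b)) :=
        (bWsq.smul θ).EI ht _
      have i2 : EI x (lp γ d t) (fun _ b => 5 / 4 * θ ^ 3 * M ^ 2 * (Real.log (Lf p x (lp γ d t) b) - c t) ^ 2) :=
        fun s => (hEI2 s).const_mul _
      have i3 : EI x (lp γ d t) (fun _ b => 1 / 2 * θ ^ 2 * M ^ 2) := (BM.const T _).EI ht _
      have i4 : EI x (lp γ d t) (fun _ b => θ * ((1 / 2 * Wf p x V (lp γ d t) b - c' t) * Wf p x V (lp γ d t) b)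
        - 5 / 4 * θ ^ 3 * M ^ 2 * (Real.log (Lf p x (lp γ d t) b) - c t) ^ 2) := fun s => (i1 s).sub (i2 s)
      rw [EP_sub i4 i3, EP_sub i1 i2, EP_smul, EP_smul, EP_const hp, hvar]
      ring
    rw [← key]
    refine EP_mono hp ?_ ((bD.add bDW).EI ht _) ?_
    · intro s
      have i1 := (bWsq.smul θ).EI (x := x) ht (lp γ d t) s
      exact (i1.sub ((hEI2 s).const_mul _)).sub (integrable_const _)
    · intro _ b
      have hX0 := cross_nonneg (x := x) hp V (lp γ d t) b
      have hXM := cross_le (x := x) hp hK0 V hK (lp γ d t) b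
      have hDW : 0 ≤ ∑ i ∈ V, ∑ k, d k * cc p x i k (lp γ d t) b ^ 2 := by
        refine Finset.sum_nonneg fun i _ => Finset.sum_nonneg fun k _ => mul_nonneg ?_ (sq_nonneg _)
        rw [hd]; unfold ind; split_ifs <;> norm_num
      refine (pointwise_bound (y := Real.log (Lf p x (lp γ d t) b) - c t) hθ (Wf_nonneg (p := p) (x := x) V (lp γ d t) b)
        (hWM t b) (hc0 t) (hcM t) hDW hX0 hXM).trans (le_of_eq ?_)
      simp only [sub_zero]
      rw [hsumW]
      have e3 : ∑ k, d k * mn p x k (lp γ d t) b ^ 2 = Wf p x V (lp γ d t) b := by rw [hd, sum_ind]; rfl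
      have e4 : ∀ κ : ℝ, ∑ k, d k * (κ * mn p x k (lp γ d t) b *
            ∑ i ∈ V, 2 * (mn p x i (lp γ d t) b * cc p x i k (lp γ d t) b))
          = κ * (2 * ∑ k ∈ V, mn p x k (lp γ d t) b * ∑ i ∈ V, (mn p x i (lp γ d t) b * cc p x i k (lp γ d t) b)) := by
        intro κ
        rw [hd, sum_ind, Finset.mul_sum, Finset.mul_sum]
        refine Finset.sum_congr rfl fun k _ => ?_
        rw [← Finset.mul_sum]
        ring
      rw [e3, e4]

end quenched
end ASS

namespace ASS

set_option linter.unusedSectionVars false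
set_option linter.unusedVariables false
set_option autoImplicit false

section efronstein

lemma sq_integral_le {Y : Type*} [MeasurableSpace Y] (ν : Measure Y) [IsProbabilityMeasure ν] {g : Y → ℝ}
    (hg : MemLp g 2 ν) : (∫ y, g y ∂ν) ^ 2 ≤ ∫ y, g y ^ 2 ∂ν := by
  have h := variance_nonneg g ν
  rw [variance_eq_sub hg] at h
  simp only [Pi.pow_apply] at h
  linarith

/-- Mean square deviation. -/
def msd {Y : Type*} [MeasurableSpace Y] (ν : Measure Y) (g : Y → ℝ) : ℝ := ∫ y, (g y - ∫ y', g y' ∂ν) ^ 2 ∂ν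

lemma msd_add_sq {Y : Type*} [MeasurableSpace Y] (ν : Measure Y) [IsProbabilityMeasure ν] {g : Y → ℝ}
    (hg : MemLp g 2 ν) (c : ℝ) : ∫ y, (g y - c) ^ 2 ∂ν = msd ν g + (∫ y, g y ∂ν - c) ^ 2 := by
  unfold msd
  set m := ∫ y, g y ∂ν with hm
  have hi : Integrable g ν := hg.integrable (by norm_num)
  have i1 : Integrable (fun y => (g y - m) ^ 2) ν := (hg.sub (memLp_const m)).integrable_sq
  have e : ∀ y, (g y - c) ^ 2 = (g y - m) ^ 2 + (2 * (m - c) * g y + (c ^ 2 - m ^ 2)) := by intro y; ring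
  simp_rw [e]
  have i2 : Integrable (fun y => 2 * (m - c) * g y + (c ^ 2 - m ^ 2)) ν := (hi.const_mul _).add (integrable_const _)
  rw [integral_add i1 i2, integral_add (hi.const_mul _) (integrable_const _), integral_const_mul, ← hm]
  simp
  ring

theorem msd_prod {X Y : Type*} [MeasurableSpace X] [MeasurableSpace Y] (μ : Measure X) (ν : Measure Y)
    [IsProbabilityMeasure μ] [IsProbabilityMeasure ν] {F : X × Y → ℝ} (hF : MemLp F 2 (μ.prod ν))
    (hm : Measurable F) {a b : ℝ} (ha : ∀ y, msd μ (fun x => F (x, y)) ≤ a)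
    (hb : ∀ x, msd ν (fun y => F (x, y)) ≤ b) : msd (μ.prod ν) F ≤ a + b := by
  have hFi : Integrable F (μ.prod ν) := hF.integrable (by norm_num)
  have hFsq : Integrable (fun q => F q ^ 2) (μ.prod ν) := hF.integrable_sq
  set m := ∫ q, F q ∂(μ.prod ν) with hmdef
  set H : Y → ℝ := fun y => ∫ x, F (x, y) ∂μ with hH
  have hHm : StronglyMeasurable H := hm.stronglyMeasurable.integral_prod_left'
  have sl2 : ∀ᵐ y ∂ν, MemLp (fun x => F (x, y)) 2 μ := by
    filter_upwards [hFsq.prod_left_ae] with y hy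
    have hmy : Measurable (fun x => F (x, y)) := hm.comp measurable_prodMk_right
    rw [memLp_two_iff_integrable_sq hmy.aestronglyMeasurable]
    exact hy
  have sl1 : ∀ᵐ x ∂μ, MemLp (fun y => F (x, y)) 2 ν := by
    filter_upwards [hFsq.prod_right_ae] with x hx
    have hmy : Measurable (fun y => F (x, y)) := hm.comp measurable_prodMk_left
    rw [memLp_two_iff_integrable_sq hmy.aestronglyMeasurable]
    exact hx
  have hH2 : MemLp H 2 ν := by
    rw [memLp_two_iff_integrable_sq hHm.aestronglyMeasurable]
    refine (hFsq.integral_prod_right).mono' (hHm.pow 2).aestronglyMeasurable ?_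
    filter_upwards [sl2] with y hy
    rw [Real.norm_eq_abs, abs_of_nonneg (sq_nonneg _)]
    exact sq_integral_le μ hy
  have hH2' : MemLp (fun q : X × Y => H q.2) 2 (μ.prod ν) := hH2.comp_measurePreserving measurePreserving_snd
  have hD : MemLp (fun q : X × Y => F q - H q.2) 2 (μ.prod ν) := hF.sub hH2'
  have hDsq : Integrable (fun q : X × Y => (F q - H q.2) ^ 2) (μ.prod ν) := hD.integrable_sq
  have hEH : ∫ y, H y ∂ν = m := by
    rw [hmdef, integral_prod_symm _ hFi]
  have hmsq : Integrable (fun q : X × Y => (F q - m) ^ 2) (μ.prod ν) := (hF.sub (memLp_const m)).integrable_sq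
  have hHi : Integrable H ν := hH2.integrable (by norm_num)
  unfold msd
  rw [← hmdef, integral_prod _ hmsq]
  have step : ∀ᵐ x ∂μ, ∫ y, (F (x, y) - m) ^ 2 ∂ν ≤ b + ∫ y, (F (x, y) - H y) ^ 2 ∂ν := by
    filter_upwards [sl1] with x hx
    rw [msd_add_sq ν hx m]
    refine add_le_add (hb x) ?_
    have h1 : ∫ y, F (x, y) ∂ν - m = ∫ y, (F (x, y) - H y) ∂ν := by
      rw [integral_sub (hx.integrable (by norm_num)) hHi, hEH]
    rw [h1]
    exact sq_integral_le ν (hx.sub hH2)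
  have i3 : Integrable (fun x => b + ∫ y, (F (x, y) - H y) ^ 2 ∂ν) μ :=
    (integrable_const b).add hDsq.integral_prod_left
  refine (integral_mono_ae hmsq.integral_prod_left i3 step).trans ?_
  rw [integral_add (integrable_const b) hDsq.integral_prod_left]
  have e4 : ∫ x, ∫ y, (F (x, y) - H y) ^ 2 ∂ν ∂μ = ∫ y, msd μ (fun x => F (x, y)) ∂ν := by
    have h1 := integral_prod _ hDsq
    have h2 := integral_prod_symm _ hDsq
    rw [h1] at h2
    exact h2
  have e5 : ∫ y, msd μ (fun x => F (x, y)) ∂ν ≤ a := by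
    have : ∫ y, msd μ (fun x => F (x, y)) ∂ν ≤ ∫ y, a ∂ν := by
      refine integral_mono hDsq.integral_prod_right (integrable_const a) ha
    simpa using this
  rw [e4]
  simp
  linarith

lemma msd_le_of_dev {Y : Type*} [MeasurableSpace Y] (ν : Measure Y) [IsProbabilityMeasure ν] {g r : Y → ℝ}
    (hg : Measurable g) (hr : MemLp r 2 ν) {c0 c : ℝ} (hc : 0 ≤ c) (h : ∀ y, |g y - c0| ≤ c * r y)
    (hr1 : ∫ y, r y ^ 2 ∂ν ≤ 1) : msd ν g ≤ c ^ 2 := by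
  have h2 : MemLp (fun y => g y - c0) 2 ν :=
    (hr.const_mul c).mono (hg.sub measurable_const).aestronglyMeasurable (ae_of_all _ fun y => by
      rw [Real.norm_eq_abs, Real.norm_eq_abs]; exact (h y).trans (le_abs_self _))
  have h3 : MemLp g 2 ν := by
    have := h2.add (memLp_const c0)
    refine this.ae_eq (ae_of_all _ fun y => ?_)
    simp
  have h4 := msd_add_sq ν h3 c0
  have h5 : ∫ y, (g y - c0) ^ 2 ∂ν ≤ ∫ y, c ^ 2 * r y ^ 2 ∂ν := by
    refine integral_mono h2.integrable_sq (hr.integrable_sq.const_mul _) fun y => ?_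
    simp only
    rw [← mul_pow, ← sq_abs]
    exact pow_le_pow_left₀ (abs_nonneg _) (h y) 2
  rw [integral_const_mul] at h5
  have := sq_nonneg (∫ y, g y ∂ν - c0)
  nlinarith [sq_nonneg c]

/-- Coordinatewise deviation bound. -/
def Dev {κ E : Type*} [DecidableEq κ] (F : (κ → E) → ℝ) (c : κ → ℝ) (r : E → ℝ) (e0 : E) : Prop :=
  ∀ ω i y, |F (Function.update ω i y) - F (Function.update ω i e0)| ≤ c i * r y

lemma Dev.global {κ E : Type*} [DecidableEq κ] [Fintype κ] {F : (κ → E) → ℝ} {c : κ → ℝ} {r : E → ℝ} {e0 : E}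
    (h : Dev F c r e0) (ω : κ → E) : |F ω - F (fun _ => e0)| ≤ ∑ i, c i * r (ω i) := by
  have key : ∀ u : Finset κ, |F (fun i => if i ∈ u then ω i else e0) - F (fun _ => e0)| ≤ ∑ i ∈ u, c i * r (ω i) := by
    intro u
    induction u using Finset.induction_on with
    | empty => simp
    | insert j u hj ih =>
      rw [Finset.sum_insert hj]
      have e1 : (fun i => if i ∈ insert j u then ω i else e0)
          = Function.update (fun i => if i ∈ u then ω i else e0) j (ω j) := by
        ext i
        by_cases hi : i = j
        · subst hi; simp
        · simp [hi]
      have e2 : (fun i => if i ∈ u then ω i else e0)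
          = Function.update (fun i => if i ∈ u then ω i else e0) j e0 := by
        ext i
        by_cases hi : i = j
        · subst hi; simp [hj]
        · simp [hi]
      have h1 := h (fun i => if i ∈ u then ω i else e0) j (ω j)
      rw [← e1, ← e2] at h1
      exact (abs_sub_le _ _ _).trans (add_le_add h1 ih)
  simpa using key Finset.univ

theorem Dev.memLp {κ E : Type*} [DecidableEq κ] [Fintype κ] [MeasurableSpace E] {μ : Measure E} [IsProbabilityMeasure μ]
    {F : (κ → E) → ℝ} {c : κ → ℝ} {r : E → ℝ} {e0 : E} (h : Dev F c r e0) (hF : Measurable F) (hr : MemLp r 2 μ) :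
    MemLp F 2 (Measure.pi fun _ : κ => μ) := by
  have h1 : MemLp (fun ω : κ → E => ∑ i, c i * r (ω i)) 2 (Measure.pi fun _ : κ => μ) :=
    memLp_finsetSum _ fun i _ => (hr.comp_measurePreserving (measurePreserving_eval (fun _ : κ => μ) i)).const_mul _
  have h2 : MemLp (fun ω => F ω - F (fun _ => e0)) 2 (Measure.pi fun _ : κ => μ) :=
    h1.mono (hF.sub measurable_const).aestronglyMeasurable (ae_of_all _ fun ω => by
      rw [Real.norm_eq_abs, Real.norm_eq_abs]; exact (h.global ω).trans (le_abs_self _))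
  have := h2.add (memLp_const (F (fun _ => e0)))
  refine this.ae_eq (ae_of_all _ fun y => ?_)
  simp

theorem msd_pi_fin {E : Type*} [MeasurableSpace E] (μ : Measure E) [IsProbabilityMeasure μ] {r : E → ℝ}
    (hr : MemLp r 2 μ) (hr1 : ∫ y, r y ^ 2 ∂μ ≤ 1) (e0 : E) : ∀ (n : ℕ) (F : (Fin n → E) → ℝ) (c : Fin n → ℝ),
    Measurable F → (∀ i, 0 ≤ c i) → Dev F c r e0 → msd (Measure.pi fun _ : Fin n => μ) F ≤ ∑ i, c i ^ 2 := by
  intro n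
  induction n with
  | zero =>
    intro F c hF hc h
    have : ∀ ω, F ω = F (fun _ => e0) := fun ω => by congr 1; exact Subsingleton.elim _ _
    unfold msd
    simp_rw [this]
    simp
  | succ n ih =>
    intro F c hF hc h
    have mp := measurePreserving_piFinSuccAbove (fun _ : Fin (n + 1) => μ) 0
    set e := MeasurableEquiv.piFinSuccAbove (fun _ : Fin (n + 1) => E) 0 with he
    set G : E × (Fin n → E) → ℝ := fun q => F (e.symm q) with hG
    have hGe : ∀ y ω, G (y, ω) = F (Fin.cons y ω) := by
      intro y ω
      simp [hG, he, MeasurableEquiv.piFinSuccAbove]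
      rfl
    have hGm : Measurable G := hF.comp e.symm.measurable
    have hF2 : MemLp F 2 (Measure.pi fun _ : Fin (n + 1) => μ) := h.memLp hF hr
    have mps := mp.symm e
    have hG2 : MemLp G 2 (μ.prod (Measure.pi fun _ : Fin n => μ)) := hF2.comp_measurePreserving mps
    have hmsd : msd (Measure.pi fun _ : Fin (n + 1) => μ) F = msd (μ.prod (Measure.pi fun _ : Fin n => μ)) G := by
      unfold msd
      have i1 : ∀ f : (Fin (n + 1) → E) → ℝ, ∫ ω, f ω ∂(Measure.pi fun _ : Fin (n + 1) => μ)
          = ∫ q, f (e.symm q) ∂(μ.prod (Measure.pi fun _ : Fin n => μ)) := fun f =>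
        (mps.integral_comp e.symm.measurableEmbedding f).symm
      rw [i1, i1]
    rw [hmsd, Fin.sum_univ_succ]
    refine msd_prod _ _ hG2 hGm (fun ω => ?_) (fun y => ?_)
    · refine msd_le_of_dev μ (hGm.comp measurable_prodMk_right) hr (c0 := G (e0, ω)) (hc 0) (fun y => ?_) hr1
      show |G (y, ω) - G (e0, ω)| ≤ _
      rw [hGe, hGe]
      have := h (Fin.cons e0 ω) 0 y
      rwa [Fin.update_cons_zero, Fin.update_cons_zero] at this
    · refine ih (fun ω => G (y, ω)) (fun i => c i.succ) (hGm.comp measurable_prodMk_left) (fun i => hc _) ?_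
      intro ω i y'
      show |G (y, _) - G (y, _)| ≤ _
      rw [hGe, hGe, Fin.cons_update, Fin.cons_update]
      exact h _ _ _

theorem msd_pi {κ E : Type*} [DecidableEq κ] [Fintype κ] [MeasurableSpace E] (μ : Measure E) [IsProbabilityMeasure μ] {r : E → ℝ}
    (hr : MemLp r 2 μ) (hr1 : ∫ y, r y ^ 2 ∂μ ≤ 1) (e0 : E) (F : (κ → E) → ℝ) (c : κ → ℝ)
    (hF : Measurable F) (hc : ∀ i, 0 ≤ c i) (h : Dev F c r e0) :
    msd (Measure.pi fun _ : κ => μ) F ≤ ∑ i, c i ^ 2 := by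
  set f := (Fintype.equivFin κ).symm with hf
  have mp := measurePreserving_piCongrLeft (fun _ : κ => μ) f
  set e := MeasurableEquiv.piCongrLeft (fun _ : κ => E) f with he
  have hev : ∀ ω : Fin (Fintype.card κ) → E, e ω = fun i => ω (f.symm i) := by
    intro ω
    ext i
    have := MeasurableEquiv.piCongrLeft_apply_apply (β := fun _ : κ => E) f ω (f.symm i)
    simpa using this
  have hmsd : msd (Measure.pi fun _ : κ => μ) F = msd (Measure.pi fun _ : Fin (Fintype.card κ) => μ) (fun ω => F (e ω)) := by
    unfold msd
    have i1 : ∀ g : (κ → E) → ℝ, ∫ ω, g ω ∂(Measure.pi fun _ : κ => μ)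
        = ∫ q, g (e q) ∂(Measure.pi fun _ : Fin (Fintype.card κ) => μ) := fun g =>
      (mp.integral_comp e.measurableEmbedding g).symm
    rw [i1, i1]
  rw [hmsd]
  refine (msd_pi_fin μ hr hr1 e0 _ _ (fun i => c (f i)) (hF.comp e.measurable) (fun i => hc _) ?_).trans ?_
  · intro ω i y
    have hu : ∀ y, e (Function.update ω i y) = Function.update (e ω) (f i) y := by
      intro y
      rw [hev, hev]
      ext k
      by_cases hk : k = f i
      · subst hk; simp
      · have : f.symm k ≠ i := fun h => hk (by rw [← h]; simp)
        simp [Function.update_of_ne hk, Function.update_of_ne this]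
    show |F (e _) - F (e _)| ≤ _
    rw [hu, hu]
    exact h _ _ _
  · rw [f.sum_comp (fun i => c i ^ 2)]

end efronstein
end ASS

namespace ASS

set_option linter.unusedSectionVars false
set_option linter.unusedVariables false
set_option autoImplicit false

section bip

/-- Index type of the observations of the bipartite model. -/
abbrev IB (n : ℕ) := (Fin n × Fin n) ⊕ (Fin n ⊕ Fin n)

variable {σ : Type*} [Fintype σ] {n : ℕ}

/-- Signal of the bipartite model. -/
def xx (X Y : σ → Fin n → ℝ) (s : σ) : IB n → ℝ :=
  Sum.elim (fun q => X s q.1 * Y s q.2) (Sum.elim (X s) (Y s))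

/-- Block-constant signal to noise ratios. -/
def gm (n : ℕ) (a h₁ h₂ : ℝ) : IB n → ℝ :=
  Sum.elim (fun _ => a) (Sum.elim (fun _ => h₁) (fun _ => h₂))

/-- Indices of the `u` channel. -/
def Vu (n : ℕ) : Finset (IB n) := Finset.univ.map ⟨fun i => Sum.inr (Sum.inl i), fun i j h => by simpa using h⟩

/-- Indices of the `v` channel. -/
def Vv (n : ℕ) : Finset (IB n) := Finset.univ.map ⟨fun i => Sum.inr (Sum.inr i), fun i j h => by simpa using h⟩

lemma sum_Vu (f : IB n → ℝ) : ∑ k ∈ Vu n, f k = ∑ i, f (Sum.inr (Sum.inl i)) := by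
  unfold Vu; rw [Finset.sum_map]; rfl

lemma sum_Vv (f : IB n → ℝ) : ∑ k ∈ Vv n, f k = ∑ i, f (Sum.inr (Sum.inr i)) := by
  unfold Vv; rw [Finset.sum_map]; rfl

lemma card_Vu : (Vu n).card = n := by simp [Vu]
lemma card_Vv : (Vv n).card = n := by simp [Vv]

lemma sum_IB (f : IB n → ℝ) : ∑ k, f k = ∑ i, ∑ j, f (Sum.inl (i, j)) + (∑ i, f (Sum.inr (Sum.inl i))
    + ∑ i, f (Sum.inr (Sum.inr i))) := by
  rw [Fintype.sum_sum_type, Fintype.sum_sum_type, Fintype.sum_prod_type]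

lemma lp_gm (a h₁ t : ℝ) : lp (gm n a h₁ 0) (ind (Vv n)) t = gm n a h₁ t := by
  ext k
  have m : ∀ k : IB n, k ∈ Vv n ↔ ∃ j, (Sum.inr (Sum.inr j) : IB n) = k := by
    intro k
    unfold Vv
    rw [Finset.mem_map]
    simp only [Finset.mem_univ, true_and]
    rfl
  rcases k with q | i | j <;> simp [lp, gm, ind, m]

lemma gm_pos {a h₁ h₂ : ℝ} (ha : 0 < a) (h1 : 0 < h₁) (h2 : 0 < h₂) (k : IB n) : 0 < gm n a h₁ h₂ k := by
  rcases k with q | i | j <;> simpa [gm]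

lemma gm_nonneg {a h₁ h₂ : ℝ} (ha : 0 ≤ a) (h1 : 0 ≤ h₁) (h2 : 0 ≤ h₂) (k : IB n) : 0 ≤ gm n a h₁ h₂ k := by
  rcases k with q | i | j <;> simpa [gm]

lemma gm_mono {a h₁ h₂ a' h₁' h₂' : ℝ} (ha : a ≤ a') (h1 : h₁ ≤ h₁') (h2 : h₂ ≤ h₂') (k : IB n) :
    gm n a h₁ h₂ k ≤ gm n a' h₁' h₂' k := by
  rcases k with q | i | j <;> simpa [gm]

lemma continuous_gm (n : ℕ) : Continuous (fun q : ℝ × ℝ × ℝ => gm n q.1 q.2.1 q.2.2) := by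
  refine continuous_pi fun k => ?_
  rcases k with q | i | j <;> simp only [gm, Sum.elim_inl, Sum.elim_inr] <;> fun_prop

variable {p : σ → ℝ} {X Y : σ → Fin n → ℝ} {K : ℝ}

lemma xx_le (hK0 : 0 ≤ K) (hX : ∀ s i, |X s i| ≤ K) (hY : ∀ s i, |Y s i| ≤ K) (s : σ) (k : IB n) :
    |xx X Y s k| ≤ K ^ 2 + K := by
  rcases k with q | i | j
  · simp only [xx, Sum.elim_inl, abs_mul]
    nlinarith [mul_le_mul (hX s q.1) (hY s q.2) (abs_nonneg _) hK0]
  · simp only [xx, Sum.elim_inl, Sum.elim_inr]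
    nlinarith [hX s i, sq_nonneg K]
  · simp only [xx, Sum.elim_inr]
    nlinarith [hY s j, sq_nonneg K]

lemma xx_u (hX : ∀ s i, |X s i| ≤ K) (s : σ) (k : IB n) (hk : k ∈ Vu n) : |xx X Y s k| ≤ K := by
  simp only [Vu, Finset.mem_map, Finset.mem_univ, true_and] at hk
  obtain ⟨i, rfl⟩ := hk
  exact hX s i

lemma xx_v (hY : ∀ s i, |Y s i| ≤ K) (s : σ) (k : IB n) (hk : k ∈ Vv n) : |xx X Y s k| ≤ K := by
  simp only [Vv, Finset.mem_map, Finset.mem_univ, true_and] at hk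
  obtain ⟨i, rfl⟩ := hk
  exact hY s i

/-- Planted free energy. -/
def fE (p : σ → ℝ) (X Y : σ → Fin n → ℝ) (γ : IB n → ℝ) : ℝ :=
  EP p (xx X Y) γ (fun _ b => Real.log (Lf p (xx X Y) γ b))

/-- `E ∑ ⟨u_i⟩²`. -/
def EWu (p : σ → ℝ) (X Y : σ → Fin n → ℝ) (γ : IB n → ℝ) : ℝ :=
  EP p (xx X Y) γ (fun _ b => Wf p (xx X Y) (Vu n) γ b)

/-- `E ∑ ⟨v_j⟩²`. -/
def EWv (p : σ → ℝ) (X Y : σ → Fin n → ℝ) (γ : IB n → ℝ) : ℝ :=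
  EP p (xx X Y) γ (fun _ b => Wf p (xx X Y) (Vv n) γ b)

/-- Quenched variance of `∑ ⟨v_j⟩²`. -/
def vV (p : σ → ℝ) (X Y : σ → Fin n → ℝ) (γ : IB n → ℝ) : ℝ :=
  EP p (xx X Y) γ (fun _ b => (Wf p (xx X Y) (Vv n) γ b - EWv p X Y γ) ^ 2)

/-- Thermal correlations. -/
def tT (p : σ → ℝ) (X Y : σ → Fin n → ℝ) (γ : IB n → ℝ) : ℝ :=
  EP p (xx X Y) γ (fun _ b => ∑ i ∈ Vu n, ∑ j ∈ Vv n, cc p (xx X Y) i j γ b ^ 2)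

/-- Variance of the log-likelihood. -/
def vL (p : σ → ℝ) (X Y : σ → Fin n → ℝ) (γ : IB n → ℝ) : ℝ :=
  EP p (xx X Y) γ (fun _ b => (Real.log (Lf p (xx X Y) γ b) - fE p X Y γ) ^ 2)

section meas
variable {ι : Type*} [Fintype ι] [DecidableEq ι] {x : σ → ι → ℝ}

lemma measurable_mn (hp : Prob p) (k : ι) (γ : ι → ℝ) : Measurable (mn p x k γ) := measurable_av hp _ γ

lemma measurable_cc (hp : Prob p) (i k : ι) (γ : ι → ℝ) : Measurable (cc p x i k γ) := by
  unfold cc cv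
  exact (measurable_av hp _ γ).sub ((measurable_av hp _ γ).mul (measurable_av hp _ γ))

lemma measurable_Wf (hp : Prob p) (V : Finset ι) (γ : ι → ℝ) : Measurable (Wf p x V γ) := by
  unfold Wf
  exact Finset.measurable_fun_sum _ fun k _ => (measurable_mn hp k γ).pow_const 2

lemma mn_abs_le (hp : Prob p) {B : ℝ} (hB : ∀ s k, |x s k| ≤ B) (k : ι) (γ b : ι → ℝ) : |mn p x k γ b| ≤ B :=
  av_abs_le hp (fun s => hB s k) γ b

lemma cc_abs_le (hp : Prob p) {B : ℝ} (hB0 : 0 ≤ B) (hB : ∀ s k, |x s k| ≤ B) (i k : ι) (γ b : ι → ℝ) :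
    |cc p x i k γ b| ≤ 2 * B ^ 2 := by
  unfold cc cv
  have h1 : |av p x (fun s => x s i * x s k) γ b| ≤ B ^ 2 := av_abs_le hp (fun s => by
    rw [abs_mul, sq]; exact mul_le_mul (hB s i) (hB s k) (abs_nonneg _) hB0) γ b
  have h2 : |av p x (fun s => x s i) γ b * av p x (fun s => x s k) γ b| ≤ B ^ 2 := by
    rw [abs_mul, sq]
    exact mul_le_mul (av_abs_le hp (fun s => hB s i) γ b) (av_abs_le hp (fun s => hB s k) γ b) (abs_nonneg _) hB0
  refine (abs_sub _ _).trans ?_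
  linarith

end meas

lemma EWu_nonneg (hp : Prob p) (γ : IB n → ℝ) : 0 ≤ EWu p X Y γ := EP_nonneg hp fun _ b => Wf_nonneg _ _ _
lemma EWv_nonneg (hp : Prob p) (γ : IB n → ℝ) : 0 ≤ EWv p X Y γ := EP_nonneg hp fun _ b => Wf_nonneg _ _ _

lemma Wu_le (hp : Prob p) (hX : ∀ s i, |X s i| ≤ K) (γ b : IB n → ℝ) : Wf p (xx X Y) (Vu n) γ b ≤ n * K ^ 2 := by
  have := Wf_le (x := xx X Y) hp (Vu n) (fun s k hk => xx_u hX s k hk) γ b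
  rwa [card_Vu] at this

lemma Wv_le (hp : Prob p) (hY : ∀ s i, |Y s i| ≤ K) (γ b : IB n → ℝ) : Wf p (xx X Y) (Vv n) γ b ≤ n * K ^ 2 := by
  have := Wf_le (x := xx X Y) hp (Vv n) (fun s k hk => xx_v hY s k hk) γ b
  rwa [card_Vv] at this

lemma EI_Wu (hp : Prob p) (hX : ∀ s i, |X s i| ≤ K) (γ : IB n → ℝ) :
    EI (xx X Y) γ (fun _ b => Wf p (xx X Y) (Vu n) γ b) :=
  EI_of_bdd (C := n * K ^ 2) (fun _ => measurable_Wf hp _ γ) fun _ b => by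
    rw [abs_of_nonneg (Wf_nonneg _ _ _)]; exact Wu_le hp hX γ b

lemma EI_Wv (hp : Prob p) (hY : ∀ s i, |Y s i| ≤ K) (γ : IB n → ℝ) :
    EI (xx X Y) γ (fun _ b => Wf p (xx X Y) (Vv n) γ b) :=
  EI_of_bdd (C := n * K ^ 2) (fun _ => measurable_Wf hp _ γ) fun _ b => by
    rw [abs_of_nonneg (Wf_nonneg _ _ _)]; exact Wv_le hp hY γ b

lemma EWu_le (hp : Prob p) (hX : ∀ s i, |X s i| ≤ K) (γ : IB n → ℝ) : EWu p X Y γ ≤ n * K ^ 2 :=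
  (le_abs_self _).trans (EP_abs_le hp fun _ b => by
    rw [abs_of_nonneg (Wf_nonneg _ _ _)]; exact Wu_le hp hX γ b)

lemma EWv_le (hp : Prob p) (hY : ∀ s i, |Y s i| ≤ K) (γ : IB n → ℝ) : EWv p X Y γ ≤ n * K ^ 2 :=
  (le_abs_self _).trans (EP_abs_le hp fun _ b => by
    rw [abs_of_nonneg (Wf_nonneg _ _ _)]; exact Wv_le hp hY γ b)

lemma EI_mn_sq (hp : Prob p) (hK0 : 0 ≤ K) (hX : ∀ s i, |X s i| ≤ K) (hY : ∀ s i, |Y s i| ≤ K) (γ : IB n → ℝ) (k : IB n) :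
    EI (xx X Y) γ (fun _ b => mn p (xx X Y) k γ b ^ 2) :=
  EI_of_bdd (C := (K ^ 2 + K) ^ 2) (fun _ => (measurable_mn hp k γ).pow_const 2) fun _ b => by
    rw [abs_of_nonneg (sq_nonneg _)]; exact mn_sq_le hp k (fun s => xx_le hK0 hX hY s k) γ b

/-- Mean squares of the matrix channel. -/
def mM (p : σ → ℝ) (X Y : σ → Fin n → ℝ) (γ : IB n → ℝ) : ℝ :=
  EP p (xx X Y) γ (fun _ b => ∑ i, ∑ j, mn p (xx X Y) (Sum.inl (i, j)) γ b ^ 2)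

lemma EI_mM (hp : Prob p) (hK0 : 0 ≤ K) (hX : ∀ s i, |X s i| ≤ K) (hY : ∀ s i, |Y s i| ≤ K) (γ : IB n → ℝ) :
    EI (xx X Y) γ (fun _ b => ∑ i, ∑ j, mn p (xx X Y) (Sum.inl (i, j)) γ b ^ 2) := fun s =>
  integrable_finsetSum _ fun i _ => integrable_finsetSum _ fun j _ => EI_mn_sq hp hK0 hX hY γ _ s

lemma tangent_bip (hp : Prob p) (hK0 : 0 ≤ K) (hX : ∀ s i, |X s i| ≤ K) (hY : ∀ s i, |Y s i| ≤ K)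
    {a h₁ h₂ g₁ g₂ : ℝ} (ha : 0 < a) (h1 : 0 < h₁) (h2 : 0 < h₂) (hg1 : 0 ≤ g₁) (hg2 : 0 ≤ g₂) :
    fE p X Y (gm n a 0 0) ≤ fE p X Y (gm n 0 g₁ g₂) + a / 2 * mM p X Y (gm n a h₁ h₂)
      - (g₁ - h₁) / 2 * EWu p X Y (gm n a h₁ h₂) - (g₂ - h₂) / 2 * EWv p X Y (gm n a h₁ h₂) := by
  have hB0 : 0 ≤ K ^ 2 + K := by positivity
  have hB := xx_le hK0 hX hY
  have m := f_mono hp hB0 hB (γ := gm n a 0 0) (γ' := gm n a h₁ h₂) (gm_nonneg ha.le le_rfl le_rfl) (gm_pos ha h1 h2)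
    (gm_mono le_rfl h1.le h2.le)
  have t := tangent hp hB0 hB (γ := gm n a h₁ h₂) (γ' := gm n 0 g₁ g₂) (gm_pos ha h1 h2) (gm_nonneg le_rfl hg1 hg2)
  set γ := gm n a h₁ h₂ with hγ
  have e : EP p (xx X Y) γ (fun _ b => ∑ k, (gm n 0 g₁ g₂ k - γ k) * (1 / 2 * mn p (xx X Y) k γ b ^ 2))
      = (-a / 2) * mM p X Y γ + ((g₁ - h₁) / 2 * EWu p X Y γ + (g₂ - h₂) / 2 * EWv p X Y γ) := by
    unfold mM EWu EWv
    rw [← EP_smul, ← EP_smul, ← EP_smul, ← EP_add, ← EP_add]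
    · refine EP_congr fun s b => ?_
      rw [sum_IB]
      unfold Wf
      rw [sum_Vu, sum_Vv]
      simp only [hγ, gm, Sum.elim_inl, Sum.elim_inr]
      simp only [Finset.mul_sum]
      congr 1
      · exact Finset.sum_congr rfl fun i _ => Finset.sum_congr rfl fun j _ => by ring
      · congr 1
        · exact Finset.sum_congr rfl fun i _ => by ring
        · exact Finset.sum_congr rfl fun i _ => by ring
    · exact fun s => (EI_mM hp hK0 hX hY γ s).const_mul _
    · exact fun s => ((EI_Wu hp hX γ s).const_mul _).add ((EI_Wv hp hY γ s).const_mul _)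
    · exact fun s => (EI_Wu hp hX γ s).const_mul _
    · exact fun s => (EI_Wv hp hY γ s).const_mul _
  rw [e] at t
  unfold fE
  linarith

lemma mM_le (hp : Prob p) (hK0 : 0 ≤ K) (hX : ∀ s i, |X s i| ≤ K) (hY : ∀ s i, |Y s i| ≤ K)
    (γ : IB n → ℝ) {η : ℝ} (hη : 0 < η) :
    mM p X Y γ ≤ EWu p X Y γ * EWv p X Y γ + 3 / 2 * η * (n * K ^ 2) ^ 2 + 1 / (2 * η) * vV p X Y γ
      + (1 + 1 / η) * tT p X Y γ := by
  have hB0 : 0 ≤ K ^ 2 + K := by positivity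
  have hB := xx_le hK0 hX hY
  set M : ℝ := n * K ^ 2 with hM
  have hM0 : 0 ≤ M := by positivity
  set E := EWv p X Y γ with hE
  have iV : EI (xx X Y) γ (fun _ b => (Wf p (xx X Y) (Vv n) γ b - E) ^ 2) :=
    EI_of_bdd (C := (M + |E|) ^ 2) (fun _ => ((measurable_Wf hp _ γ).sub measurable_const).pow_const 2) fun _ b => by
      rw [abs_of_nonneg (sq_nonneg _), ← sq_abs]
      refine pow_le_pow_left₀ (abs_nonneg _) ((abs_sub _ _).trans ?_) 2
      rw [abs_of_nonneg (Wf_nonneg _ _ _)]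
      exact add_le_add (Wv_le hp hY γ b) le_rfl
  have iT : EI (xx X Y) γ (fun _ b => ∑ i ∈ Vu n, ∑ j ∈ Vv n, cc p (xx X Y) i j γ b ^ 2) := by
    have : ∀ i j : IB n, EI (xx X Y) γ (fun _ b => cc p (xx X Y) i j γ b ^ 2) := fun i j =>
      EI_of_bdd (C := (2 * (K ^ 2 + K) ^ 2) ^ 2) (fun _ => (measurable_cc hp i j γ).pow_const 2) fun _ b => by
        rw [abs_of_nonneg (sq_nonneg _), ← sq_abs]
        exact pow_le_pow_left₀ (abs_nonneg _) (cc_abs_le hp hB0 hB i j γ b) 2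
    exact fun s => integrable_finsetSum _ fun i _ => integrable_finsetSum _ fun j _ => this i j s
  have iU := EI_Wu (Y := Y) hp hX γ
  have e : EWu p X Y γ * E + 3 / 2 * η * M ^ 2 + 1 / (2 * η) * vV p X Y γ + (1 + 1 / η) * tT p X Y γ
      = EP p (xx X Y) γ (fun _ b => (E * Wf p (xx X Y) (Vu n) γ b + 3 / 2 * η * M ^ 2)
        + (1 / (2 * η) * (Wf p (xx X Y) (Vv n) γ b - E) ^ 2
        + (1 + 1 / η) * ∑ i ∈ Vu n, ∑ j ∈ Vv n, cc p (xx X Y) i j γ b ^ 2)) := by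
    rw [EP_add (fun s => ((iU s).const_mul _).add (integrable_const _))
        (fun s => ((iV s).const_mul _).add ((iT s).const_mul _)),
      EP_add (fun s => ((iU s).const_mul _)) (fun s => integrable_const _),
      EP_add (fun s => ((iV s).const_mul _)) (fun s => ((iT s).const_mul _)), EP_smul E, EP_smul (1 / (2 * η)), EP_smul (1 + 1 / η), EP_const hp]
    have e1 : EP p (xx X Y) γ (fun _ b => Wf p (xx X Y) (Vu n) γ b) = EWu p X Y γ := rfl
    have e2 : EP p (xx X Y) γ (fun _ b => (Wf p (xx X Y) (Vv n) γ b - E) ^ 2) = vV p X Y γ := rfl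
    have e3 : EP p (xx X Y) γ (fun _ b => ∑ i ∈ Vu n, ∑ j ∈ Vv n, cc p (xx X Y) i j γ b ^ 2) = tT p X Y γ := rfl
    rw [e1, e2, e3]
    ring
  rw [e]
  unfold mM
  refine EP_mono hp (EI_mM hp hK0 hX hY γ) (fun s => (((iU s).const_mul _).add (integrable_const _)).add
    (((iV s).const_mul _).add ((iT s).const_mul _))) fun _ b => ?_
  set Wu := Wf p (xx X Y) (Vu n) γ b with hWu
  set Wv := Wf p (xx X Y) (Vv n) γ b with hWv
  have hWu0 : 0 ≤ Wu := Wf_nonneg _ _ _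
  have hWv0 : 0 ≤ Wv := Wf_nonneg _ _ _
  have hWuM : Wu ≤ M := Wu_le hp hX γ b
  have hWvM : Wv ≤ M := Wv_le hp hY γ b
  have h1 : ∑ i, ∑ j, mn p (xx X Y) (Sum.inl (i, j)) γ b ^ 2
      ≤ (1 + η) * (Wu * Wv) + (1 + 1 / η) * ∑ i ∈ Vu n, ∑ j ∈ Vv n, cc p (xx X Y) i j γ b ^ 2 := by
    rw [hWu, hWv]
    unfold Wf
    rw [sum_Vu, sum_Vv, sum_Vu, Finset.sum_mul_sum, Finset.mul_sum, Finset.mul_sum, ← Finset.sum_add_distrib]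
    refine Finset.sum_le_sum fun i _ => ?_
    rw [sum_Vv, Finset.mul_sum, Finset.mul_sum, ← Finset.sum_add_distrib]
    refine Finset.sum_le_sum fun j _ => ?_
    have e : mn p (xx X Y) (Sum.inl (i, j)) γ b = mn p (xx X Y) (Sum.inr (Sum.inl i)) γ b * mn p (xx X Y) (Sum.inr (Sum.inr j)) γ b
        + cc p (xx X Y) (Sum.inr (Sum.inl i)) (Sum.inr (Sum.inr j)) γ b := by
      unfold mn cc cv
      simp [xx]
    rw [e]
    set x1 := mn p (xx X Y) (Sum.inr (Sum.inl i)) γ b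
    set x2 := mn p (xx X Y) (Sum.inr (Sum.inr j)) γ b
    set c := cc p (xx X Y) (Sum.inr (Sum.inl i)) (Sum.inr (Sum.inr j)) γ b
    have h : 0 ≤ (η * (x1 * x2) - c) ^ 2 / η := by positivity
    have h' : (η * (x1 * x2) - c) ^ 2 / η = η * (x1 ^ 2 * x2 ^ 2) - 2 * (x1 * x2) * c + 1 / η * c ^ 2 := by
      field_simp; ring
    nlinarith
  have h2 : Wu * Wv ≤ E * Wu + (η / 2 * M ^ 2 + 1 / (2 * η) * (Wv - E) ^ 2) := by
    have h : 0 ≤ (η * Wu - (Wv - E)) ^ 2 / (2 * η) := by positivity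
    have h' : (η * Wu - (Wv - E)) ^ 2 / (2 * η) = η / 2 * Wu ^ 2 - Wu * (Wv - E) + 1 / (2 * η) * (Wv - E) ^ 2 := by
      field_simp; ring
    have h3 : Wu ^ 2 ≤ M ^ 2 := pow_le_pow_left₀ hWu0 hWuM 2
    nlinarith
  have h3 : η * (Wu * Wv) ≤ η * M ^ 2 := by
    rw [sq]
    exact mul_le_mul_of_nonneg_left (mul_le_mul hWuM hWvM hWv0 hM0) hη.le
  linarith

/-- Integration against the perturbation parameter. -/
lemma int_pert {c c1 s : ℝ} {A D D' : ℝ → ℝ} (hs : 0 < s) (hA : Continuous A)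
    (hD : ∀ t ∈ Set.Icc s (4 * s), HasDerivAt D (D' t) t) (hD0 : ∀ t ∈ Set.Icc s (4 * s), 0 ≤ D' t)
    (h : ∀ a ∈ Set.Icc (1 : ℝ) 2, c ≤ A a + c1 + D' (s * a ^ 2)) :
    c ≤ (∫ a in (1 : ℝ)..2, A a) + c1 + (D (4 * s) - D s) / (2 * s) := by
  have hmem : ∀ a ∈ Set.Icc (1 : ℝ) 2, s * a ^ 2 ∈ Set.Icc s (4 * s) := by
    intro a ha
    have a1 : 1 ≤ a ^ 2 := by nlinarith [ha.1]
    have a2 : a ^ 2 ≤ 4 := by nlinarith [ha.1, ha.2]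
    constructor <;> nlinarith
  have hg : ∀ a ∈ Set.Icc (1 : ℝ) 2, HasDerivAt (fun a => D (s * a ^ 2) / (2 * s)) (a * D' (s * a ^ 2)) a := by
    intro a ha
    have h1 : HasDerivAt (fun a : ℝ => s * a ^ 2) (s * (2 * a)) a := by
      have := (hasDerivAt_pow 2 a).const_mul s
      simpa using this
    have h2 := ((hD _ (hmem a ha)).comp a h1).div_const (2 * s)
    refine h2.congr_deriv ?_
    field_simp
  have := intervalIntegral.integral_le_sub_of_hasDeriv_right_of_le (a := 1) (b := 2) (by norm_num)
    (g := fun a => D (s * a ^ 2) / (2 * s)) (g' := fun a => a * D' (s * a ^ 2)) (φ := fun a => c - c1 - A a)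
    (fun a ha => (hg a ha).continuousAt.continuousWithinAt)
    (fun a ha => (hg a ⟨ha.1.le, ha.2.le⟩).hasDerivWithinAt)
    ((continuous_const.sub hA).continuousOn.integrableOn_Icc)
    (fun a ha => by
      have ha' : a ∈ Set.Icc (1 : ℝ) 2 := ⟨ha.1.le, ha.2.le⟩
      have h1 := h a ha'
      have h2 := hD0 _ (hmem a ha')
      have := mul_nonneg (sub_nonneg.2 ha'.1) h2
      show c - c1 - A a ≤ a * D' (s * a ^ 2)
      linarith)
  rw [intervalIntegral.integral_sub (by simp) (hA.intervalIntegrable _ _)] at this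
  simp only [intervalIntegral.integral_const, smul_eq_mul] at this
  have e : s * 2 ^ 2 = 4 * s := by ring
  have e' : s * 1 ^ 2 = s := by ring
  rw [e, e', ← sub_div] at this
  linarith

/-- The main finite-size bound. -/
theorem main_bip (hp : Prob p) (hK0 : 0 ≤ K) (hX : ∀ s i, |X s i| ≤ K) (hY : ∀ s i, |Y s i| ≤ K) (hn : 0 < n)
    {lam s h₁ θ η R : ℝ} (hl : 0 < lam) (hs : 0 < s) (h1 : 0 < h₁) (hθ : 0 < θ) (hη : 0 < η)
    (hR : ∀ t ∈ Set.Icc s (4 * s), vL p X Y (gm n (lam / n) h₁ t) ≤ R) {A : ℝ → ℝ} (hA : Continuous A)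
    (hAe : ∀ a ∈ Set.Icc (1 : ℝ) 2, A a = fE p X Y (gm n 0 (lam / n * EWv p X Y (gm n (lam / n) h₁ (s * a ^ 2)))
        (lam / n * EWu p X Y (gm n (lam / n) h₁ (s * a ^ 2))))
      - lam / (2 * n) * (EWu p X Y (gm n (lam / n) h₁ (s * a ^ 2)) * EWv p X Y (gm n (lam / n) h₁ (s * a ^ 2)))) :
    fE p X Y (gm n (lam / n) 0 0) ≤ (∫ a in (1 : ℝ)..2, A a)
      + (lam / (2 * n) * (3 / 2 * η * (n * K ^ 2) ^ 2) + (h₁ + 4 * s) / 2 * (n * K ^ 2))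
      + lam / (2 * n) * (1 / (η * θ) * (4 * (n * K ^ 2) + 3 * s * (5 / 4 * θ ^ 3 * (n * K ^ 2) ^ 2 * R + 1 / 2 * θ ^ 2 * (n * K ^ 2) ^ 2))
        + (1 + 1 / η) * (n * K ^ 2)) / (2 * s) := by
  have hn' : (0 : ℝ) < n := by exact_mod_cast hn
  have hB0 : 0 ≤ K ^ 2 + K := by positivity
  have hB := xx_le hK0 hX hY
  set M : ℝ := n * K ^ 2 with hM
  have hM0 : 0 ≤ M := by positivity
  set l : ℝ := lam / n with hl'
  have hl0 : 0 < l := by positivity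
  have hll : lam / (2 * n) = l / 2 := by rw [hl']; field_simp
  set RR := 5 / 4 * θ ^ 3 * M ^ 2 * R + 1 / 2 * θ ^ 2 * M ^ 2 with hRR
  obtain ⟨Θ, Θ', hΘ, hΘd⟩ := quenched (γ := gm n l h₁ 0) (V := Vv n) hp hB0 hB hK0 (fun s k hk => xx_v hY s k hk) hθ.le
  rw [card_Vv, ← hM] at hΘ
  simp only [card_Vv, ← hM, lp_gm] at hΘd
  set D : ℝ → ℝ := fun t => l / 2 * (1 / (η * θ) * (Θ t + RR * t) + (1 + 1 / η) * EWu p X Y (gm n l h₁ t)) with hD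
  set D' : ℝ → ℝ := fun t => l / 2 * (1 / (η * θ) * (Θ' t + RR) + (1 + 1 / η) * tT p X Y (gm n l h₁ t)) with hD'
  have hpos : ∀ t ∈ Set.Icc s (4 * s), 0 < t := fun t ht => lt_of_lt_of_le hs ht.1
  have hvV0 : ∀ t, 0 ≤ vV p X Y (gm n l h₁ t) := fun t => EP_nonneg hp fun _ _ => sq_nonneg _
  have htT0 : ∀ t, 0 ≤ tT p X Y (gm n l h₁ t) := fun t => EP_nonneg hp fun _ _ =>
    Finset.sum_nonneg fun _ _ => Finset.sum_nonneg fun _ _ => sq_nonneg _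
  have hq : ∀ t ∈ Set.Icc s (4 * s), θ / 2 * vV p X Y (gm n l h₁ t) ≤ Θ' t + RR := by
    intro t ht
    have h := (hΘd t (gm_pos hl0 h1 (hpos t ht))).2
    have h2 : 5 / 4 * θ ^ 3 * M ^ 2 * vL p X Y (gm n l h₁ t) ≤ 5 / 4 * θ ^ 3 * M ^ 2 * R :=
      mul_le_mul_of_nonneg_left (hR t ht) (by positivity)
    unfold vV EWv
    unfold vL fE at h2
    rw [hRR]
    linarith
  have hDd : ∀ t ∈ Set.Icc s (4 * s), HasDerivAt D (D' t) t := by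
    intro t ht
    have hdW := deriv_W (γ := gm n l h₁ 0) (V := Vu n) (x := xx X Y) hp (ind (Vv n)) (t := t)
      (by rw [lp_gm]; exact gm_pos hl0 h1 (hpos t ht))
    simp only [lp_gm, sum_ind] at hdW
    have hd1 := (hΘd t (gm_pos hl0 h1 (hpos t ht))).1
    have hd2 := (hasDerivAt_id' t).const_mul RR
    have := (((hd1.add hd2).const_mul (1 / (η * θ))).add (hdW.const_mul (1 + 1 / η))).const_mul (l / 2)
    rw [mul_one] at this
    exact this
  have hD'0 : ∀ t ∈ Set.Icc s (4 * s), 0 ≤ D' t := by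
    intro t ht
    have h := hq t ht
    have h0 : 0 ≤ Θ' t + RR := le_trans (mul_nonneg (by positivity) (hvV0 t)) h
    have := htT0 t
    simp only [hD']
    positivity
  have hmem : ∀ a ∈ Set.Icc (1 : ℝ) 2, s * a ^ 2 ∈ Set.Icc s (4 * s) := by
    intro a ha
    have a1 : 1 ≤ a ^ 2 := by nlinarith [ha.1]
    have a2 : a ^ 2 ≤ 4 := by nlinarith [ha.1, ha.2]
    constructor <;> nlinarith
  have hmain := int_pert (c := fE p X Y (gm n l 0 0)) (c1 := l / 2 * (3 / 2 * η * M ^ 2) + (h₁ + 4 * s) / 2 * M) hs hA hDd hD'0 (by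
    intro a ha
    have ht := hmem a ha
    set t := s * a ^ 2 with htdef
    set γ := gm n l h₁ t with hγ
    have hu0 : 0 ≤ EWu p X Y γ := EWu_nonneg hp γ
    have hv0 : 0 ≤ EWv p X Y γ := EWv_nonneg hp γ
    have huM : EWu p X Y γ ≤ M := EWu_le hp hX γ
    have hvM : EWv p X Y γ ≤ M := EWv_le hp hY γ
    have h3 := tangent_bip (n := n) (h₁ := h₁) (h₂ := t) hp hK0 hX hY hl0 h1 (hpos t ht) (g₁ := l * EWv p X Y γ) (g₂ := l * EWu p X Y γ)
      (by positivity) (by positivity)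
    rw [← hγ] at h3
    have h4 := mM_le hp hK0 hX hY γ hη
    rw [← hM] at h4
    have h4' := mul_le_mul_of_nonneg_left h4 (by positivity : 0 ≤ l / 2)
    have h5 := hq t ht
    have h6 : 1 / (2 * η) * vV p X Y γ ≤ 1 / (η * θ) * (Θ' t + RR) := by
      have := mul_le_mul_of_nonneg_left h5 (by positivity : 0 ≤ 1 / (η * θ))
      have e : 1 / (η * θ) * (θ / 2 * vV p X Y γ) = 1 / (2 * η) * vV p X Y γ := by field_simp
      rwa [e] at this
    have h6' := mul_le_mul_of_nonneg_left h6 (by positivity : 0 ≤ l / 2)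
    have h7 : h₁ / 2 * EWu p X Y γ ≤ h₁ / 2 * M := mul_le_mul_of_nonneg_left huM (by positivity)
    have h8 : t / 2 * EWv p X Y γ ≤ (4 * s) / 2 * M :=
      mul_le_mul (by linarith [ht.2]) hvM hv0 (by positivity)
    rw [hAe a ha, hll]
    simp only [hD']
    rw [← hγ]
    nlinarith)
  have hfin : D (4 * s) - D s ≤ l / 2 * (1 / (η * θ) * (4 * M + 3 * s * RR) + (1 + 1 / η) * M) := by
    have a1 := (abs_le.1 (hΘ (4 * s))).2
    have a2 := (abs_le.1 (hΘ s)).1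
    have a3 : EWu p X Y (gm n l h₁ (4 * s)) ≤ M := EWu_le hp hX _
    have a4 : 0 ≤ EWu p X Y (gm n l h₁ s) := EWu_nonneg hp _
    have b1 : D (4 * s) - D s = l / 2 * (1 / (η * θ) * (Θ (4 * s) - Θ s + 3 * s * RR)
        + (1 + 1 / η) * (EWu p X Y (gm n l h₁ (4 * s)) - EWu p X Y (gm n l h₁ s))) := by
      simp only [hD]; ring
    rw [b1]
    refine mul_le_mul_of_nonneg_left (add_le_add (mul_le_mul_of_nonneg_left (by linarith) (by positivity))
      (mul_le_mul_of_nonneg_left (by linarith) (by positivity))) (by positivity)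
  have hfin' := div_le_div_of_nonneg_right hfin (by positivity : 0 ≤ 2 * s)
  rw [hll]
  linarith

end bip
end ASS

namespace ASS

set_option linter.unusedSectionVars false
set_option linter.unusedVariables false
set_option autoImplicit false

section fin

/-- Log-likelihoods are Lipschitz in the observation. -/
lemma logL_lip {σ ι : Type*} [Fintype σ] [Fintype ι] [DecidableEq ι] {p : σ → ℝ} {x : σ → ι → ℝ} (hp : Prob p) {B : ι → ℝ}
    (hB : ∀ s k, |x s k| ≤ B k) (γ b b' : ι → ℝ) :
    |Real.log (Lf p x γ b) - Real.log (Lf p x γ b')| ≤ ∑ k, B k * |b k - b' k| := by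
  have key : ∀ b b' : ι → ℝ, Real.log (Lf p x γ b) - Real.log (Lf p x γ b') ≤ ∑ k, B k * |b k - b' k| := by
    intro b b'
    set R := ∑ k, B k * |b k - b' k| with hR
    have h1 : Lf p x γ b ≤ rexp R * Lf p x γ b' := by
      unfold Lf
      rw [Finset.mul_sum]
      refine Finset.sum_le_sum fun s _ => ?_
      unfold wt
      have h2 : ∑ k, (x s k * b k - γ k * x s k ^ 2 / 2) ≤ R + ∑ k, (x s k * b' k - γ k * x s k ^ 2 / 2) := by
        rw [hR, ← Finset.sum_add_distrib]
        refine Finset.sum_le_sum fun k _ => ?_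
        have h3 : x s k * (b k - b' k) ≤ B k * |b k - b' k| := by
          refine (le_abs_self _).trans ?_
          rw [abs_mul]
          exact mul_le_mul_of_nonneg_right (hB s k) (abs_nonneg _)
        linarith
      have h4 := Real.exp_le_exp.2 h2
      rw [Real.exp_add] at h4
      have := mul_le_mul_of_nonneg_left h4 (hp.nn s)
      linarith
    have h5 := Real.log_le_log (Lf_pos hp γ b) h1
    rw [Real.log_mul (Real.exp_pos R).ne' (Lf_pos hp γ b').ne', Real.log_exp] at h5
    linarith
  rw [abs_le]
  constructor
  · have := key b' b
    simp_rw [abs_sub_comm (b' _)] at this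
    linarith
  · exact key b b'

section disc
variable {σ : Type*} [Fintype σ] [MeasurableSpace σ] [MeasurableSingletonClass σ] (μ : Measure σ) [IsProbabilityMeasure μ]

/-- Probability vector of a measure on a finite type. -/
def pv (s : σ) : ℝ := μ.real {s}

lemma prob_pv : Prob (pv μ) := ⟨fun s => measureReal_nonneg, by
  have h := integral_fintype (μ := μ) (f := fun _ => (1 : ℝ)) (Integrable.of_finite)
  rw [integral_const, probReal_univ] at h
  simp only [smul_eq_mul, mul_one] at h
  exact h.symm⟩

lemma integral_pv (f : σ → ℝ) : ∫ s, f s ∂μ = ∑ s, pv μ s * f s := by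
  rw [integral_fintype Integrable.of_finite]
  rfl

lemma integrable_fin {Z : Type*} [MeasurableSpace Z] {ν : Measure Z} [IsProbabilityMeasure ν] {f : σ × Z → ℝ}
    (hm : ∀ s, Measurable (fun z => f (s, z))) (h : ∀ s, Integrable (fun z => f (s, z)) ν) : Integrable f (μ.prod ν) := by
  have hf : Measurable f := measurable_from_prod_countable_right hm
  rw [integrable_prod_iff hf.aestronglyMeasurable]
  exact ⟨ae_of_all _ h, Integrable.of_finite⟩

variable {ι : Type*} [Fintype ι] [DecidableEq ι] {x : σ → ι → ℝ}

lemma EP_eq {γ : ι → ℝ} {φ : σ → (ι → ℝ) → ℝ} (hm : ∀ s, Measurable (φ s)) (h : EI x γ φ) :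
    EP (pv μ) x γ φ = ∫ q : σ × (ι → ℝ), φ q.1 (pl x γ q.1 q.2) ∂(μ.prod (gp ι)) := by
  have hi : Integrable (fun q : σ × (ι → ℝ) => φ q.1 (pl x γ q.1 q.2)) (μ.prod (gp ι)) :=
    integrable_fin μ (f := fun q => φ q.1 (pl x γ q.1 q.2)) (fun s => (hm s).comp (continuous_pl γ s).measurable) h
  rw [integral_prod _ hi, integral_pv]
  rfl

lemma Lf_eq (γ b : ι → ℝ) : Lf (pv μ) x γ b = ∫ s, rexp (∑ k, (x s k * b k - γ k * x s k ^ 2 / 2)) ∂μ := by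
  rw [integral_pv]; rfl

lemma av_eq (a : σ → ℝ) (γ b : ι → ℝ) : av (pv μ) x a γ b
    = (∫ s, a s * rexp (∑ k, (x s k * b k - γ k * x s k ^ 2 / 2)) ∂μ) /
      ∫ s, rexp (∑ k, (x s k * b k - γ k * x s k ^ 2 / 2)) ∂μ := by
  rw [integral_pv, ← Lf_eq]
  unfold av wt
  congr 1
  exact Finset.sum_congr rfl fun s _ => by ring

end disc

variable {T : Type*} [Fintype T] [MeasurableSpace T] [MeasurableSingletonClass T] (P Q : Measure T)
  [IsProbabilityMeasure P] [IsProbabilityMeasure Q] (val : T → ℝ) {K : ℝ} {n : ℕ}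

/-- Prior on the finite configuration space. -/
def mus (n : ℕ) : Measure ((Fin n → T) × (Fin n → T)) := (Measure.pi fun _ => P).prod (Measure.pi fun _ => Q)

instance : IsProbabilityMeasure (mus P Q n) := by unfold mus; infer_instance

/-- First component of the signal. -/
def XX (n : ℕ) (s : (Fin n → T) × (Fin n → T)) (i : Fin n) : ℝ := val (s.1 i)
/-- Second component of the signal. -/
def YY (n : ℕ) (s : (Fin n → T) × (Fin n → T)) (i : Fin n) : ℝ := val (s.2 i)

/-- Coordinate bounds of the signal. -/
def bB (n : ℕ) (K : ℝ) : IB n → ℝ := Sum.elim (fun _ => K ^ 2) (Sum.elim (fun _ => K) (fun _ => K))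

lemma xx_bB (hK0 : 0 ≤ K) (hv : ∀ t, |val t| ≤ K) (s : (Fin n → T) × (Fin n → T)) (k : IB n) :
    |xx (XX val n) (YY val n) s k| ≤ bB n K k := by
  rcases k with q | i | j
  · simp only [xx, bB, Sum.elim_inl, abs_mul, sq]
    exact mul_le_mul (hv _) (hv _) (abs_nonneg _) hK0
  · exact hv _
  · exact hv _

lemma abs_val_sub (hv : ∀ t, |val t| ≤ K) (t t' : T) : |val t - val t'| ≤ 2 * K := by
  refine (abs_sub _ _).trans ?_
  linarith [hv t, hv t']

theorem var_bound (hK0 : 0 ≤ K) (hv : ∀ t, |val t| ≤ K) (hn : 0 < n) {lam h₁ h₂ : ℝ} (hl : 0 < lam) (h1 : 0 ≤ h₁) (h1' : h₁ ≤ 4)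
    (h2 : 0 ≤ h₂) (h2' : h₂ ≤ 4) :
    vL (pv (mus P Q n)) (XX val n) (YY val n) (gm n (lam / n) h₁ h₂)
      ≤ n * (2 * (2 * lam * K ^ 4 + 8 * K ^ 2) ^ 2 + (lam * K ^ 4 + 8 * K ^ 2)) := by
  classical
  have hn' : (0 : ℝ) < n := by exact_mod_cast hn
  set c0 := 2 * lam * K ^ 4 + 8 * K ^ 2 with hc0
  have hc00 : 0 ≤ c0 := by positivity
  set γ := gm n (lam / n) h₁ h₂ with hγ
  have hγ0 : ∀ k, 0 ≤ γ k := gm_nonneg (by positivity) h1 h2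
  have hp := prob_pv (mus P Q n)
  set x := xx (XX val n) (YY val n) with hx
  have hB0 : 0 ≤ K ^ 2 + K := by positivity
  have hB : ∀ s k, |x s k| ≤ K ^ 2 + K := xx_le (X := XX val n) (Y := YY val n) hK0 (fun s i => hv _) (fun s i => hv _)
  have hBB := xx_bB (n := n) val hK0 hv
  set F : ((Fin n → T) × (Fin n → T)) × (IB n → ℝ) → ℝ := fun q => Real.log (Lf (pv (mus P Q n)) x γ (pl x γ q.1 q.2)) with hF
  have hFz : ∀ s, Measurable (fun z => F (s, z)) := fun s => (measurable_logL hp γ).comp (continuous_pl γ s).measurable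
  have hFm : Measurable F := measurable_from_prod_countable_right hFz
  have hF2 : MemLp F 2 ((mus P Q n).prod (gp (IB n))) := by
    rw [memLp_two_iff_integrable_sq hFm.aestronglyMeasurable]
    exact integrable_fin _ (fun s => (hFz s).pow_const 2) fun s => (memLp_logL hp hB0 hB γ γ s).integrable_sq
  have hfE : fE (pv (mus P Q n)) (XX val n) (YY val n) γ = ∫ q, F q ∂((mus P Q n).prod (gp (IB n))) :=
    EP_eq _ (fun _ => measurable_logL hp γ) (EI_logL hp hB γ γ)
  have hvL : vL (pv (mus P Q n)) (XX val n) (YY val n) γ = msd ((mus P Q n).prod (gp (IB n))) F := by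
    unfold vL
    have hm2 : ∀ s : (Fin n → T) × (Fin n → T), Measurable (fun b => (Real.log (Lf (pv (mus P Q n)) x γ b)
        - fE (pv (mus P Q n)) (XX val n) (YY val n) γ) ^ 2) :=
      fun _ => ((measurable_logL hp γ).sub measurable_const).pow_const 2
    rw [EP_eq _ (φ := fun _ b => (Real.log (Lf (pv (mus P Q n)) x γ b)
        - fE (pv (mus P Q n)) (XX val n) (YY val n) γ) ^ 2) hm2 (EI_logL_sq hp hB0 hB γ γ _), hfE]
    rfl
  rw [hvL]
  have hlip : ∀ s s' z z', |F (s, z) - F (s', z')| ≤ ∑ k, bB n K k * |pl x γ s z k - pl x γ s' z' k| := fun s s' z z' =>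
    logL_lip hp hBB γ _ _
  have part1 : ∀ z, msd (mus P Q n) (fun s => F (s, z)) ≤ n * c0 ^ 2 + n * c0 ^ 2 := by
    intro z
    have hsum : ∑ i : Fin n, c0 ^ 2 = n * c0 ^ 2 := by simp
    rw [← hsum]
    have e0 : Nonempty T := by
      by_contra h
      rw [not_nonempty_iff] at h
      have : P = 0 := Measure.eq_zero_of_isEmpty P
      have h2 := measure_univ (μ := P)
      simp [this] at h2
    obtain ⟨e0⟩ := e0
    have one : ∀ (R : Measure T) [IsProbabilityMeasure R], MemLp (fun _ : T => (1 : ℝ)) 2 R := fun R _ => memLp_const 1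
    have hcoef : ∀ w : ℝ, |w| ≤ K → ∀ d : ℝ, |d| ≤ 2 * K → K ^ 2 * |lam / n * (d * w)| ≤ 2 * lam * K ^ 4 / n := by
      intro w hw d hd
      rw [abs_mul, abs_mul, abs_of_pos (by positivity : 0 < lam / n)]
      have : |d| * |w| ≤ 2 * K * K := mul_le_mul hd hw (abs_nonneg _) (by positivity)
      calc K ^ 2 * (lam / n * (|d| * |w|)) ≤ K ^ 2 * (lam / n * (2 * K * K)) := by gcongr
        _ = 2 * lam * K ^ 4 / n := by ring
    refine msd_prod _ _ (MemLp.of_discrete) (Measurable.of_discrete) (fun V => ?_) (fun U => ?_)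
    · refine msd_pi P (one P) (by simp) e0 _ (fun _ => c0) Measurable.of_discrete (fun _ => hc00) ?_
      intro U i y
      rw [mul_one]
      refine (hlip _ _ _ _).trans ?_
      rw [sum_IB]
      have z1 : ∑ j, bB n K (Sum.inr (Sum.inr j)) * |pl x γ (Function.update U i y, V) z (Sum.inr (Sum.inr j))
          - pl x γ (Function.update U i e0, V) z (Sum.inr (Sum.inr j))| = 0 := by
        simp [pl, hx, xx, YY]
      have z2 : ∑ i', bB n K (Sum.inr (Sum.inl i')) * |pl x γ (Function.update U i y, V) z (Sum.inr (Sum.inl i'))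
          - pl x γ (Function.update U i e0, V) z (Sum.inr (Sum.inl i'))| ≤ 8 * K ^ 2 := by
        rw [Finset.sum_eq_single i]
        · simp only [pl, hx, xx, XX, bB, hγ, gm, Sum.elim_inl, Sum.elim_inr, Function.update_self]
          have e : h₁ * val y + √h₁ * z (Sum.inr (Sum.inl i)) - (h₁ * val e0 + √h₁ * z (Sum.inr (Sum.inl i)))
              = h₁ * (val y - val e0) := by ring
          rw [e, abs_mul, abs_of_nonneg h1]
          have := abs_val_sub val hv y e0
          calc K * (h₁ * |val y - val e0|) ≤ K * (4 * (2 * K)) := by gcongr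
            _ = 8 * K ^ 2 := by ring
        · intro i' _ hi'
          simp [pl, hx, xx, XX, Function.update_of_ne hi']
        · simp
      have z3 : ∑ i', ∑ j, bB n K (Sum.inl (i', j)) * |pl x γ (Function.update U i y, V) z (Sum.inl (i', j))
          - pl x γ (Function.update U i e0, V) z (Sum.inl (i', j))| ≤ 2 * lam * K ^ 4 := by
        rw [Finset.sum_eq_single i]
        · have : ∀ j ∈ (Finset.univ : Finset (Fin n)), bB n K (Sum.inl (i, j)) * |pl x γ (Function.update U i y, V) z (Sum.inl (i, j))
              - pl x γ (Function.update U i e0, V) z (Sum.inl (i, j))| ≤ 2 * lam * K ^ 4 / n := by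
            intro j _
            simp only [pl, hx, xx, XX, YY, bB, hγ, gm, Sum.elim_inl, Sum.elim_inr, Function.update_self]
            have e : lam / n * (val y * val (V j)) + √(lam / n) * z (Sum.inl (i, j)) - (lam / n * (val e0 * val (V j)) + √(lam / n) * z (Sum.inl (i, j)))
              = lam / n * ((val y - val e0) * val (V j)) := by ring
            rw [e]
            exact hcoef _ (hv _) _ (abs_val_sub val hv y e0)
          refine (Finset.sum_le_sum this).trans (le_of_eq ?_)
          simp
          field_simp
        · intro i' _ hi'
          simp [pl, hx, xx, XX, YY, Function.update_of_ne hi']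
        · simp
      rw [z1]
      linarith
    · refine msd_pi Q (one Q) (by simp) e0 _ (fun _ => c0) Measurable.of_discrete (fun _ => hc00) ?_
      intro V i y
      rw [mul_one]
      refine (hlip _ _ _ _).trans ?_
      rw [sum_IB]
      have z1 : ∑ j, bB n K (Sum.inr (Sum.inl j)) * |pl x γ (U, Function.update V i y) z (Sum.inr (Sum.inl j))
          - pl x γ (U, Function.update V i e0) z (Sum.inr (Sum.inl j))| = 0 := by
        simp [pl, hx, xx, XX]
      have z2 : ∑ i', bB n K (Sum.inr (Sum.inr i')) * |pl x γ (U, Function.update V i y) z (Sum.inr (Sum.inr i'))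
          - pl x γ (U, Function.update V i e0) z (Sum.inr (Sum.inr i'))| ≤ 8 * K ^ 2 := by
        rw [Finset.sum_eq_single i]
        · simp only [pl, hx, xx, YY, bB, hγ, gm, Sum.elim_inl, Sum.elim_inr, Function.update_self]
          have e : h₂ * val y + √h₂ * z (Sum.inr (Sum.inr i)) - (h₂ * val e0 + √h₂ * z (Sum.inr (Sum.inr i)))
              = h₂ * (val y - val e0) := by ring
          rw [e, abs_mul, abs_of_nonneg h2]
          have := abs_val_sub val hv y e0
          calc K * (h₂ * |val y - val e0|) ≤ K * (4 * (2 * K)) := by gcongr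
            _ = 8 * K ^ 2 := by ring
        · intro i' _ hi'
          simp [pl, hx, xx, YY, Function.update_of_ne hi']
        · simp
      have z3 : ∑ j, ∑ i', bB n K (Sum.inl (j, i')) * |pl x γ (U, Function.update V i y) z (Sum.inl (j, i'))
          - pl x γ (U, Function.update V i e0) z (Sum.inl (j, i'))| ≤ 2 * lam * K ^ 4 := by
        rw [Finset.sum_comm, Finset.sum_eq_single i]
        · have : ∀ j ∈ (Finset.univ : Finset (Fin n)), bB n K (Sum.inl (j, i)) * |pl x γ (U, Function.update V i y) z (Sum.inl (j, i))
              - pl x γ (U, Function.update V i e0) z (Sum.inl (j, i))| ≤ 2 * lam * K ^ 4 / n := by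
            intro j _
            simp only [pl, hx, xx, XX, YY, bB, hγ, gm, Sum.elim_inl, Sum.elim_inr, Function.update_self]
            have e : lam / n * (val (U j) * val y) + √(lam / n) * z (Sum.inl (j, i)) - (lam / n * (val (U j) * val e0) + √(lam / n) * z (Sum.inl (j, i)))
              = lam / n * ((val y - val e0) * val (U j)) := by ring
            rw [e]
            exact hcoef _ (hv _) _ (abs_val_sub val hv y e0)
          refine (Finset.sum_le_sum this).trans (le_of_eq ?_)
          simp
          field_simp
        · intro i' _ hi'
          simp [pl, hx, xx, XX, YY, Function.update_of_ne hi']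
        · simp
      rw [z1]
      linarith
  have part2 : ∀ s, msd (gp (IB n)) (fun z => F (s, z)) ≤ n * (lam * K ^ 4 + 8 * K ^ 2) := by
    intro s
    have habs : MemLp (fun y : ℝ => |y|) 2 stdG :=
      ((memLp_two_iff_integrable_sq measurable_id.aestronglyMeasurable).2 integrable_sq_stdG).abs
    have h := msd_pi stdG habs (by simp [integral_sq_stdG]) 0 (fun z => F (s, z)) (fun k => bB n K k * √(γ k)) (hFz s)
      (fun k => mul_nonneg ((abs_nonneg _).trans (hBB s k)) (Real.sqrt_nonneg _)) (by
        intro z k y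
        refine (hlip _ _ _ _).trans ?_
        rw [Finset.sum_eq_single k]
        · simp only [pl, Function.update_self]
          have e : γ k * x s k + √(γ k) * y - (γ k * x s k + √(γ k) * 0) = √(γ k) * y := by ring
          rw [e, abs_mul, abs_of_nonneg (Real.sqrt_nonneg _), mul_assoc]
        · intro k' _ hk'
          simp [pl, Function.update_of_ne hk']
        · simp)
    refine h.trans ?_
    simp only [mul_pow, Real.sq_sqrt (hγ0 _)]
    rw [sum_IB]
    simp only [bB, hγ, gm, Sum.elim_inl, Sum.elim_inr]
    simp only [Finset.sum_const, Finset.card_univ, Fintype.card_fin, nsmul_eq_mul]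
    have e : (n : ℝ) * (n * ((K ^ 2) ^ 2 * (lam / n))) = n * (lam * K ^ 4) := by field_simp
    rw [e]
    have a1 : K ^ 2 * h₁ ≤ K ^ 2 * 4 := by gcongr
    have a2 : K ^ 2 * h₂ ≤ K ^ 2 * 4 := by gcongr
    have a3 : (n : ℝ) * (K ^ 2 * h₁) ≤ n * (K ^ 2 * 4) := by gcongr
    have a4 : (n : ℝ) * (K ^ 2 * h₂) ≤ n * (K ^ 2 * 4) := by gcongr
    linarith
  have := msd_prod _ _ hF2 hFm part1 part2
  linarith

end fin
end ASS

namespace ASS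

set_option linter.unusedSectionVars false
set_option linter.unusedVariables false
set_option linter.unusedSimpArgs false
set_option autoImplicit false

section tensor

variable {T : Type*} [Fintype T] [MeasurableSpace T] [MeasurableSingletonClass T] (P Q : Measure T)
  [IsProbabilityMeasure P] [IsProbabilityMeasure Q] (val : T → ℝ) {K : ℝ} {n : ℕ}

/-- Scalar log-likelihood. -/
def gS (g : ℝ) (q : T × ℝ) : ℝ :=
  Real.log (∫ t, rexp (val t * (g * val q.1 + √g * q.2) - g * val t ^ 2 / 2) ∂P)

lemma gS_eq (g : ℝ) (t : T) (z : Unit → ℝ) : gS P val g (t, z ())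
    = Real.log (Lf (pv P) (fun t (_ : Unit) => val t) (fun _ => g) (pl (fun t (_ : Unit) => val t) (fun _ => g) t z)) := by
  rw [Lf_eq]
  simp [gS, pl]

lemma integrable_gS (hv : ∀ t, |val t| ≤ K) (g : ℝ) : Integrable (gS P val g) (P.prod stdG) := by
  have hmp : MeasurePreserving (fun z : Unit → ℝ => z ()) (gp Unit) stdG := measurePreserving_eval (fun _ : Unit => stdG) ()
  have hm : ∀ t, Measurable (fun z => gS P val g (t, z)) := by
    intro t
    have h1 := ((measurable_logL (x := fun t (_ : Unit) => val t) (prob_pv P) (fun _ => g)).comp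
      (continuous_pl (x := fun t (_ : Unit) => val t) (fun _ => g) t).measurable).comp
        (measurable_pi_lambda (fun (z : ℝ) (_ : Unit) => z) fun _ => measurable_id)
    exact (funext fun z => gS_eq P val g t (fun _ => z) : (fun z => gS P val g (t, z)) = _) ▸ h1
  refine integrable_fin P hm fun t => ?_
  rw [← hmp.integrable_comp (hm t).aestronglyMeasurable]
  refine (EI_logL (prob_pv P) (x := fun t (_ : Unit) => val t) (B := K) (fun s k => hv s) (fun _ => g) (fun _ => g) t).congr ?_
  exact ae_of_all _ fun z => (gS_eq P val g t z).symm

lemma integral_gS {PU : Measure ℝ} [IsProbabilityMeasure PU] (he : MeasurableEmbedding val) (hPU : PU = P.map val) (g : ℝ) :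
    ∫ q, gS P val g q ∂(P.prod stdG) = psiF PU g := by
  have hmv : MeasurePreserving val P PU := ⟨he.measurable, hPU.symm⟩
  have hmp : MeasurePreserving (Prod.map val (id : ℝ → ℝ)) (P.prod stdG) (PU.prod stdG) := hmv.prod (MeasurePreserving.id _)
  have hemb : MeasurableEmbedding (Prod.map val (id : ℝ → ℝ)) := he.prodMap MeasurableEmbedding.id
  unfold psiF
  rw [← hmp.integral_comp hemb]
  refine integral_congr_ae (ae_of_all _ fun q => ?_)
  simp only [gS, Prod.map, id]
  congr 1
  rw [← hmv.integral_comp he]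
  refine integral_congr_ae (ae_of_all _ fun t => ?_)
  simp only [scalarWeight]
  congr 1
  ring

lemma gS_pos (g : ℝ) (q : T × ℝ) : 0 < ∫ t, rexp (val t * (g * val q.1 + √g * q.2) - g * val t ^ 2 / 2) ∂P :=
  integral_exp_pos Integrable.of_finite

lemma logL_tensor (g₁ g₂ : ℝ) (s : (Fin n → T) × (Fin n → T)) (z : IB n → ℝ) :
    Real.log (Lf (pv (mus P Q n)) (xx (XX val n) (YY val n)) (gm n 0 g₁ g₂)
      (pl (xx (XX val n) (YY val n)) (gm n 0 g₁ g₂) s z))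
      = ∑ i, gS P val g₁ (s.1 i, z (Sum.inr (Sum.inl i))) + ∑ i, gS Q val g₂ (s.2 i, z (Sum.inr (Sum.inr i))) := by
  rw [Lf_eq]
  have h : ∀ s' : (Fin n → T) × (Fin n → T), rexp (∑ k, (xx (XX val n) (YY val n) s' k *
        pl (xx (XX val n) (YY val n)) (gm n 0 g₁ g₂) s z k - gm n 0 g₁ g₂ k * xx (XX val n) (YY val n) s' k ^ 2 / 2))
      = (∏ i, rexp (val (s'.1 i) * (g₁ * val (s.1 i) + √g₁ * z (Sum.inr (Sum.inl i))) - g₁ * val (s'.1 i) ^ 2 / 2))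
        * ∏ i, rexp (val (s'.2 i) * (g₂ * val (s.2 i) + √g₂ * z (Sum.inr (Sum.inr i))) - g₂ * val (s'.2 i) ^ 2 / 2) := by
    intro s'
    rw [sum_IB, Real.exp_add, Real.exp_add, Real.exp_sum, Real.exp_sum, Real.exp_sum]
    simp [xx, pl, gm, XX, YY]
  simp_rw [h]
  unfold mus
  rw [integral_prod_mul (μ := Measure.pi fun _ : Fin n => P) (ν := Measure.pi fun _ : Fin n => Q)
    (fun u : Fin n → T => ∏ i, rexp (val (u i) * (g₁ * val (s.1 i) + √g₁ * z (Sum.inr (Sum.inl i))) - g₁ * val (u i) ^ 2 / 2))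
    (fun v : Fin n → T => ∏ i, rexp (val (v i) * (g₂ * val (s.2 i) + √g₂ * z (Sum.inr (Sum.inr i))) - g₂ * val (v i) ^ 2 / 2)),
    integral_fintype_prod_eq_prod (fun i t => rexp (val t * (g₁ * val (s.1 i) + √g₁ * z (Sum.inr (Sum.inl i))) - g₁ * val t ^ 2 / 2)),
    integral_fintype_prod_eq_prod (fun i t => rexp (val t * (g₂ * val (s.2 i) + √g₂ * z (Sum.inr (Sum.inr i))) - g₂ * val t ^ 2 / 2)),
    Real.log_mul, Real.log_prod, Real.log_prod]
  · rfl
  · exact fun i _ => (gS_pos Q val g₂ (s.2 i, z (Sum.inr (Sum.inr i)))).ne'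
  · exact fun i _ => (gS_pos P val g₁ (s.1 i, z (Sum.inr (Sum.inl i)))).ne'
  · exact Finset.prod_ne_zero_iff.2 fun i _ => (gS_pos P val g₁ (s.1 i, z (Sum.inr (Sum.inl i)))).ne'
  · exact Finset.prod_ne_zero_iff.2 fun i _ => (gS_pos Q val g₂ (s.2 i, z (Sum.inr (Sum.inr i)))).ne'

theorem fE_tensor (hK0 : 0 ≤ K) (hv : ∀ t, |val t| ≤ K) {PU PV : Measure ℝ} [IsProbabilityMeasure PU] [IsProbabilityMeasure PV]
    (he : MeasurableEmbedding val) (hPU : PU = P.map val) (hPV : PV = Q.map val) (g₁ g₂ : ℝ) :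
    fE (pv (mus P Q n)) (XX val n) (YY val n) (gm n 0 g₁ g₂) = n * psiF PU g₁ + n * psiF PV g₂ := by
  have hp := prob_pv (mus P Q n)
  have hB : ∀ s k, |xx (XX val n) (YY val n) s k| ≤ K ^ 2 + K := xx_le (X := XX val n) (Y := YY val n) hK0 (fun s i => hv _) (fun s i => hv _)
  unfold fE
  rw [EP_eq _ (fun _ => measurable_logL hp _) (EI_logL hp hB _ _)]
  simp_rw [logL_tensor]
  have m1 : ∀ i : Fin n, MeasurePreserving (fun q : ((Fin n → T) × (Fin n → T)) × (IB n → ℝ) => (q.1.1 i, q.2 (Sum.inr (Sum.inl i))))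
      ((mus P Q n).prod (gp (IB n))) (P.prod stdG) := by
    intro i
    exact ((measurePreserving_eval (fun _ : Fin n => P) i).comp measurePreserving_fst).prod
      (measurePreserving_eval (fun _ : IB n => stdG) (Sum.inr (Sum.inl i)))
  have m2 : ∀ i : Fin n, MeasurePreserving (fun q : ((Fin n → T) × (Fin n → T)) × (IB n → ℝ) => (q.1.2 i, q.2 (Sum.inr (Sum.inr i))))
      ((mus P Q n).prod (gp (IB n))) (Q.prod stdG) := by
    intro i
    exact ((measurePreserving_eval (fun _ : Fin n => Q) i).comp measurePreserving_snd).prod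
      (measurePreserving_eval (fun _ : IB n => stdG) (Sum.inr (Sum.inr i)))
  have i1 : ∀ i : Fin n, Integrable (fun q : ((Fin n → T) × (Fin n → T)) × (IB n → ℝ) => gS P val g₁ (q.1.1 i, q.2 (Sum.inr (Sum.inl i))))
      ((mus P Q n).prod (gp (IB n))) := fun i => (m1 i).integrable_comp_of_integrable (integrable_gS P val hv g₁)
  have i2 : ∀ i : Fin n, Integrable (fun q : ((Fin n → T) × (Fin n → T)) × (IB n → ℝ) => gS Q val g₂ (q.1.2 i, q.2 (Sum.inr (Sum.inr i))))
      ((mus P Q n).prod (gp (IB n))) := fun i => (m2 i).integrable_comp_of_integrable (integrable_gS Q val hv g₂)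
  rw [integral_add (integrable_finsetSum _ fun i _ => i1 i) (integrable_finsetSum _ fun i _ => i2 i),
    integral_finsetSum _ fun i _ => i1 i, integral_finsetSum _ fun i _ => i2 i]
  have e1 : ∀ i : Fin n, ∫ q : ((Fin n → T) × (Fin n → T)) × (IB n → ℝ), gS P val g₁ (q.1.1 i, q.2 (Sum.inr (Sum.inl i)))
      ∂((mus P Q n).prod (gp (IB n))) = psiF PU g₁ := by
    intro i
    rw [← integral_gS P val he hPU, ← (m1 i).map_eq, integral_map (m1 i).measurable.aemeasurable]
    rw [(m1 i).map_eq]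
    exact (integrable_gS P val hv g₁).aestronglyMeasurable
  have e2 : ∀ i : Fin n, ∫ q : ((Fin n → T) × (Fin n → T)) × (IB n → ℝ), gS Q val g₂ (q.1.2 i, q.2 (Sum.inr (Sum.inr i)))
      ∂((mus P Q n).prod (gp (IB n))) = psiF PV g₂ := by
    intro i
    rw [← integral_gS Q val he hPV, ← (m2 i).map_eq, integral_map (m2 i).measurable.aemeasurable]
    rw [(m2 i).map_eq]
    exact (integrable_gS Q val hv g₂).aestronglyMeasurable
  simp [e1, e2]

end tensor
end ASS

namespace ASS

set_option linter.unusedSectionVars false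
set_option linter.unusedVariables false
set_option linter.unusedSimpArgs false
set_option autoImplicit false

section ident

/-- Gathers all the Gaussian noises in a single family. -/
def Psi (n : ℕ) (w : (Fin n → Fin n → ℝ) × (((Fin n → ℝ) × (Fin n → ℝ)) × ((Fin n → ℝ) × (Fin n → ℝ)))) : IB n → ℝ :=
  Sum.elim (fun q => w.1 q.1 q.2) (Sum.elim w.2.2.1 w.2.2.2)

instance (n : ℕ) : IsProbabilityMeasure (gvec n) := by unfold gvec; infer_instance
instance (n : ℕ) : IsProbabilityMeasure (noiseM n) := by unfold noiseM; infer_instance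

lemma mp_Psi (n : ℕ) : MeasurePreserving (Psi n) ((noiseM n).prod (((gvec n).prod (gvec n)).prod ((gvec n).prod (gvec n)))) (gp (IB n)) := by
  have h1 : MeasurePreserving (fun w : (Fin n → Fin n → ℝ) × ((Fin n → ℝ) × (Fin n → ℝ)) =>
      (Sum.elim (fun q => w.1 q.1 q.2) (Sum.elim w.2.1 w.2.2) : IB n → ℝ)) ((noiseM n).prod ((gvec n).prod (gvec n))) (gp (IB n)) := by
    have hm : Measurable (fun w : (Fin n → Fin n → ℝ) × ((Fin n → ℝ) × (Fin n → ℝ)) =>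
      (Sum.elim (fun q => w.1 q.1 q.2) (Sum.elim w.2.1 w.2.2) : IB n → ℝ)) := by
      refine measurable_pi_lambda _ fun k => ?_
      rcases k with q | i | i
      · exact (measurable_pi_apply q.2).comp ((measurable_pi_apply q.1).comp measurable_fst)
      · exact (measurable_pi_apply i).comp (measurable_fst.comp measurable_snd)
      · exact (measurable_pi_apply i).comp (measurable_snd.comp measurable_snd)
    refine ⟨hm, ?_⟩
    unfold gp
    symm
    refine Measure.pi_eq fun S hS => ?_
    rw [Measure.map_apply hm (MeasurableSet.univ_pi hS)]
    have e : (fun w : (Fin n → Fin n → ℝ) × ((Fin n → ℝ) × (Fin n → ℝ)) =>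
        (Sum.elim (fun q => w.1 q.1 q.2) (Sum.elim w.2.1 w.2.2) : IB n → ℝ)) ⁻¹' (Set.univ.pi S)
        = (Set.univ.pi fun i => Set.univ.pi fun j => S (Sum.inl (i, j))) ×ˢ
          ((Set.univ.pi fun i => S (Sum.inr (Sum.inl i))) ×ˢ (Set.univ.pi fun i => S (Sum.inr (Sum.inr i)))) := by
      ext w
      simp only [Set.mem_preimage, Set.mem_pi, Set.mem_univ, true_implies, Set.mem_prod]
      constructor
      · intro h
        exact ⟨fun i j => h (Sum.inl (i, j)), fun i => h (Sum.inr (Sum.inl i)), fun i => h (Sum.inr (Sum.inr i))⟩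
      · rintro ⟨h1, h2, h3⟩ (q | i | i)
        · exact h1 q.1 q.2
        · exact h2 i
        · exact h3 i
    rw [e, Measure.prod_prod, Measure.prod_prod]
    unfold noiseM gvec
    simp only [Measure.pi_pi]
    rw [Fintype.prod_sum_type, Fintype.prod_sum_type, Fintype.prod_prod_type]
  have h2 : MeasurePreserving (Prod.map id Prod.snd) ((noiseM n).prod (((gvec n).prod (gvec n)).prod ((gvec n).prod (gvec n))))
      ((noiseM n).prod ((gvec n).prod (gvec n))) := (MeasurePreserving.id _).prod measurePreserving_snd
  exact h1.comp h2

variable {T : Type*} [Fintype T] [MeasurableSpace T] [MeasurableSingletonClass T] {P Q : Measure T}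
  [IsProbabilityMeasure P] [IsProbabilityMeasure Q] {val : T → ℝ} {K : ℝ} {n : ℕ}
  {PU PV : Measure ℝ} [IsProbabilityMeasure PU] [IsProbabilityMeasure PV]

/-- Embedding of finite configurations. -/
def JJ (val : T → ℝ) (n : ℕ) (s : (Fin n → T) × (Fin n → T)) : (Fin n → ℝ) × (Fin n → ℝ) := (XX val n s, YY val n s)

lemma emb_JJ (he : MeasurableEmbedding val) : MeasurableEmbedding (JJ val n) where
  injective := by
    rintro ⟨a, b⟩ ⟨a', b'⟩ h
    simp only [JJ, Prod.mk.injEq] at h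
    refine Prod.ext (funext fun i => he.injective (congrFun h.1 i)) (funext fun i => he.injective (congrFun h.2 i))
  measurable := Measurable.of_discrete
  measurableSet_image' := fun s _ => (Set.toFinite _).measurableSet

lemma mp_JJ (he : MeasurableEmbedding val) (hPU : PU = P.map val) (hPV : PV = Q.map val) :
    MeasurePreserving (JJ val n) (mus P Q n) (prior PU PV n) := by
  have h1 : MeasurePreserving val P PU := ⟨he.measurable, hPU.symm⟩
  have h2 : MeasurePreserving val Q PV := ⟨he.measurable, hPV.symm⟩
  exact (measurePreserving_pi (fun _ : Fin n => P) (fun _ => PU) fun _ => h1).prod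
    (measurePreserving_pi (fun _ : Fin n => Q) (fun _ => PV) fun _ => h2)

lemma integral_prior (he : MeasurableEmbedding val) (hPU : PU = P.map val) (hPV : PV = Q.map val) (f : (Fin n → ℝ) × (Fin n → ℝ) → ℝ) :
    ∫ uv, f uv ∂prior PU PV n = ∫ s, f (JJ val n s) ∂mus P Q n :=
  ((mp_JJ he hPU hPV).integral_comp (emb_JJ he) f).symm

instance : IsProbabilityMeasure (prior PU PV n) := by unfold prior; infer_instance
instance : IsProbabilityMeasure (sampleM PU PV n) := by unfold sampleM; infer_instance

theorem transfer (he : MeasurableEmbedding val) (hPU : PU = P.map val) (hPV : PV = Q.map val)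
    {x : (Fin n → T) × (Fin n → T) → IB n → ℝ} {γ : IB n → ℝ}
    {φ : ((((Fin n → ℝ) × (Fin n → ℝ)) × (Fin n → Fin n → ℝ)) ×
      (((Fin n → ℝ) × (Fin n → ℝ)) × ((Fin n → ℝ) × (Fin n → ℝ)))) → ℝ}
    {ψ : (Fin n → T) × (Fin n → T) → (IB n → ℝ) → ℝ} (hm : ∀ s, Measurable (ψ s)) (hI : EI x γ ψ)
    (h : ∀ s Z r, φ ((JJ val n s, Z), r) = ψ s (pl x γ s (Psi n (Z, r)))) :
    ∫ ω, φ ω ∂sampleP PU PV n = EP (pv (mus P Q n)) x γ ψ := by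
  rw [EP_eq _ hm hI]
  set R := ((gvec n).prod (gvec n)).prod ((gvec n).prod (gvec n)) with hR
  have m1 : MeasurePreserving (Prod.map (JJ val n) id) ((mus P Q n).prod ((noiseM n).prod R)) ((prior PU PV n).prod ((noiseM n).prod R)) :=
    (mp_JJ he hPU hPV).prod (MeasurePreserving.id _)
  have m2 : MeasurePreserving (MeasurableEquiv.prodAssoc.symm) ((prior PU PV n).prod ((noiseM n).prod R)) (sampleP PU PV n) :=
    (measurePreserving_prodAssoc (prior PU PV n) (noiseM n) R).symm _
  have e1 : MeasurableEmbedding (Prod.map (JJ val n) (id : (Fin n → Fin n → ℝ) × (((Fin n → ℝ) × (Fin n → ℝ)) × ((Fin n → ℝ) × (Fin n → ℝ))) → _)) :=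
    (emb_JJ he).prodMap MeasurableEmbedding.id
  rw [← m2.integral_comp (MeasurableEquiv.measurableEmbedding _), ← m1.integral_comp e1]
  have m3 : MeasurePreserving (Prod.map id (Psi n)) ((mus P Q n).prod ((noiseM n).prod R)) ((mus P Q n).prod (gp (IB n))) :=
    (MeasurePreserving.id _).prod (mp_Psi n)
  have hmes : Measurable (fun q : ((Fin n → T) × (Fin n → T)) × (IB n → ℝ) => ψ q.1 (pl x γ q.1 q.2)) :=
    measurable_from_prod_countable_right fun s => (hm s).comp (continuous_pl γ s).measurable
  rw [← m3.map_eq, integral_map m3.measurable.aemeasurable hmes.aestronglyMeasurable]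
  refine integral_congr_ae (ae_of_all _ fun q => ?_)
  exact h q.1 q.2.1 q.2.2

lemma ham_eq {lam : ℝ} (s s' : (Fin n → T) × (Fin n → T)) (Z : Fin n → Fin n → ℝ)
    (r : ((Fin n → ℝ) × (Fin n → ℝ)) × ((Fin n → ℝ) × (Fin n → ℝ))) :
    Ham lam n (JJ val n s).1 (JJ val n s).2 Z (JJ val n s').1 (JJ val n s').2
    = ∑ k, (xx (XX val n) (YY val n) s' k * pl (xx (XX val n) (YY val n)) (gm n (lam / n) 0 0) s (Psi n (Z, r)) k
      - gm n (lam / n) 0 0 k * xx (XX val n) (YY val n) s' k ^ 2 / 2) := by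
  rw [sum_IB]
  simp only [xx, pl, gm, Psi, Sum.elim_inl, Sum.elim_inr, Real.sqrt_zero, zero_mul, mul_zero, add_zero, zero_div, sub_zero,
    Finset.sum_const_zero, Ham, JJ]
  refine Finset.sum_congr rfl fun i _ => Finset.sum_congr rfl fun j _ => ?_
  have : lam / (2 * (n : ℝ)) = lam / n / 2 := by rw [div_div, mul_comm]
  rw [this]
  ring

lemma hamTot_eq {lam au av : ℝ} (hs : 0 ≤ sSeq n) (hau : 0 ≤ au) (hav : 0 ≤ av) (s s' : (Fin n → T) × (Fin n → T)) (Z : Fin n → Fin n → ℝ)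
    (r : ((Fin n → ℝ) × (Fin n → ℝ)) × ((Fin n → ℝ) × (Fin n → ℝ))) :
    HamTot lam 0 0 n au av ((JJ val n s, Z), r) (JJ val n s').1 (JJ val n s').2
    = ∑ k, (xx (XX val n) (YY val n) s' k * pl (xx (XX val n) (YY val n)) (gm n (lam / n) (sSeq n * au ^ 2) (sSeq n * av ^ 2)) s (Psi n (Z, r)) k
      - gm n (lam / n) (sSeq n * au ^ 2) (sSeq n * av ^ 2) k * xx (XX val n) (YY val n) s' k ^ 2 / 2) := by
  have q1 : √(sSeq n * au ^ 2) = √(sSeq n) * au := by rw [Real.sqrt_mul hs, Real.sqrt_sq hau]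
  have q2 : √(sSeq n * av ^ 2) = √(sSeq n) * av := by rw [Real.sqrt_mul hs, Real.sqrt_sq hav]
  unfold HamTot
  have h0 := ham_eq (lam := lam) (val := val) s s' Z r
  rw [sum_IB] at h0 ⊢
  simp only [xx, pl, gm, Psi, Sum.elim_inl, Sum.elim_inr, Real.sqrt_zero, zero_mul, mul_zero, add_zero, zero_div, sub_zero,
    Finset.sum_const_zero] at h0 ⊢
  rw [h0, q1, q2, add_assoc]
  congr 1
  congr 1
  · refine Finset.sum_congr rfl fun i _ => ?_
    simp only [JJ]
    ring
  · refine Finset.sum_congr rfl fun i _ => ?_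
    simp only [JJ]
    ring

theorem freeEnergy_eq (hK0 : 0 ≤ K) (hv : ∀ t, |val t| ≤ K) (he : MeasurableEmbedding val) (hPU : PU = P.map val) (hPV : PV = Q.map val)
    (lam : ℝ) :
    freeEnergy PU PV n lam = 1 / n * fE (pv (mus P Q n)) (XX val n) (YY val n) (gm n (lam / n) 0 0) := by
  have hp := prob_pv (mus P Q n)
  have hB : ∀ s k, |xx (XX val n) (YY val n) s k| ≤ K ^ 2 + K := xx_le (X := XX val n) (Y := YY val n) hK0 (fun s i => hv _) (fun s i => hv _)
  unfold freeEnergy fE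
  congr 1
  rw [← transfer he hPU hPV (φ := fun ω => Real.log (partFun PU PV lam n ω.1)) (fun _ => measurable_logL hp _) (EI_logL hp hB _ _)]
  · unfold sampleP
    rw [integral_fun_fst (f := fun ω => Real.log (partFun PU PV lam n ω))]
    simp
  · intro s Z r
    rw [Lf_eq]
    simp only [partFun]
    rw [integral_prior he hPU hPV]
    simp only [ham_eq s _ Z r]

lemma gibbs_eq (he : MeasurableEmbedding val) (hPU : PU = P.map val) (hPV : PV = Q.map val) {lam au av : ℝ}
    (hs : 0 ≤ sSeq n) (hau : 0 ≤ au) (hav : 0 ≤ av) (s : (Fin n → T) × (Fin n → T)) (Z : Fin n → Fin n → ℝ)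
    (r : ((Fin n → ℝ) × (Fin n → ℝ)) × ((Fin n → ℝ) × (Fin n → ℝ))) (f : (Fin n → ℝ) × (Fin n → ℝ) → ℝ) :
    gibbsTot PU PV lam 0 0 n au av ((JJ val n s, Z), r) f
      = ASS.av (pv (mus P Q n)) (xx (XX val n) (YY val n)) (fun s' => f (JJ val n s')) (gm n (lam / n) (sSeq n * au ^ 2) (sSeq n * av ^ 2))
        (pl (xx (XX val n) (YY val n)) (gm n (lam / n) (sSeq n * au ^ 2) (sSeq n * av ^ 2)) s (Psi n (Z, r))) := by
  rw [av_eq]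
  unfold gibbsTot
  rw [integral_prior he hPU hPV, integral_prior he hPU hPV]
  simp only [hamTot_eq hs hau hav s _ Z r]

lemma av_ov {γ b : IB n → ℝ} (p : (Fin n → T) × (Fin n → T) → ℝ) (x : (Fin n → T) × (Fin n → T) → IB n → ℝ) (k : Fin n → IB n) :
    ASS.av p x (fun s => ASS.av p x (fun s' => ovDot n (fun i => x s (k i)) (fun i => x s' (k i))) γ b) γ b
      = 1 / n * ∑ i, mn p x (k i) γ b ^ 2 := by
  unfold ovDot
  simp only [av_smul, av_sum]
  congr 1
  refine Finset.sum_congr rfl fun i _ => ?_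
  have : ∀ s, x s (k i) * ASS.av p x (fun s' => x s' (k i)) γ b = mn p x (k i) γ b * x s (k i) := fun s => mul_comm _ _
  simp only [this, av_smul]
  rw [sq]; rfl

theorem EovU_eq (hK0 : 0 ≤ K) (hv : ∀ t, |val t| ≤ K) (he : MeasurableEmbedding val) (hPU : PU = P.map val) (hPV : PV = Q.map val)
    {lam au av : ℝ} (hs : 0 ≤ sSeq n) (hau : 0 ≤ au) (hav : 0 ≤ av) :
    EovU PU PV lam 0 0 n au av = 1 / n * EWu (pv (mus P Q n)) (XX val n) (YY val n) (gm n (lam / n) (sSeq n * au ^ 2) (sSeq n * av ^ 2)) := by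
  have hp := prob_pv (mus P Q n)
  unfold EovU EWu
  rw [← EP_smul]
  refine transfer he hPU hPV (fun _ => (measurable_Wf hp _ _).const_mul _)
    (fun s => (EI_Wu (K := K) hp (fun s i => hv _) _ s).const_mul _) ?_
  intro s Z r
  simp only [gibbs_eq he hPU hPV hs hau hav s Z r]
  have := av_ov (pv (mus P Q n)) (xx (XX val n) (YY val n)) (fun i => Sum.inr (Sum.inl i))
    (γ := gm n (lam / n) (sSeq n * au ^ 2) (sSeq n * av ^ 2))
    (b := pl (xx (XX val n) (YY val n)) (gm n (lam / n) (sSeq n * au ^ 2) (sSeq n * av ^ 2)) s (Psi n (Z, r)))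
  unfold Wf
  rw [sum_Vu, ← this]
  rfl

theorem EovV_eq (hK0 : 0 ≤ K) (hv : ∀ t, |val t| ≤ K) (he : MeasurableEmbedding val) (hPU : PU = P.map val) (hPV : PV = Q.map val)
    {lam au av : ℝ} (hs : 0 ≤ sSeq n) (hau : 0 ≤ au) (hav : 0 ≤ av) :
    EovV PU PV lam 0 0 n au av = 1 / n * EWv (pv (mus P Q n)) (XX val n) (YY val n) (gm n (lam / n) (sSeq n * au ^ 2) (sSeq n * av ^ 2)) := by
  have hp := prob_pv (mus P Q n)
  unfold EovV EWv
  rw [← EP_smul]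
  refine transfer he hPU hPV (fun _ => (measurable_Wf hp _ _).const_mul _)
    (fun s => (EI_Wv (K := K) hp (fun s i => hv _) _ s).const_mul _) ?_
  intro s Z r
  simp only [gibbs_eq he hPU hPV hs hau hav s Z r]
  have := av_ov (pv (mus P Q n)) (xx (XX val n) (YY val n)) (fun i => Sum.inr (Sum.inr i))
    (γ := gm n (lam / n) (sSeq n * au ^ 2) (sSeq n * av ^ 2))
    (b := pl (xx (XX val n) (YY val n)) (gm n (lam / n) (sSeq n * au ^ 2) (sSeq n * av ^ 2)) s (Psi n (Z, r)))
  unfold Wf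
  rw [sum_Vv, ← this]
  rfl

end ident
end ASS

namespace ASS

set_option linter.unusedSectionVars false
set_option linter.unusedVariables false
set_option linter.unusedSimpArgs false
set_option autoImplicit false

section final

variable {T : Type*} [Fintype T] [MeasurableSpace T] [MeasurableSingletonClass T] {P Q : Measure T}
  [IsProbabilityMeasure P] [IsProbabilityMeasure Q] {val : T → ℝ} {K : ℝ} {n : ℕ}
  {PU PV : Measure ℝ} [IsProbabilityMeasure PU] [IsProbabilityMeasure PV]

lemma continuous_fE (hK0 : 0 ≤ K) (hv : ∀ t, |val t| ≤ K) :
    Continuous (fun γ => fE (pv (mus P Q n)) (XX val n) (YY val n) γ) :=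
  continuous_EP_logL (prob_pv _) (by positivity : 0 ≤ K ^ 2 + K)
    (xx_le (X := XX val n) (Y := YY val n) hK0 (fun s i => hv _) (fun s i => hv _))

lemma continuous_Wf {σ ι : Type*} [Fintype σ] [Fintype ι] [DecidableEq ι] {p : σ → ℝ} {x : σ → ι → ℝ} (hp : Prob p) (V : Finset ι) :
    Continuous (fun q : (ι → ℝ) × (ι → ℝ) => Wf p x V q.1 q.2) := by
  unfold Wf
  exact continuous_finsetSum _ fun k _ => (continuous_av hp (fun s => x s k)).pow 2

lemma continuous_EWu (hv : ∀ t, |val t| ≤ K) :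
    Continuous (fun γ => EWu (pv (mus P Q n)) (XX val n) (YY val n) γ) := by
  refine continuous_EP_bdd (C := n * K ^ 2) (continuous_Wf (prob_pv _) _) fun γ b => ?_
  rw [abs_of_nonneg (Wf_nonneg _ _ _)]
  exact Wu_le (prob_pv _) (fun s i => hv _) γ b

lemma continuous_EWv (hv : ∀ t, |val t| ≤ K) :
    Continuous (fun γ => EWv (pv (mus P Q n)) (XX val n) (YY val n) γ) := by
  refine continuous_EP_bdd (C := n * K ^ 2) (continuous_Wf (prob_pv _) _) fun γ b => ?_
  rw [abs_of_nonneg (Wf_nonneg _ _ _)]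
  exact Wv_le (prob_pv _) (fun s i => hv _) γ b

lemma continuous_psiF (P : Measure T) [IsProbabilityMeasure P] (hK0 : 0 ≤ K) (hv : ∀ t, |val t| ≤ K)
    (he : MeasurableEmbedding val) (hPU : PU = P.map val) : Continuous (psiF PU) := by
  have h : ∀ g, psiF PU g = fE (pv (mus P P 1)) (XX val 1) (YY val 1) (gm 1 0 g 0) - psiF PU 0 := by
    intro g
    have := fE_tensor (n := 1) P P val hK0 hv he hPU hPU g 0
    rw [this]
    simp
  rw [funext h]
  have hg : Continuous (fun g : ℝ => gm 1 0 g 0) := (continuous_gm 1).comp (by fun_prop : Continuous fun g : ℝ => ((0 : ℝ), g, (0 : ℝ)))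
  exact Continuous.sub ((continuous_fE hK0 hv).comp hg) continuous_const

/-- Continuous version of the replica-symmetric potential at the overlaps. -/
def Gc (P Q : Measure T) (PU PV : Measure ℝ) [IsProbabilityMeasure PU] [IsProbabilityMeasure PV] (val : T → ℝ) (lam : ℝ) (n : ℕ) (q : ℝ × ℝ) : ℝ :=
  rsF PU PV lam
    (1 / n * EWv (pv (mus P Q n)) (XX val n) (YY val n) (gm n (lam / n) (sSeq n * q.1 ^ 2) (sSeq n * q.2 ^ 2)))
    (1 / n * EWu (pv (mus P Q n)) (XX val n) (YY val n) (gm n (lam / n) (sSeq n * q.1 ^ 2) (sSeq n * q.2 ^ 2)))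

lemma continuous_Gc (hK0 : 0 ≤ K) (hv : ∀ t, |val t| ≤ K) (he : MeasurableEmbedding val) (hPU : PU = P.map val) (hPV : PV = Q.map val)
    (lam : ℝ) : Continuous (Gc P Q PU PV val lam n) := by
  have c1 := continuous_psiF P hK0 hv he hPU
  have c2 := continuous_psiF Q hK0 hv he hPV
  have hg : Continuous (fun q : ℝ × ℝ => gm n (lam / n) (sSeq n * q.1 ^ 2) (sSeq n * q.2 ^ 2)) :=
    (continuous_gm n).comp (by fun_prop : Continuous fun q : ℝ × ℝ => (lam / (n : ℝ), sSeq n * q.1 ^ 2, sSeq n * q.2 ^ 2))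
  have cu := (continuous_EWu (P := P) (Q := Q) (n := n) hv).comp hg
  have cv := (continuous_EWv (P := P) (Q := Q) (n := n) hv).comp hg
  simp only [Function.comp_def] at cu cv
  unfold Gc rsF
  fun_prop

lemma abs_Gc_le (hK0 : 0 ≤ K) (hv : ∀ t, |val t| ≤ K) {lam C : ℝ} (hl : 0 < lam)
    (hC : ∀ g ∈ Set.Icc 0 (lam * K ^ 2), |psiF PU g| ≤ C ∧ |psiF PV g| ≤ C) (hn : 0 < n) (q : ℝ × ℝ) :
    |Gc P Q PU PV val lam n q| ≤ 2 * C + lam / 2 * K ^ 4 := by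
  have hn' : (0 : ℝ) < n := by exact_mod_cast hn
  have hp := prob_pv (mus P Q n)
  set γ := gm n (lam / n) (sSeq n * q.1 ^ 2) (sSeq n * q.2 ^ 2) with hγ
  have u0 : 0 ≤ 1 / (n : ℝ) * EWu (pv (mus P Q n)) (XX val n) (YY val n) γ := mul_nonneg (by positivity) (EWu_nonneg hp γ)
  have v0 : 0 ≤ 1 / (n : ℝ) * EWv (pv (mus P Q n)) (XX val n) (YY val n) γ := mul_nonneg (by positivity) (EWv_nonneg hp γ)
  have u1 : 1 / (n : ℝ) * EWu (pv (mus P Q n)) (XX val n) (YY val n) γ ≤ K ^ 2 := by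
    have := EWu_le (X := XX val n) (Y := YY val n) (K := K) hp (fun s i => hv _) γ
    rw [one_div, inv_mul_le_iff₀ hn']; exact this
  have v1 : 1 / (n : ℝ) * EWv (pv (mus P Q n)) (XX val n) (YY val n) γ ≤ K ^ 2 := by
    have := EWv_le (X := XX val n) (Y := YY val n) (K := K) hp (fun s i => hv _) γ
    rw [one_div, inv_mul_le_iff₀ hn']; exact this
  unfold Gc rsF
  rw [← hγ]
  set a := 1 / (n : ℝ) * EWu (pv (mus P Q n)) (XX val n) (YY val n) γ
  set b := 1 / (n : ℝ) * EWv (pv (mus P Q n)) (XX val n) (YY val n) γ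
  have h1 := abs_le.1 (hC (lam * b) ⟨by positivity, by gcongr⟩).1
  have h2 := abs_le.1 (hC (lam * a) ⟨by positivity, by gcongr⟩).2
  have h3 : lam / 2 * b * a ≤ lam / 2 * K ^ 4 := by
    have : b * a ≤ K ^ 2 * K ^ 2 := mul_le_mul v1 u1 u0 (by positivity)
    calc lam / 2 * b * a = lam / 2 * (b * a) := by ring
      _ ≤ lam / 2 * (K ^ 2 * K ^ 2) := by gcongr
      _ = _ := by ring
  have h4 : 0 ≤ lam / 2 * b * a := by positivity
  rw [abs_le]
  constructor <;> linarith [h1.1, h1.2, h2.1, h2.2]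

theorem one_n (hK0 : 0 ≤ K) (hv : ∀ t, |val t| ≤ K) (he : MeasurableEmbedding val) (hPU : PU = P.map val) (hPV : PV = Q.map val)
    {lam η θ : ℝ} (hl : 0 < lam) (hn : 0 < n) (hη : 0 < η) (hθ : 0 < θ) :
    freeEnergy PU PV n lam ≤ (∫ a in (1 : ℝ)..2, ∫ b in (1 : ℝ)..2, Gc P Q PU PV val lam n (a, b))
      + (3 / 4 * lam * η * K ^ 4 + 4 * K ^ 2 * sSeq n + lam * K ^ 2 / η * (1 / (θ * n * sSeq n))
        + 15 * lam * K ^ 4 * (2 * (2 * lam * K ^ 4 + 8 * K ^ 2) ^ 2 + (lam * K ^ 4 + 8 * K ^ 2)) / (16 * η) * (θ ^ 2 * n)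
        + 3 * lam * K ^ 4 / (8 * η) * θ + lam * (1 + 1 / η) * K ^ 2 / 4 * (1 / (n * sSeq n))) := by
  have hn' : (0 : ℝ) < n := by exact_mod_cast hn
  have hn1 : (1 : ℝ) ≤ n := by exact_mod_cast hn
  have hp := prob_pv (mus P Q n)
  have hs : 0 < sSeq n := Real.rpow_pos_of_pos hn' _
  have hs1 : sSeq n ≤ 1 := Real.rpow_le_one_of_one_le_of_nonpos hn1 (by norm_num)
  have hX : ∀ s i, |XX val n s i| ≤ K := fun s i => hv _
  have hY : ∀ s i, |YY val n s i| ≤ K := fun s i => hv _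
  set C := 2 * (2 * lam * K ^ 4 + 8 * K ^ 2) ^ 2 + (lam * K ^ 4 + 8 * K ^ 2) with hC
  set E := (3 / 4 * lam * η * K ^ 4 + 4 * K ^ 2 * sSeq n + lam * K ^ 2 / η * (1 / (θ * n * sSeq n))
        + 15 * lam * K ^ 4 * C / (16 * η) * (θ ^ 2 * n)
        + 3 * lam * K ^ 4 / (8 * η) * θ + lam * (1 + 1 / η) * K ^ 2 / 4 * (1 / (n * sSeq n))) with hE
  have hG := continuous_Gc (n := n) hK0 hv he hPU hPV lam
  have key : ∀ a ∈ Set.Icc (1 : ℝ) 2, freeEnergy PU PV n lam ≤ (∫ b in (1 : ℝ)..2, Gc P Q PU PV val lam n (a, b)) + E := by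
    intro a ha
    have ha0 : 0 < a := by linarith [ha.1]
    have ha4 : a ^ 2 ≤ 4 := by nlinarith [ha.1, ha.2]
    have h1 : 0 < sSeq n * a ^ 2 := by positivity
    have h1' : sSeq n * a ^ 2 ≤ 4 * sSeq n := by nlinarith
    have hcA : Continuous (fun b : ℝ => (n : ℝ) * Gc P Q PU PV val lam n (a, b)) :=
      continuous_const.mul (hG.comp (by fun_prop : Continuous fun b : ℝ => (a, b)))
    have := main_bip hp hK0 hX hY hn (s := sSeq n) (h₁ := sSeq n * a ^ 2) (R := n * C) hl hs h1 hθ hη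
      (fun t ht => var_bound P Q val hK0 hv hn hl h1.le (by linarith) (by linarith [ht.1]) (by linarith [ht.2]))
      hcA (by
        intro b hb
        rw [fE_tensor P Q val hK0 hv he hPU hPV]
        simp only [Gc, rsF]
        set γ := gm n (lam / n) (sSeq n * a ^ 2) (sSeq n * b ^ 2) with hγ
        set wu := EWu (pv (mus P Q n)) (XX val n) (YY val n) γ
        set wv := EWv (pv (mus P Q n)) (XX val n) (YY val n) γ
        have e1 : lam * (1 / (n : ℝ) * wv) = lam / n * wv := by ring
        have e2 : lam * (1 / (n : ℝ) * wu) = lam / n * wu := by ring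
        rw [e1, e2]
        field_simp)
    rw [intervalIntegral.integral_const_mul] at this
    rw [freeEnergy_eq hK0 hv he hPU hPV, one_div, inv_mul_le_iff₀ hn']
    refine this.trans ?_
    have hb : (sSeq n * a ^ 2 + 4 * sSeq n) / 2 * (n * K ^ 2) ≤ 4 * sSeq n * (n * K ^ 2) := by
      have : 0 ≤ n * K ^ 2 := by positivity
      have h8 : (sSeq n * a ^ 2 + 4 * sSeq n) / 2 ≤ 4 * sSeq n := by linarith
      exact mul_le_mul_of_nonneg_right h8 this
    have hEe : (n : ℝ) * E = lam / (2 * n) * (3 / 2 * η * (n * K ^ 2) ^ 2) + 4 * sSeq n * (n * K ^ 2)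
      + lam / (2 * n) * (1 / (η * θ) * (4 * (n * K ^ 2) + 3 * sSeq n * (5 / 4 * θ ^ 3 * (n * K ^ 2) ^ 2 * (n * C) + 1 / 2 * θ ^ 2 * (n * K ^ 2) ^ 2))
        + (1 + 1 / η) * (n * K ^ 2)) / (2 * sSeq n) := by
      rw [hE]
      clear_value C
      field_simp
      ring
    rw [mul_add (n : ℝ) (∫ b in (1 : ℝ)..2, Gc P Q PU PV val lam n (a, b)) E, hEe]
    linarith
  have hin : Continuous (fun a : ℝ => ∫ b in (1 : ℝ)..2, Gc P Q PU PV val lam n (a, b)) :=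
    intervalIntegral.continuous_parametric_intervalIntegral_of_continuous' (f := fun a b => Gc P Q PU PV val lam n (a, b)) hG 1 2
  have hmono := intervalIntegral.integral_mono_on (a := 1) (b := 2) (μ := volume) (by norm_num) (f := fun _ => freeEnergy PU PV n lam)
    (g := fun a : ℝ => (∫ b in (1 : ℝ)..2, Gc P Q PU PV val lam n (a, b)) + E) (by simp)
    ((hin.add continuous_const).intervalIntegrable _ _) key
  rw [intervalIntegral.integral_add (hin.intervalIntegrable _ _) (by simp), intervalIntegral.integral_const, intervalIntegral.integral_const] at hmono
  norm_num at hmono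
  exact hmono

lemma rs_eq (hK0 : 0 ≤ K) (hv : ∀ t, |val t| ≤ K) (he : MeasurableEmbedding val) (hPU : PU = P.map val) (hPV : PV = Q.map val) (lam : ℝ) :
    (∫ au in (1 : ℝ)..2, ∫ av in (1 : ℝ)..2, rsF PU PV lam (EovV PU PV lam 0 0 n au av) (EovU PU PV lam 0 0 n au av))
      = ∫ a in (1 : ℝ)..2, ∫ b in (1 : ℝ)..2, Gc P Q PU PV val lam n (a, b) := by
  have hs : 0 ≤ sSeq n := Real.rpow_nonneg (Nat.cast_nonneg n) _
  refine intervalIntegral.integral_congr fun a ha => ?_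
  refine intervalIntegral.integral_congr fun b hb => ?_
  rw [Set.uIcc_of_le (by norm_num)] at ha hb
  simp only [Gc]
  rw [EovV_eq hK0 hv he hPU hPV hs (by linarith [ha.1]) (by linarith [hb.1]),
    EovU_eq hK0 hv he hPU hPV hs (by linarith [ha.1]) (by linarith [hb.1])]

lemma tendsto_npow {c : ℝ} (hc : 0 < c) : Tendsto (fun n : ℕ => (n : ℝ) ^ (-c)) atTop (𝓝 0) :=
  (tendsto_rpow_neg_atTop hc).comp tendsto_natCast_atTop_atTop

/-- The error term tends to its leading part. -/
lemma tendsto_err (c0 c1 c2 c3 c4 c5 : ℝ) :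
    Tendsto (fun n : ℕ => c0 + c1 * sSeq n + c2 * (1 / ((n : ℝ) ^ (-(5 / 8 : ℝ)) * n * sSeq n))
        + c3 * (((n : ℝ) ^ (-(5 / 8 : ℝ))) ^ 2 * n)
        + c4 * (n : ℝ) ^ (-(5 / 8 : ℝ)) + c5 * (1 / (n * sSeq n))) atTop (𝓝 c0) := by
  have t1 : Tendsto (fun n : ℕ => sSeq n) atTop (𝓝 0) := tendsto_npow (by norm_num)
  have t4 : Tendsto (fun n : ℕ => (n : ℝ) ^ (-(5 / 8 : ℝ))) atTop (𝓝 0) := tendsto_npow (by norm_num)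
  have t2 : Tendsto (fun n : ℕ => 1 / ((n : ℝ) ^ (-(5 / 8 : ℝ)) * n * sSeq n)) atTop (𝓝 0) := by
    refine (tendsto_npow (c := 1 / 8) (by norm_num)).congr' ?_
    filter_upwards [eventually_gt_atTop 0] with n hn
    have hn' : (0 : ℝ) < n := by exact_mod_cast hn
    unfold sSeq
    rw [← Real.rpow_add_one hn'.ne', ← Real.rpow_add hn', one_div ((n : ℝ) ^ _), ← Real.rpow_neg hn'.le]
    norm_num
  have t3 : Tendsto (fun n : ℕ => ((n : ℝ) ^ (-(5 / 8 : ℝ))) ^ 2 * n) atTop (𝓝 0) := by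
    refine (tendsto_npow (c := 1 / 4) (by norm_num)).congr' ?_
    filter_upwards [eventually_gt_atTop 0] with n hn
    have hn' : (0 : ℝ) < n := by exact_mod_cast hn
    rw [sq, ← Real.rpow_add hn', ← Real.rpow_add_one hn'.ne']
    norm_num
  have t5 : Tendsto (fun n : ℕ => 1 / ((n : ℝ) * sSeq n)) atTop (𝓝 0) := by
    refine (tendsto_npow (c := 3 / 4) (by norm_num)).congr' ?_
    filter_upwards [eventually_gt_atTop 0] with n hn
    have hn' : (0 : ℝ) < n := by exact_mod_cast hn
    unfold sSeq
    have : (n : ℝ) * (n : ℝ) ^ (-(1 / 4 : ℝ)) = (n : ℝ) ^ ((3 / 4 : ℝ)) := by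
      rw [mul_comm, ← Real.rpow_add_one hn'.ne']; norm_num
    rw [this, one_div, ← Real.rpow_neg hn'.le]
  have := ((((tendsto_const_nhds (x := c0)).add (t1.const_mul c1)).add (t2.const_mul c2)).add (t3.const_mul c3)).add (t4.const_mul c4)
    |>.add (t5.const_mul c5)
  simpa using this

lemma fE_lower (hK0 : 0 ≤ K) (hv : ∀ t, |val t| ≤ K) (he : MeasurableEmbedding val) (hPU : PU = P.map val) (hPV : PV = Q.map val)
    {lam : ℝ} (hl : 0 < lam) (hn : 0 < n) : psiF PU 0 + psiF PV 0 ≤ freeEnergy PU PV n lam := by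
  have hn' : (0 : ℝ) < n := by exact_mod_cast hn
  rw [freeEnergy_eq hK0 hv he hPU hPV, one_div, le_inv_mul_iff₀ hn', mul_add, ← fE_tensor P Q val hK0 hv he hPU hPV]
  have hg : Continuous (fun e : ℝ => gm n (lam / n) e e) :=
    (continuous_gm n).comp (by fun_prop : Continuous fun e : ℝ => (lam / (n : ℝ), e, e))
  have hc : Continuous (fun e : ℝ => fE (pv (mus P Q n)) (XX val n) (YY val n) (gm n (lam / n) e e)) := (continuous_fE hK0 hv).comp hg
  have ht : Tendsto (fun e : ℝ => fE (pv (mus P Q n)) (XX val n) (YY val n) (gm n (lam / n) e e)) (𝓝[>] 0)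
      (𝓝 (fE (pv (mus P Q n)) (XX val n) (YY val n) (gm n (lam / n) 0 0))) := (hc.tendsto 0).mono_left nhdsWithin_le_nhds
  refine ge_of_tendsto ht ?_
  filter_upwards [self_mem_nhdsWithin] with e he0
  exact f_mono (prob_pv _) (by positivity : 0 ≤ K ^ 2 + K)
    (xx_le (X := XX val n) (Y := YY val n) hK0 (fun s i => hv _) (fun s i => hv _)) (gm_nonneg le_rfl le_rfl le_rfl)
    (gm_pos (by positivity) he0 he0) (gm_mono (by positivity) (le_of_lt he0) (le_of_lt he0))

theorem final (hK0 : 0 ≤ K) (hv : ∀ t, |val t| ≤ K) (he : MeasurableEmbedding val) (hPU : PU = P.map val) (hPV : PV = Q.map val)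
    {lam : ℝ} (hl : 0 < lam) :
    limsup (fun n : ℕ => freeEnergy PU PV n lam) atTop
      ≤ limsup (fun n : ℕ => ∫ au in (1 : ℝ)..2, ∫ av in (1 : ℝ)..2,
          rsF PU PV lam (EovV PU PV lam 0 0 n au av) (EovU PU PV lam 0 0 n au av)) atTop := by
  simp only [rs_eq hK0 hv he hPU hPV lam]
  set R : ℕ → ℝ := fun n => ∫ a in (1 : ℝ)..2, ∫ b in (1 : ℝ)..2, Gc P Q PU PV val lam n (a, b) with hR
  set F : ℕ → ℝ := fun n => freeEnergy PU PV n lam with hF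
  obtain ⟨C1, hC1⟩ := isCompact_Icc.exists_bound_of_continuousOn (s := Set.Icc 0 (lam * K ^ 2)) (continuous_psiF P hK0 hv he hPU).continuousOn
  obtain ⟨C2, hC2⟩ := isCompact_Icc.exists_bound_of_continuousOn (s := Set.Icc 0 (lam * K ^ 2)) (continuous_psiF Q hK0 hv he hPV).continuousOn
  set B := 2 * max C1 C2 + lam / 2 * K ^ 4 with hB
  have hRB : ∀ n : ℕ, 0 < n → |R n| ≤ B := by
    intro n hn
    have hG := abs_Gc_le (P := P) (Q := Q) (PU := PU) (PV := PV) (C := max C1 C2) hK0 hv hl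
      (fun g hg => ⟨(hC1 g hg).trans (le_max_left _ _), (hC2 g hg).trans (le_max_right _ _)⟩) hn
    have h1 : ∀ a : ℝ, ‖∫ b in (1 : ℝ)..2, Gc P Q PU PV val lam n (a, b)‖ ≤ B := by
      intro a
      have := intervalIntegral.norm_integral_le_of_norm_le_const (a := 1) (b := 2) (f := fun b => Gc P Q PU PV val lam n (a, b)) (C := B)
        (fun b _ => hG (a, b))
      norm_num at this
      exact this
    have := intervalIntegral.norm_integral_le_of_norm_le_const (a := 1) (b := 2)
      (f := fun a => ∫ b in (1 : ℝ)..2, Gc P Q PU PV val lam n (a, b)) (C := B) (fun a _ => h1 a)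
    norm_num at this
    exact this
  have evn : ∀ᶠ n : ℕ in atTop, 0 < n := eventually_gt_atTop 0
  have bR : IsBoundedUnder (· ≤ ·) atTop R := ⟨B, by
    rw [eventually_map]; filter_upwards [evn] with n hn; exact (abs_le.1 (hRB n hn)).2⟩
  have bRe : ∀ {ε : ℝ}, IsBoundedUnder (· ≤ ·) atTop (fun n => R n + ε) := fun {ε} => ⟨B + ε, by
    rw [eventually_map]; filter_upwards [evn] with n hn; linarith [(abs_le.1 (hRB n hn)).2]⟩
  have bR2 : IsBoundedUnder (· ≥ ·) atTop R := ⟨-B, by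
    rw [eventually_map]; filter_upwards [evn] with n hn; exact (abs_le.1 (hRB n hn)).1⟩
  have bF : IsBoundedUnder (· ≥ ·) atTop F := ⟨psiF PU 0 + psiF PV 0, by
    rw [eventually_map]; filter_upwards [evn] with n hn; exact fE_lower hK0 hv he hPU hPV hl hn⟩
  refine le_of_forall_pos_le_add fun ε hε => ?_
  have hη : ∃ η : ℝ, 0 < η ∧ 3 / 4 * lam * η * K ^ 4 < ε := by
    refine ⟨ε / (3 / 4 * lam * K ^ 4 + 1), by positivity, ?_⟩
    have hd : 0 < 3 / 4 * lam * K ^ 4 + 1 := by positivity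
    have e : 3 / 4 * lam * (ε / (3 / 4 * lam * K ^ 4 + 1)) * K ^ 4 = ε * (3 / 4 * lam * K ^ 4) / (3 / 4 * lam * K ^ 4 + 1) := by ring
    rw [e, div_lt_iff₀ hd]
    nlinarith
  obtain ⟨η, hη0, hηε⟩ := hη
  have hle : ∀ᶠ n : ℕ in atTop, F n ≤ R n + ε := by
    filter_upwards [evn, (tendsto_err (3 / 4 * lam * η * K ^ 4) (4 * K ^ 2) (lam * K ^ 2 / η)
      (15 * lam * K ^ 4 * (2 * (2 * lam * K ^ 4 + 8 * K ^ 2) ^ 2 + (lam * K ^ 4 + 8 * K ^ 2)) / (16 * η))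
      (3 * lam * K ^ 4 / (8 * η)) (lam * (1 + 1 / η) * K ^ 2 / 4)).eventually_lt_const hηε] with n hn hlt
    have hn' : (0 : ℝ) < n := by exact_mod_cast hn
    have := one_n (n := n) hK0 hv he hPU hPV hl hn hη0 (Real.rpow_pos_of_pos hn' (-(5 / 8 : ℝ)))
    simp only [hF, hR]
    linarith
  calc limsup F atTop ≤ limsup (fun n => R n + ε) atTop :=
        limsup_le_limsup hle bF.isCoboundedUnder_le bRe
    _ = limsup R atTop + ε := limsup_add_const atTop R ε bR bR2.isCoboundedUnder_le

end final
end ASS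

namespace ASS

lemma map_comap_supp {PU : Measure ℝ} (S : Finset ℝ) (h : PU ((↑S : Set ℝ)ᶜ) = 0) :
    (PU.comap (Subtype.val : ↥(S : Set ℝ) → ℝ)).map Subtype.val = PU := by
  rw [(MeasurableEmbedding.subtype_coe S.finite_toSet.measurableSet).map_comap, Subtype.range_coe]
  exact Measure.restrict_eq_self_of_ae_mem (by rw [ae_iff]; exact h)

lemma prob_comap {PU : Measure ℝ} [IsProbabilityMeasure PU] (S : Finset ℝ) (h : PU ((↑S : Set ℝ)ᶜ) = 0) :
    IsProbabilityMeasure (PU.comap (Subtype.val : ↥(S : Set ℝ) → ℝ)) := by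
  have h1 := map_comap_supp S h
  refine ⟨?_⟩
  have h2 : PU Set.univ = 1 := measure_univ
  rw [← h1, Measure.map_apply measurable_subtype_coe MeasurableSet.univ, Set.preimage_univ] at h2
  exact h2

end ASS

/-- **Upper bound via the Aizenman–Sims–Starr scheme** (perturbed model with
`q_u = q_v = 0`, `s_n = n^{-1/4}`, `(a_u,a_v)` uniform on `[1,2]²`):
`limsup F_n ≤ limsup E_a[𝓕(λ, E⟨v⁽¹⁾·v⁽²⁾⟩_n, E⟨u⁽¹⁾·u⁽²⁾⟩_n)]`. -/
theorem aizenman_sims_starr_upper_bound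
    (K₀ : ℝ) (S : Finset ℝ) (hSK : ∀ x ∈ S, |x| ≤ K₀)
    (PU PV : Measure ℝ) [IsProbabilityMeasure PU] [IsProbabilityMeasure PV]
    (hUS : PU ((↑S : Set ℝ)ᶜ) = 0) (hVS : PV ((↑S : Set ℝ)ᶜ) = 0)
    (hUvar : 0 < (∫ x, x ^ 2 ∂PU) - (∫ x, x ∂PU) ^ 2)
    (hVvar : 0 < (∫ x, x ^ 2 ∂PV) - (∫ x, x ∂PV) ^ 2)
    (lam : ℝ) (hlam : 0 < lam) :
    Filter.limsup (fun n => freeEnergy PU PV n lam) atTop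
      ≤ Filter.limsup
          (fun n =>
            ∫ au in (1 : ℝ)..2, ∫ av in (1 : ℝ)..2,
              rsF PU PV lam (EovV PU PV lam 0 0 n au av) (EovU PU PV lam 0 0 n au av))
          atTop := by
  haveI : IsProbabilityMeasure (PU.comap (Subtype.val : ↥(S : Set ℝ) → ℝ)) :=
    ASS.prob_comap S hUS
  haveI : IsProbabilityMeasure (PV.comap (Subtype.val : ↥(S : Set ℝ) → ℝ)) :=
    ASS.prob_comap S hVS
  have he : MeasurableEmbedding (Subtype.val : ↥(S : Set ℝ) → ℝ) := MeasurableEmbedding.subtype_coe S.finite_toSet.measurableSet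
  have hv : ∀ t : ↥(S : Set ℝ), |(t : ℝ)| ≤ |K₀| := fun t => (hSK t t.2).trans (le_abs_self _)
  exact ASS.final (abs_nonneg K₀) hv he (ASS.map_comap_supp S hUS).symm (ASS.map_comap_supp S hVS).symm hlam
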